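/- There exists a function ε : (0,∞) → (0,∞) with the property that for every α ∈ (0, 1/6), ε(δ)/δ^{1/6−α} → 0 as δ → 0⁺, such that the following holds for every n ≥ 1 and every δ > 0: if U is a unitary n×n complex matrix and K is a Hermitian n×n matrix with ‖K‖ ≤ 1 and ‖[U, K]‖ ≤ δ, then there exist a unitary n×n matrix U′ and a Hermitian n×n matrix K′ with ‖K′‖ ≤ 1, U′K′ = K′U′, ‖U − U′‖ ≤ ε(δ), and ‖K − K′‖ ≤ ε(δ). The function ε does not depend on the dimension n. -/

import Mathlib

open Matrix

noncomputable section

namespace AC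

variable {m : Type*} [Fintype m] [DecidableEq m]

/-- The ℓ² operator norm of a complex matrix. -/
def opNorm (A : Matrix m m ℂ) : ℝ :=
  ‖Matrix.toEuclideanCLM (𝕜 := ℂ) A‖

/-- `(H₁, H₂, H₃)` is a δ-representation of the sphere: each `Hᵣ` is Hermitian, all
commutators have ℓ²-operator norm at most `δ`, and `‖H₁² + H₂² + H₃² − I‖ ≤ δ`. -/
def IsSphereRep (δ : ℝ) (H₁ H₂ H₃ : Matrix m m ℂ) : Prop :=
  H₁.IsHermitian ∧ H₂.IsHermitian ∧ H₃.IsHermitian ∧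
  opNorm (H₁ * H₂ - H₂ * H₁) ≤ δ ∧
  opNorm (H₁ * H₃ - H₃ * H₁) ≤ δ ∧
  opNorm (H₂ * H₃ - H₃ * H₂) ≤ δ ∧
  opNorm (H₁ ^ 2 + H₂ ^ 2 + H₃ ^ 2 - 1) ≤ δ

/-- The 2n×2n Hermitian block matrix `S(H₁,H₂,H₃) = [[H₃, H₁ − iH₂], [H₁ + iH₂, −H₃]]`. -/
def sphS (H₁ H₂ H₃ : Matrix m m ℂ) : Matrix (m ⊕ m) (m ⊕ m) ℂ :=
  Matrix.fromBlocks H₃ (H₁ - Complex.I • H₂) (H₁ + Complex.I • H₂) (-H₃)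

open Classical in
/-- The Bott index: the number of positive eigenvalues (with multiplicity) of
`S(H₁,H₂,H₃)` minus `n`.  (Junk value `0` if `S(H₁,H₂,H₃)` is not Hermitian.) -/
def bott (H₁ H₂ H₃ : Matrix m m ℂ) : ℤ :=
  if h : (sphS H₁ H₂ H₃).IsHermitian then
    ((Finset.univ.filter fun i => 0 < h.eigenvalues i).card : ℤ) - Fintype.card m
  else 0

end AC

set_option linter.unusedSectionVars false

/-- A cone of positive elements in a star ring, with the closure properties of the positive
cone of a C*-algebra that are used below. -/
class PosCone (R : Type*) [Ring R] [StarRing R] where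
  pos : R → Prop
  pos_one : pos 1
  pos_add : ∀ {a b : R}, pos a → pos b → pos (a + b)
  pos_conj : ∀ {a : R} (c : R), pos a → pos (star c * a * c)
  pos_star : ∀ {a : R}, pos a → star a = a
  pos_antisymm : ∀ {a : R}, pos a → pos (-a) → a = 0
  proper : ∀ {a : R}, star a * a = 0 → a = 0
  pos_sqrt : ∀ {a : R}, pos a → ∃ c, pos c ∧ c * c = a
  pos_comm : ∀ {a z : R}, pos a → Commute (a * a) z → Commute a z

namespace PosCone

section basic

variable {R : Type*} [Ring R] [StarRing R] [PosCone R]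

lemma pos_star_mul_self (c : R) : pos (star c * c) := by
  simpa using pos_conj c (pos_one (R := R))

lemma pos_mul {a b : R} (ha : pos a) (hb : pos b) (h : Commute a b) : pos (a * b) := by
  obtain ⟨c, hc, rfl⟩ := pos_sqrt ha
  have hcb : Commute c b := pos_comm hc h
  have := pos_conj c hb
  rwa [pos_star hc, hcb.eq, mul_assoc, ← h.eq] at this

lemma pos_mul_self {a : R} (ha : star a = a) : pos (a * a) := by
  simpa [ha] using pos_star_mul_self a

lemma eq_zero_of_pos_add {a b : R} (ha : pos a) (hb : pos b) (h : a + b = 0) : a = 0 := by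
  refine pos_antisymm ha ?_
  rwa [← eq_neg_iff_add_eq_zero.2 ((add_comm b a).trans h)]

lemma mul_eq_zero_of_conj {a f : R} (ha : pos a) (h : star f * a * f = 0) : a * f = 0 := by
  obtain ⟨c, hc, rfl⟩ := pos_sqrt ha
  have : c * f = 0 := by
    apply proper
    rw [star_mul, pos_star hc, ← h]; noncomm_ring
  rw [mul_assoc, this, mul_zero]

lemma mul_eq_zero_of_mul_self {a f : R} (ha : star a = a) (h : a * a * f = 0) : a * f = 0 := by
  apply proper
  rw [star_mul, ha, mul_assoc, ← mul_assoc a, h, mul_zero]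

/-- A self-adjoint element with positive product against a commuting positive element of
smaller kernel is positive. -/
lemma pos_of_pos_mul {a k : R} (ha : star a = a) (hk : pos k)
    (hka : Commute k a) (hp : pos (k * a)) (hker : ∀ f, k * f = 0 → a * f = 0) : pos a := by
  obtain ⟨A, hA, hAA⟩ := pos_sqrt (pos_mul_self ha)
  have hAa : Commute A a := pos_comm hA (by rw [hAA]; exact (Commute.refl a).mul_left (.refl a))
  have hAk : Commute A k := pos_comm hA (by rw [hAA]; exact hka.symm.mul_left hka.symm)
  set n := A - a with hn
  have hns : star n = n := by rw [hn, star_sub, ha, pos_star hA]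
  have hnA : Commute n A := (Commute.refl A).sub_left hAa.symm
  have hna : Commute n a := hAa.sub_left (.refl a)
  have hnk : Commute n k := hAk.sub_left hka.symm
  have e1 : (A + a) * n = 0 := by
    rw [hn, mul_sub, add_mul, add_mul, hAA, hAa.eq]; abel
  have e2 : n * n = -(a * n + a * n) := by
    have : n * n = (A + a) * n - (a * n + a * n) := by rw [hn]; noncomm_ring
    rw [this, e1, zero_sub]
  have e3 : n * n = A * n + A * n := by
    have : n * n = (A * n + A * n) - (A + a) * n := by rw [hn]; noncomm_ring
    rw [this, e1, sub_zero]
  have p1 : pos (n * (k * a) * n) := by simpa [hns] using pos_conj n hp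
  have p2 : pos (k * (n * A * n)) := by
    refine pos_mul hk (by simpa [hns] using pos_conj n hA) ?_
    exact (hnk.symm.mul_right hAk.symm).mul_right hnk.symm
  have p3 : pos (-(k * (n * n * n))) := by
    have : -(k * (n * n * n)) = n * (k * a) * n + n * (k * a) * n := by
      have h1 : n * (k * a) * n = k * (n * (a * n)) := by
        rw [← mul_assoc n, hnk.eq]; noncomm_ring
      rw [h1, mul_assoc n n n, e2]; noncomm_ring
    rw [this]; exact pos_add p1 p1
  have p4 : pos (k * (n * n * n)) := by
    have : k * (n * n * n) = k * (n * A * n) + k * (n * A * n) := by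
      rw [mul_assoc n n n, e3]; noncomm_ring
    rw [this]; exact pos_add p2 p2
  have h3 : k * (n * n * n) = 0 := pos_antisymm p4 p3
  have h4 : a * (n * n * n) = 0 := hker _ h3
  have h5 : (n * n) * ((n * n) * 1) = 0 := by
    have h : n * n * (n * n * 1) = n * n * n * n := by noncomm_ring
    have h' : n * n * n * n = (n * n) * (n * n) := by noncomm_ring
    have h'' : a * n * (n * n) = a * (n * n * n) := by noncomm_ring
    rw [h, h', e2, neg_mul, add_mul, ← e2, h'', h4]; simp
  have h6 : n * n * 1 = 0 := mul_eq_zero_of_mul_self (a := n * n) (f := 1)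
    (by rw [star_mul, hns]) (by rw [mul_assoc]; exact h5)
  have h7 : n = 0 := proper (by rw [hns]; simpa using h6)
  have h8 : a = A := (sub_eq_zero.1 (hn.symm.trans h7)).symm
  rw [h8]; exact hA

end basic

end PosCone

/-- A commutative ring acting on a star ring by left multiplication with commuting self-adjoint
elements. -/
class RealAction (C R : Type*) [CommRing C] [Ring R] [StarRing R] extends Module C R where
  smul_mul : ∀ (a : C) (f g : R), (a • f) * g = a • (f * g)
  star_mul_smul : ∀ (a : C) (f g : R), star f * (a • g) = star (a • f) * g

namespace RealAction
open PosCone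

section basic


variable {C R : Type*} [CommRing C] [Ring R] [StarRing R] [PosCone R] [RealAction C R]

variable (R) in
/-- Positivity of an acting element. -/
def Pos (a : C) : Prop := pos (a • (1 : R))

lemma smul_one_mul' (a : C) (f : R) : (a • (1 : R)) * f = a • f := by
  rw [smul_mul, one_mul]

lemma star_smul_one (a : C) : star (a • (1 : R)) = a • (1 : R) := by
  have := star_mul_smul (R := R) a 1 1
  simpa using this.symm

lemma smul_one_mul_smul_one (a b : C) : (a • (1 : R)) * (b • (1 : R)) = (a * b) • (1 : R) := by
  rw [smul_one_mul', mul_smul]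

lemma commute_smul_one (a b : C) : Commute (a • (1 : R)) (b • (1 : R)) := by
  rw [Commute, SemiconjBy, smul_one_mul_smul_one, smul_one_mul_smul_one, mul_comm]

lemma Pos.conj {a : C} (h : Pos R a) (f : R) : pos (star f * (a • f)) := by
  have := pos_conj f h
  rwa [mul_assoc, smul_one_mul'] at this

lemma Pos.add {a b : C} (ha : Pos R a) (hb : Pos R b) : Pos R (a + b) := by
  rw [Pos, add_smul]; exact pos_add ha hb

lemma Pos.mul {a b : C} (ha : Pos R a) (hb : Pos R b) : Pos R (a * b) := by
  rw [Pos, ← smul_one_mul_smul_one]; exact pos_mul ha hb (commute_smul_one a b)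

lemma Pos.one : Pos R (1 : C) := by rw [Pos, one_smul]; exact pos_one

lemma Pos.mul_self (a : C) : Pos R (a * a) := by
  rw [Pos, ← smul_one_mul_smul_one]; exact pos_mul_self (star_smul_one a)

lemma smul_eq_zero_of_mul_self {a : C} {f : R} (h : (a * a) • f = 0) : a • f = 0 := by
  have := mul_eq_zero_of_mul_self (star_smul_one (R := R) a) (f := f)
    (by rw [smul_one_mul_smul_one, smul_one_mul', h])
  rwa [smul_one_mul'] at this

lemma Pos.smul_eq_zero_of_conj {a : C} {f : R} (ha : Pos R a) (h : star f * (a • f) = 0) :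
    a • f = 0 := by
  have := mul_eq_zero_of_conj ha (f := f) (by rw [mul_assoc, smul_one_mul', h])
  rwa [smul_one_mul'] at this

lemma Pos.smul_eq_zero_left {a b : C} {f : R} (ha : Pos R a) (hb : Pos R b)
    (h : (a + b) • f = 0) : a • f = 0 := by
  refine ha.smul_eq_zero_of_conj (eq_zero_of_pos_add (ha.conj f) (hb.conj f) ?_)
  rw [← mul_add, ← add_smul, h, mul_zero]

lemma Pos.smul_eq_zero_right {a b : C} {f : R} (ha : Pos R a) (hb : Pos R b)
    (h : (a + b) • f = 0) : b • f = 0 :=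
  hb.smul_eq_zero_left ha (by rwa [add_comm])

lemma star_smul_eq (a : C) (f : R) : star (a • f) = star f * (a • (1 : R)) := by
  rw [← smul_one_mul', star_mul, star_smul_one]

lemma mul_smul_one_eq_zero {a : C} {f : R} (h : a • star f = 0) : f * (a • (1 : R)) = 0 := by
  have := star_smul_eq a (star f)
  rw [h, star_zero, star_star] at this
  exact this.symm

end basic

/-- One side (even or odd arcs) of the winding construction, in the exact limit. -/
structure Side (C R : Type*) [CommRing C] [Ring R] [StarRing R] [PosCone R] [RealAction C R]
    (x y c S H w Y q I A G : C) (J : R) : Prop where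
  cH : c * H = x
  SH : S * H = (1 - x * x) * y
  cS : c * c + S * S = 1
  posH : Pos R H
  posx : Pos R (1 - x * x)
  posw : Pos R w
  hw : w + w = 1 + x
  hY : Y = w * w * y
  posY : Pos R (1 - 2 * (Y * Y))
  qI : q * q + I * I = 1
  rel_re : q + Y * I = c - Y * S
  rel_im : I - Y * q = S + Y * c
  posA : Pos R A
  hA : A * A = I * I
  posG : Pos R G
  posGq : Pos R (2 * G - q)
  hG : G * G = G * q
  J_star : star J = J
  J_sq : J * J = 1
  JI : J * (I • 1) = A • 1
  Jq : Commute J (q • 1)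
  JG : Commute J (G • 1)

namespace Side

variable {C R : Type*} [CommRing C] [Ring R] [StarRing R] [PosCone R] [RealAction C R]
  {x y c S H w Y q I A G : C} {J : R}

lemma y_smul_eq_zero (s : Side C R x y c S H w Y q I A G J) {f : R} (hf : q • f = f) :
    y • f = 0 := by
  have hI : I • f = 0 := by
    apply smul_eq_zero_of_mul_self
    have : I * I = 1 - q * q := by linear_combination s.qI
    rw [this, sub_smul, mul_smul, hf, hf, one_smul, sub_self]
  have h1 : f = c • f - (Y * S) • f := by
    have := congrArg (· • f) s.rel_re
    simp only [add_smul, sub_smul, mul_smul, hI, hf, smul_zero, add_zero] at this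
    rw [mul_smul]; exact this
  have h2 : -(Y • f) = S • f + (Y * c) • f := by
    have := congrArg (· • f) s.rel_im
    simp only [add_smul, sub_smul, mul_smul, hI, hf, zero_sub] at this
    rw [mul_smul]; exact this
  have h3 : ((1 - x * x) * (1 + Y * Y) * y + 2 * (w * w * H * y)) • f = 0 := by
    have e : (1 - x * x) * (1 + Y * Y) * y + 2 * (w * w * H * y) =
      (1 + Y * Y) * S * H + 2 * Y * H := by rw [s.hY]; linear_combination -(1+Y*Y) * s.SH -
        (Y + w * w * y) * ((1 - x * x) * y - S * H) * s.hY
    rw [e]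
    linear_combination (norm := module) (-H) • h2 + (H * Y) • h1
  have pyy := Pos.mul_self (R := R) y
  have p1 : Pos R ((1 - x * x) * (1 + Y * Y) * (y * y)) :=
    (s.posx.mul (Pos.one.add (Pos.mul_self Y))).mul pyy
  have p2 : Pos R (w * w * H * (y * y)) := ((Pos.mul_self w).mul s.posH).mul pyy
  have h4 : ((1 - x * x) * (1 + Y * Y) * (y * y) + (w * w * H * (y * y) + w * w * H * (y * y))) • f
      = 0 := by
    linear_combination (norm := module) y • h3
  have h5 := p1.smul_eq_zero_left (p2.add p2) h4
  have h6 := p2.smul_eq_zero_left p2 (p1.smul_eq_zero_right (p2.add p2) h4)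
  have h7 : ((1 - x * x) * (y * y)) • f = 0 := by
    refine (s.posx.mul pyy).smul_eq_zero_left ((s.posx.mul pyy).mul (Pos.mul_self Y)) ?_
    linear_combination (norm := module) h5
  have h8 : ((1 - x * x) * y) • f = 0 := by
    apply smul_eq_zero_of_mul_self
    linear_combination (norm := module) (1 - x * x) • h7
  have hHH : H * H = x * x + ((1 - x * x) * y) * ((1 - x * x) * y) := by
    linear_combination (-H * H) * s.cS + (c * H + x) * s.cH + (S * H + (1 - x * x) * y) * s.SH
  have h9 : (w * x * y) • f = 0 := by
    apply smul_eq_zero_of_mul_self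
    have : w * x * y * (w * x * y) = H * (w * w * H * (y * y))
      - w * w * (y * y) * ((1 - x * x) * y) * ((1 - x * x) * y) := by
      linear_combination -(w * w * y * y) * hHH
    rw [this, sub_smul, mul_smul, h6, mul_smul _ ((1 - x * x) * y), h8]; simp
  have h10 : (w * y) • f = 0 := by
    linear_combination (norm := module) w • h8 + x • h9
  have hYf : Y • f = 0 := by
    rw [s.hY]; linear_combination (norm := module) w • h10
  have hcf : c • f = f := by
    rw [mul_comm, mul_smul, hYf, smul_zero, sub_zero] at h1; exact h1.symm
  have hHf : H • f = x • f := by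
    rw [← s.cH, mul_comm, mul_smul, hcf]
  have h11 : (H + 1) • y • f = 0 := by
    have e : (1 + x) • y • f = 0 := by
      rw [← s.hw]; linear_combination (norm := module) (2 : C) • h10
    linear_combination (norm := module) y • hHf + e
  simpa using s.posH.smul_eq_zero_right Pos.one h11

lemma G_smul_commutator (s : Side C R x y c S H w Y q I A G J) {z : C}
    (hz : ∀ f : R, y • f = 0 → z • f = 0) :
    G • (J * (z • 1) - z • J) = 0 := by
  have hz1 : z • J = (z • (1 : R)) * J := (smul_one_mul' z J).symm
  set D : R := J * (z • 1) - z • J with hD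
  have hDs : star D = -D := by
    rw [hD, star_sub, star_mul, star_smul_one, hz1, star_mul, star_smul_one, s.J_star]; abel
  have hIJ : I • J = A • (1 : R) := by
    have := congrArg star s.JI
    rw [star_mul, star_smul_one, star_smul_one, s.J_star, smul_one_mul'] at this
    exact this
  have hAJ : A • J = I • (1 : R) := by
    rw [← smul_one_mul', ← s.JI, mul_assoc, smul_one_mul', hIJ, ← s.JI, ← mul_assoc, s.J_sq,
      one_mul]
  have hID : I • D = 0 := by
    rw [hD, smul_sub, ← smul_mul, hIJ, smul_one_mul', smul_comm I z J, hIJ, smul_comm, sub_self]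
  have hIIq : (q * q) • D = D := by
    have : q * q = 1 - I * I := by linear_combination s.qI
    rw [this, sub_smul, mul_smul, hID, smul_zero, one_smul, sub_zero]
  have hqf : q • ((1 + q) • D) = (1 + q) • D := by
    linear_combination (norm := module) hIIq
  have hzf : z • (1 + q) • D = 0 := hz _ (s.y_smul_eq_zero hqf)
  have hDz : D * (((1 + q) * z) • (1 : R)) = 0 := by
    apply mul_smul_one_eq_zero
    rw [hDs, smul_neg, mul_comm, mul_smul, hzf, neg_zero]
  have hJD : J * D = -(D * J) := by
    rw [hD, mul_sub, sub_mul, ← mul_assoc, s.J_sq, one_mul, hz1]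
    simp only [mul_assoc, s.J_sq, mul_one]; abel
  have hJq : Commute J ((1 + q) • (1 : R)) := by
    rw [add_smul, one_smul]; exact (Commute.one_right J).add_right s.Jq
  have hf : (1 + q) • D = 0 := by
    apply proper
    rw [← star_mul_smul, hDs, smul_smul, ← smul_one_mul' ((1 + q) * (1 + q)), ← mul_assoc]
    nth_rw 2 [hD]
    rw [mul_sub, mul_assoc, ← mul_assoc _ J, ← smul_one_mul_smul_one,
      ← (hJq.mul_right hJq).eq, hz1]
    have e1 : -D * (((1 + q) • (1 : R)) * ((1 + q) • (1 : R))) * ((z • (1 : R)) * J)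
        = -(D * (((1 + q) * z) • (1 : R)) * (((1 + q) • (1 : R)) * J)) := by
      rw [← smul_one_mul_smul_one, neg_mul, neg_mul]
      congr 1
      have := (commute_smul_one (R := R) (1 + q) z).eq
      simp only [mul_assoc]
      rw [← mul_assoc _ (z • (1 : R)) J, this, mul_assoc]
    have e2 : -D * (J * (((1 + q) • (1 : R)) * ((1 + q) • (1 : R))) * (z • (1 : R)))
        = J * (D * (((1 + q) * z) • (1 : R)) * ((1 + q) • (1 : R))) := by
      rw [← mul_assoc, ← mul_assoc, neg_mul, ← hJD, ← smul_one_mul_smul_one]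
      have := (commute_smul_one (R := R) (1 + q) z).eq
      simp only [mul_assoc]
      rw [this]
    rw [e1, e2, hDz]; simp
  refine s.posG.smul_eq_zero_left (Pos.mul_self G) ?_
  have e : (G + G * G) • D = G • (1 + q) • D := by rw [s.hG]; module
  rw [e, hf, smul_zero]

lemma commute_theta (s : Side C R x y c S H w Y q I A G J) {z : C}
    (hz : ∀ f : R, y • f = 0 → z • f = 0) : Commute (J * (G • 1)) (z • (1 : R)) := by
  have h := s.G_smul_commutator hz
  rw [Commute, SemiconjBy, ← sub_eq_zero, ← h, smul_sub, smul_one_mul', smul_comm, s.JG.eq,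
    smul_one_mul', smul_mul]

lemma theta_star (s : Side C R x y c S H w Y q I A G J) : star (J * (G • 1)) = J * (G • 1) := by
  rw [star_mul, star_smul_one, s.J_star, s.JG.eq]

lemma rel (s : Side C R x y c S H w Y q I A G J) :
    (1 - Y * Y) * I = (1 + Y * Y) * S + 2 * Y * q := by
  linear_combination s.rel_im - Y * s.rel_re

lemma commute_JA (s : Side C R x y c S H w Y q I A G J) : Commute J (A • 1) := by
  have h := s.JI
  have := congrArg star s.JI
  rw [star_mul, star_smul_one, star_smul_one, s.J_star] at this
  rw [Commute, SemiconjBy]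
  nth_rw 1 [← this]
  rw [← h, ← mul_assoc]

lemma JA (s : Side C R x y c S H w Y q I A G J) : J * (A • 1) = I • 1 := by
  rw [← s.JI, ← mul_assoc, s.J_sq, one_mul]

lemma pos_theta (s : Side C R x y c S H w Y q I A G J) :
    pos (J * (G • 1) * ((y * H) • (1 : R))) := by
  have cyH := s.commute_theta (z := y * H) (fun f hf => by rw [mul_comm, mul_smul, hf, smul_zero])
  have hYz : ∀ f : R, y • f = 0 → Y • f = 0 := fun f hf => by
    rw [s.hY, mul_smul, hf, smul_zero]
  have cY := s.commute_theta hYz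
  have pk : Pos R (1 - Y * Y + (1 - Y * Y)) := by
    have : 1 - Y * Y + (1 - Y * Y) = 1 + (1 - 2 * (Y * Y)) := by ring
    rw [this]; exact Pos.one.add s.posY
  have cK : Commute (J * (G • 1)) ((1 - Y * Y + (1 - Y * Y)) • (1 : R)) := by
    have : (1 - Y * Y) • (1 : R) = 1 - (Y • (1 : R)) * (Y • (1 : R)) := by
      rw [sub_smul, one_smul, smul_one_mul_smul_one]
    rw [add_smul, this]
    have := (Commute.one_right (J * (G • (1 : R)))).sub_right (cY.mul_right cY)
    exact this.add_right this
  have cA : Commute (J * (G • 1)) (A • (1 : R)) := s.commute_JA.mul_left (commute_smul_one _ _)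
  refine pos_of_pos_mul (k := ((1 - Y * Y + (1 - Y * Y)) * A) • (1 : R)) ?_ (pk.mul s.posA) ?_ ?_ ?_
  · rw [star_mul, star_smul_one, s.theta_star, cyH.eq]
  · rw [← smul_one_mul_smul_one]
    exact ((cK.symm.mul_right (commute_smul_one _ _)).mul_left
      (cA.symm.mul_right (commute_smul_one _ _)))
  · have e : ((1 - Y * Y + (1 - Y * Y)) * A) • (1 : R) * (J * (G • 1) * ((y * H) • (1 : R)))
        = (((1 - Y * Y) * I + (1 - Y * Y) * I) * G * y * H) • (1 : R) := by
      have h : A • (J * (G • (1 : R))) = (I * G) • (1 : R) := by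
        rw [← smul_mul, ← smul_one_mul' A J, ← s.commute_JA.eq, s.JA, smul_one_mul_smul_one]
      rw [smul_one_mul', mul_smul, ← smul_mul, h, smul_one_mul_smul_one, smul_smul]
      congr 1; ring
    have e' : ((1 - Y * Y) * I + (1 - Y * Y) * I) * G * y * H =
        2 * ((1 + Y * Y) * ((1 - x * x) * (y * y)) * G) + 2 * (2 * ((w * w) * (y * y) * H * (G * G))) := by
      rw [s.hG]
      linear_combination 2 * G * y * H * s.rel + 2 * (1 + Y * Y) * G * y * s.SH
        + 4 * q * G * y * H * s.hY
    rw [e, e', two_mul, two_mul, two_mul]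
    have p1 := ((Pos.one.add (Pos.mul_self Y)).mul (s.posx.mul (Pos.mul_self y))).mul s.posG
    have p2 := (((Pos.mul_self (R := R) w).mul (Pos.mul_self y)).mul s.posH).mul (Pos.mul_self G)
    exact (p1.add p1).add ((p2.add p2).add (p2.add p2))
  · intro f hf
    rw [smul_one_mul', mul_smul] at hf
    have hAf : A • f = 0 := by
      have e : (1 - Y * Y + (1 - Y * Y)) = 1 + (1 - 2 * (Y * Y)) := by ring
      rw [e] at hf
      simpa using Pos.one.smul_eq_zero_left s.posY hf
    have hIf : I • f = 0 := by
      rw [← smul_one_mul', ← s.JA, mul_assoc, smul_one_mul', hAf, mul_zero]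
    have hqq : (q * q) • f = f := by
      have : q * q = 1 - I * I := by linear_combination s.qI
      rw [this, sub_smul, mul_smul, hIf, smul_zero, one_smul, sub_zero]
    have hGG : (G + 1) • (G - 1) • G • f = 0 := by
      have e1 : (G * G * G) • f = G • f := by
        rw [s.hG, mul_comm (G * q), ← mul_assoc, s.hG, mul_assoc, mul_smul, hqq]
      linear_combination (norm := module) e1
    have h1 : (G - 1) • G • f = 0 := by
      simpa using s.posG.smul_eq_zero_right Pos.one hGG
    have h2 : q • G • f = G • f := by
      have e : q • G • f = (G * G) • f := by rw [s.hG, mul_comm, mul_smul]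
      rw [e]; linear_combination (norm := module) h1
    have h3 := s.y_smul_eq_zero h2
    rw [mul_assoc, smul_one_mul', mul_comm y H, mul_assoc, smul_one_mul']
    have : G • (H * y) • f = H • y • G • f := by module
    rw [this, h3, smul_zero, mul_zero]

end Side

section kernel

variable {C R : Type*} [CommRing C] [Ring R] [StarRing R] [PosCone R] [RealAction C R]

/-- On the common kernel of `I - S`, `q - c` and `S` the half-angle projections agree with the
multiplication by the sign of `c`. -/
lemma Side.G_smul_add {x y c S H w Y q I A G : C} {J : R} (s : Side C R x y c S H w Y q I A G J)
    {g : R} (hq : q • g = g) : (2 * G) • g = (2 : C) • g := by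
  have hq2 : (q * q) • g = g := by rw [mul_smul, hq, hq]
  have h : (2 * G - q + 1) • (2 * G - q - 1) • g = 0 := by
    have e : (2 * G - q + 1) * (2 * G - q - 1) = q * q - 1 := by linear_combination 4 * s.hG
    rw [smul_smul, e, sub_smul, hq2, one_smul, sub_self]
  have h1 : (2 * G - q - 1) • g = 0 := by simpa using s.posGq.smul_eq_zero_right Pos.one h
  linear_combination (norm := module) h1 + hq

lemma Side.G_smul_sub {x y c S H w Y q I A G : C} {J : R} (s : Side C R x y c S H w Y q I A G J)
    {g : R} (hq : q • g = -g) : (2 * G) • g = 0 := by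
  have hq2 : (q * q) • g = g := by rw [mul_smul, hq, smul_neg, hq, neg_neg]
  have h : (2 * G - q + 1) • (2 * G - q - 1) • g = 0 := by
    have e : (2 * G - q + 1) * (2 * G - q - 1) = q * q - 1 := by linear_combination 4 * s.hG
    rw [smul_smul, e, sub_smul, hq2, one_smul, sub_self]
  have h1 : (2 * G - q - 1) • g = 0 := by simpa using s.posGq.smul_eq_zero_right Pos.one h
  linear_combination (norm := module) h1 + hq

variable {x y c S H w Y q I A G w' Y' q' I' A' G' : C} {J J' : R}

lemma kernel_eq_zero (h2 : ∀ f : R, f + f = 0 → f = 0)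
    (s : Side C R x y c S H w Y q I A G J)
    (s' : Side C R (-x) y (-c) S H w' Y' q' I' A' G' J') {g : R}
    (hT : S • g + J * (G • g) + J' * (G' • g) = 0) (hy : y • g = 0) : g = 0 := by
  have key : ∀ {x c w Y q I A G : C} {J : R} (s : Side C R x y c S H w Y q I A G J) {g : R},
      y • g = 0 → q • g = c • g ∧ I • g = S • g := by
    intro x c w Y q I A G J s g hy
    have hY : Y • g = 0 := by rw [s.hY, mul_smul, hy, smul_zero]
    constructor
    · have := congrArg (· • g) s.rel_re
      simp only [add_smul, sub_smul, mul_comm Y, mul_smul, hY, smul_zero, add_zero,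
        sub_zero] at this
      exact this
    · have := congrArg (· • g) s.rel_im
      simp only [add_smul, sub_smul, mul_comm Y, mul_smul, hY, smul_zero, add_zero,
        sub_zero] at this
      exact this
  have hJ : ∀ {x c w Y q I A G : C} {J : R} (s : Side C R x y c S H w Y q I A G J) {g : R},
      y • g = 0 → star g * (S • (J * (G • g))) = star g * ((A * G) • g) := by
    intro x c w Y q I A G J s g hy
    rw [star_mul_smul, ← (key s hy).2, ← star_mul_smul, ← smul_one_mul' I, ← s.JA,
      s.commute_JA.eq, mul_assoc (A • (1 : R)), ← mul_assoc J J, s.J_sq, one_mul, smul_one_mul',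
      mul_smul]
  have hsum : star g * ((S * S) • g) + (star g * ((A * G) • g) + star g * ((A' * G') • g)) = 0 := by
    rw [← hJ s hy, ← hJ s' hy, ← mul_add, ← mul_add, mul_smul, ← smul_add, ← smul_add, ← add_assoc,
      hT, smul_zero, mul_zero]
  have hS : S • g = 0 := by
    apply smul_eq_zero_of_mul_self
    refine (Pos.mul_self S).smul_eq_zero_of_conj (eq_zero_of_pos_add ((Pos.mul_self S).conj g)
      (pos_add ((s.posA.mul s.posG).conj g) ((s'.posA.mul s'.posG).conj g)) hsum)
  have hcc : (c * c) • g = g := by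
    have : c * c = 1 - S * S := by linear_combination s.cS
    rw [this, sub_smul, mul_smul, hS, smul_zero, one_smul, sub_zero]
  set u := (1 + c) • g with hu
  set v := (1 - c) • g with hv
  have hyu : y • u = 0 := by rw [hu, smul_comm, hy, smul_zero]
  have hyv : y • v = 0 := by rw [hv, smul_comm, hy, smul_zero]
  have hcu : c • u = u := by rw [hu]; linear_combination (norm := module) hcc
  have hcv : c • v = -v := by rw [hv]; linear_combination (norm := module) -(1:C) • hcc
  have hqu : q • u = u := by rw [(key s hyu).1, hcu]
  have hqv : q • v = -v := by rw [(key s hyv).1, hcv]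
  have hqu' : q' • u = -u := by rw [(key s' hyu).1, neg_smul, hcu]
  have hqv' : q' • v = v := by rw [(key s' hyv).1, neg_smul, hcv, neg_neg]
  have huv : u + v = (2 : C) • g := by rw [hu, hv]; module
  have h2' : ∀ {f f' : R}, (2 : C) • f = (2 : C) • f' → f = f' := by
    intro f f' h
    refine sub_eq_zero.1 (h2 _ ?_)
    linear_combination (norm := module) h
  have hGu : G • (u + v) = u := h2' (by
    rw [smul_smul, smul_add, s.G_smul_add hqu, s.G_smul_sub hqv, add_zero])
  have hGv : G' • (u + v) = v := h2' (by
    rw [smul_smul, smul_add, s'.G_smul_sub hqu', s'.G_smul_add hqv', zero_add])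
  have hθ : J * u + J' * v = 0 := by
    have e : ∀ (J : R) (G : C), J * (G • ((2 : C) • g)) = J * (G • g) + J * (G • g) := by
      intro J G
      rw [← mul_add]; congr 1; module
    have hT' : J * (G • g) + J' * (G' • g) = 0 := by rwa [hS, zero_add] at hT
    have hJu : J * u = J * (G • g) + J * (G • g) := by rw [← e, ← huv, hGu]
    have hJv : J' * v = J' * (G' • g) + J' * (G' • g) := by rw [← e, ← huv, hGv]
    rw [hJu, hJv, add_add_add_comm, hT', add_zero]
  set h := J * u with hh
  have hh' : h = -(J' * v) := eq_neg_of_add_eq_zero_left hθ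
  have hyh : y • h = 0 := by
    have hc := s.commute_theta (z := y) (fun f hf => hf)
    rw [hh, ← hGu, huv, ← smul_one_mul' G, ← mul_assoc, ← smul_one_mul' y, ← mul_assoc, ← hc.eq,
      mul_assoc, smul_one_mul', smul_comm, hy, smul_zero, mul_zero]
  have h1 : c • h = h := by
    rw [← (key s hyh).1, hh, ← smul_one_mul', ← mul_assoc, ← s.Jq.eq, mul_assoc, smul_one_mul', hqu]
  have h3 : c • h = -h := by
    have : q' • h = h := by
      rw [hh', smul_neg, ← smul_one_mul', ← mul_assoc, ← s'.Jq.eq, mul_assoc, smul_one_mul', hqv']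
    rw [(key s' hyh).1, neg_smul] at this
    rw [← this, neg_neg, this]
  have hz : h = 0 := h2 _ (by nth_rw 1 [← h1]; rw [h3, neg_add_cancel])
  have hu0 : u = 0 := by rw [← one_mul u, ← s.J_sq, mul_assoc, ← hh, hz, mul_zero]
  have hv0 : v = 0 := by
    rw [← one_mul v, ← s'.J_sq, mul_assoc, ← neg_neg (J' * v), ← hh', hz, neg_zero, mul_zero]
  apply h2
  rw [hu0, hv0] at huv
  linear_combination (norm := module) -(1 : C) • huv

/-- The exact limit of the gap property. -/
theorem eq_zero_of_side (h2 : ∀ f : R, f + f = 0 → f = 0) {b B : C} {β : R}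
    (s : Side C R x y c S H w Y q I A G J)
    (s' : Side C R (-x) y (-c) S H w' Y' q' I' A' G' J')
    (hb : Pos R b) (hbB : b • (1 : R) = β + B • (1 : R)) (hβ : ∀ f, Commute β f)
    (hB : ∀ f : R, y • f = 0 → B • f = 0) {T p κ : R}
    (hTdef : T = -(S • (1 : R) + J * (G • 1) + J' * (G' • 1)))
    (hTp : T * p = κ) (hκ : b • κ = y • p)
    (hbig : ∃ c r : R, pos c ∧ c + star p * p = r * (star p * (b • p) + star κ * (y • p))) : p = 0 := by
  have hTs : star T = T := by
    rw [hTdef, star_neg, star_add, star_add, star_smul_one, s.theta_star, s'.theta_star]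
  have cTb : Commute T (b • (1 : R)) := by
    have : ∀ t : R, Commute t (B • (1 : R)) → Commute t (b • (1 : R)) := fun t ht => by
      rw [hbB]; exact (hβ t).symm.add_right ht
    rw [hTdef]
    exact ((((commute_smul_one S b).add_left (this _ (s.commute_theta hB))).add_left
      (this _ (s'.commute_theta hB)))).neg_left
  have hTb : ∀ f, T * (b • f) = b • (T * f) := fun f => by
    rw [← smul_one_mul' b f, ← mul_assoc, cTb.eq, mul_assoc, smul_one_mul']
  set f := b • p with hf
  have hTf : T * f = y • p := by rw [hf, hTb, hTp, hκ]
  have hpos : pos (-(T * ((y * H) • (1 : R)))) := by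
    have e : -(T * ((y * H) • (1 : R))) = ((1 - x * x) * (y * y)) • (1 : R)
        + (J * (G • 1) * ((y * H) • (1 : R)) + J' * (G' • 1) * ((y * H) • (1 : R))) := by
      rw [hTdef, neg_mul, neg_neg, add_mul, add_mul, smul_one_mul_smul_one, ← add_assoc]
      congr 3
      linear_combination y * s.SH
    rw [e]
    exact pos_add (s.posx.mul (Pos.mul_self y)) (pos_add s.pos_theta s'.pos_theta)
  have hz : (b * (y * y * H)) • p = 0 := by
    have pz : Pos R (b * (y * y * H)) := hb.mul ((Pos.mul_self y).mul s.posH)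
    refine pz.smul_eq_zero_of_conj (pos_antisymm (pz.conj p) ?_)
    have hq := pos_star hpos
    rw [star_neg, star_mul, star_smul_one, hTs, neg_inj] at hq
    have hc := pos_conj f hpos
    rw [← hq] at hc
    convert hc using 1
    rw [mul_neg, neg_mul, mul_assoc (star f), mul_assoc _ T, hTf, smul_one_mul', hf, ← star_mul_smul, smul_smul,
      smul_smul]
    congr 3; ring
  have hz' : (y * y * (x * x) + y * y * (((1 - x * x) * y) * ((1 - x * x) * y))) • f = 0 := by
    have hHH : H * H = x * x + ((1 - x * x) * y) * ((1 - x * x) * y) := by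
      linear_combination (-H * H) * s.cS + (c * H + x) * s.cH + (S * H + (1 - x * x) * y) * s.SH
    rw [← mul_add, ← hHH, hf]
    linear_combination (norm := module) H • hz
  have pyy := Pos.mul_self (R := R) y
  have p1 := pyy.mul (Pos.mul_self x)
  have p2 := pyy.mul (Pos.mul_self ((1 - x * x) * y))
  have h3 : (y * x) • f = 0 := by
    apply smul_eq_zero_of_mul_self
    linear_combination (norm := module) p1.smul_eq_zero_left p2 hz'
  have h4 : (y * ((1 - x * x) * y)) • f = 0 := by
    apply smul_eq_zero_of_mul_self
    linear_combination (norm := module) p1.smul_eq_zero_right p2 hz'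
  have hyf : y • f = 0 := by
    apply smul_eq_zero_of_mul_self
    linear_combination (norm := module) h4 + (x * y) • h3
  have hbf : b • f = 0 := by
    refine kernel_eq_zero h2 s s' ?_ (by rw [smul_comm, hyf, smul_zero])
    have : T * (b • f) = 0 := by rw [hTb, hTf, ← smul_comm y b, hyf]
    rw [hTdef, neg_mul, neg_eq_zero] at this
    simpa only [add_mul, mul_assoc, smul_one_mul'] using this
  have hf0 : f = 0 := smul_eq_zero_of_mul_self (by rw [mul_smul]; exact hbf)
  have hyp : y • p = 0 := by rw [← hTf, hf0, mul_zero]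
  obtain ⟨c, r, hc, hc'⟩ := hbig
  rw [hyp, hf0, mul_zero, mul_zero, add_zero, mul_zero, add_comm] at hc'
  exact proper (eq_zero_of_pos_add (pos_star_mul_self p) hc hc')

end kernel

end RealAction

section bicommutant
open PosCone

variable {R : Type*} [Ring R] [StarRing R]

/-- The self-adjoint part of the bicommutant of a commutative set. -/
def saBicomm (Z : Set R) (hZ : ∀ a ∈ Z, ∀ b ∈ Z, Commute a b) : Subring R where
  carrier := {a | star a = a ∧ ∀ t, (∀ z ∈ Z, Commute z t) → Commute a t}
  mul_mem' := by
    rintro a b ⟨ha, ha'⟩ ⟨hb, hb'⟩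
    have hab : Commute a b := ha' b fun z hz => (hb' z fun z' hz' => hZ z' hz' z hz).symm
    exact ⟨by rw [star_mul, ha, hb, hab.eq], fun t ht => (ha' t ht).mul_left (hb' t ht)⟩
  one_mem' := ⟨star_one R, fun t _ => Commute.one_left t⟩
  add_mem' := by
    rintro a b ⟨ha, ha'⟩ ⟨hb, hb'⟩
    exact ⟨by rw [star_add, ha, hb], fun t ht => (ha' t ht).add_left (hb' t ht)⟩
  zero_mem' := ⟨star_zero R, fun t _ => Commute.zero_left t⟩
  neg_mem' := by
    rintro a ⟨ha, ha'⟩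
    exact ⟨by rw [star_neg, ha], fun t ht => (ha' t ht).neg_left⟩

lemma saBicomm.commute {Z : Set R} {hZ : ∀ a ∈ Z, ∀ b ∈ Z, Commute a b} {a b : R}
    (ha : a ∈ saBicomm Z hZ) (hb : b ∈ saBicomm Z hZ) : Commute a b :=
  ha.2 b fun z hz => (hb.2 z fun z' hz' => hZ z' hz' z hz).symm

/-- The bicommutant as a commutative ring. -/
def Bi (Z : Set R) (hZ : ∀ a ∈ Z, ∀ b ∈ Z, Commute a b) : Type _ := saBicomm Z hZ

instance (Z : Set R) (hZ : ∀ a ∈ Z, ∀ b ∈ Z, Commute a b) : CommRing (Bi Z hZ) :=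
  { (inferInstance : Ring (saBicomm Z hZ)) with
    mul_comm := fun a b => Subtype.ext (saBicomm.commute a.2 b.2).eq }

/-- The inclusion of the bicommutant. -/
def Bi.val (Z : Set R) (hZ : ∀ a ∈ Z, ∀ b ∈ Z, Commute a b) : Bi Z hZ →+* R :=
  (saBicomm Z hZ).subtype

lemma Bi.val_injective (Z : Set R) (hZ : ∀ a ∈ Z, ∀ b ∈ Z, Commute a b) :
    Function.Injective (Bi.val Z hZ) := Subtype.val_injective

lemma Bi.star_val {Z : Set R} {hZ : ∀ a ∈ Z, ∀ b ∈ Z, Commute a b} (a : Bi Z hZ) :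
    star (Bi.val Z hZ a) = Bi.val Z hZ a := a.2.1

lemma Bi.commute_val {Z : Set R} {hZ : ∀ a ∈ Z, ∀ b ∈ Z, Commute a b} (a : Bi Z hZ) {t : R}
    (ht : ∀ z ∈ Z, Commute z t) : Commute (Bi.val Z hZ a) t := a.2.2 t ht

instance (Z : Set R) (hZ : ∀ a ∈ Z, ∀ b ∈ Z, Commute a b) : RealAction (Bi Z hZ) R :=
  { Module.compHom R (Bi.val Z hZ) with
    smul_mul := fun a f g => mul_assoc _ _ _
    star_mul_smul := fun a f g => by
      change star f * (Bi.val Z hZ a * g) = star (Bi.val Z hZ a * f) * g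
      rw [star_mul, Bi.star_val, mul_assoc] }

lemma Bi.smul_eq {Z : Set R} {hZ : ∀ a ∈ Z, ∀ b ∈ Z, Commute a b} (a : Bi Z hZ) (f : R) :
    a • f = Bi.val Z hZ a * f := rfl

lemma Bi.smul_one {Z : Set R} {hZ : ∀ a ∈ Z, ∀ b ∈ Z, Commute a b} (a : Bi Z hZ) :
    a • (1 : R) = Bi.val Z hZ a := mul_one _

lemma Bi.exists_val {Z : Set R} (hZ : ∀ a ∈ Z, ∀ b ∈ Z, Commute a b) {a : R} (ha : star a = a)
    (h : ∀ t, (∀ z ∈ Z, Commute z t) → Commute a t) : ∃ a' : Bi Z hZ, Bi.val Z hZ a' = a :=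
  ⟨⟨a, ha, h⟩, rfl⟩

lemma Bi.pos_iff [PosCone R] {Z : Set R} {hZ : ∀ a ∈ Z, ∀ b ∈ Z, Commute a b} (a : Bi Z hZ) :
    RealAction.Pos R a ↔ pos (Bi.val Z hZ a) := by rw [RealAction.Pos, Bi.smul_one]

end bicommutant

section parts

variable {R : Type*} [Ring R] [StarRing R] [Algebra ℂ R] [StarModule ℂ R]

/-- Real part. -/
def rePart (a : R) : R := (1 / 2 : ℂ) • (a + star a)

/-- Imaginary part. -/
def imPart (a : R) : R := (-Complex.I / 2 : ℂ) • (a - star a)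

lemma star_rePart (a : R) : star (rePart a) = rePart a := by
  rw [rePart, star_smul, star_add, star_star, add_comm (star a)]; simp

lemma star_imPart (a : R) : star (imPart a) = imPart a := by
  rw [imPart, star_smul, star_sub, star_star, ← neg_sub a, smul_neg, ← neg_smul]
  simp [neg_div]

lemma rePart_add_imPart (a : R) : rePart a + Complex.I • imPart a = a := by
  rw [rePart, imPart, smul_smul]
  have : Complex.I * (-Complex.I / 2) = 1 / 2 := by
    rw [mul_div_assoc', mul_neg, Complex.I_mul_I, neg_neg]
  rw [this, ← smul_add]
  have : a + star a + (a - star a) = (2 : ℂ) • a := by rw [two_smul]; abel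
  rw [this, smul_smul]; norm_num

lemma rePart_sub_imPart (a : R) : rePart a - Complex.I • imPart a = star a := by
  conv_rhs => rw [← rePart_add_imPart a, star_add, star_smul, star_rePart, star_imPart]
  simp [sub_eq_add_neg]

lemma commute_rePart {a t : R} (h : Commute a t) (h' : Commute (star a) t) :
    Commute (rePart a) t := (h.add_left h').smul_left _

lemma commute_imPart {a t : R} (h : Commute a t) (h' : Commute (star a) t) :
    Commute (imPart a) t := (h.sub_left h').smul_left _

lemma rePart_eq {a r s : R} (h : a = r + Complex.I • s) (hr : star r = r) (hs : star s = s) :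
    rePart a = r := by
  rw [rePart, h, star_add, star_smul, hr, hs]
  have : r + Complex.I • s + (r + star Complex.I • s) = (2 : ℂ) • r := by
    simp only [Complex.star_def, Complex.conj_I, neg_smul, two_smul]; abel
  rw [this, smul_smul]; norm_num

lemma imPart_eq {a r s : R} (h : a = r + Complex.I • s) (hr : star r = r) (hs : star s = s) :
    imPart a = s := by
  rw [imPart, h, star_add, star_smul, hr, hs]
  have : r + Complex.I • s - (r + star Complex.I • s) = (2 * Complex.I : ℂ) • s := by
    simp only [Complex.star_def, Complex.conj_I, neg_smul, mul_smul, two_smul]; abel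
  rw [this, smul_smul]
  have : -Complex.I / 2 * (2 * Complex.I) = 1 := by
    ring_nf; rw [Complex.I_sq]; norm_num
  rw [this, one_smul]

lemma part_mul {r s r' s' : R} :
    (r + Complex.I • s) * (r' + Complex.I • s') =
      (r * r' - s * s') + Complex.I • (r * s' + s * r') := by
  simp only [add_mul, mul_add, smul_mul_assoc, mul_smul_comm, smul_smul, Complex.I_mul_I, smul_add]
  simp only [neg_smul, one_smul]; abel

lemma rePart_sq_add_imPart_sq {a : R} (h : star a * a = 1) (h' : a * star a = 1) :
    rePart a * rePart a + imPart a * imPart a = 1 := by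
  have h1 : (rePart a + Complex.I • imPart a) * (rePart a + Complex.I • -imPart a) = 1 := by
    rw [rePart_add_imPart, smul_neg, ← sub_eq_add_neg, rePart_sub_imPart, h']
  have h2 : (rePart a + Complex.I • -imPart a) * (rePart a + Complex.I • imPart a) = 1 := by
    rw [rePart_add_imPart, smul_neg, ← sub_eq_add_neg, rePart_sub_imPart, h]
  rw [part_mul] at h1 h2
  have h3 : (2 : ℂ) • (rePart a * rePart a + imPart a * imPart a) = (2 : ℂ) • (1 : R) := by
    rw [two_smul, two_smul]
    refine Eq.trans ?_ (congrArg₂ (· + ·) h1 h2)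
    simp only [neg_mul, mul_neg, sub_neg_eq_add, smul_add, smul_neg]; abel
  have := congrArg ((1 / 2 : ℂ) • ·) h3
  simpa [smul_smul] using this

end parts

section exact
open PosCone

variable {R : Type*} [Ring R] [StarRing R] [Algebra ℂ R] [StarModule ℂ R] [PosCone R]

lemma eq_zero_of_one_sub {Y f : R} (hY : star Y = Y) (h : (1 - Complex.I • Y) * f = 0) :
    f = 0 := by
  have h1 : (1 + Complex.I • Y) * (1 + Complex.I • -Y) = 1 + Y * Y := by
    rw [part_mul]; simp
  have h2 : f + Y * Y * f = 0 := by
    rw [← one_mul f, ← mul_assoc, mul_one, ← add_mul, ← h1, smul_neg, ← sub_eq_add_neg, mul_assoc,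
      h, mul_zero]
  apply proper
  refine eq_zero_of_pos_add (pos_star_mul_self f) (b := star f * (Y * Y * f)) ?_ ?_
  · rw [← mul_assoc]; exact pos_conj f (pos_mul_self hY)
  · rw [← mul_add, h2, mul_zero]

lemma commute_star_of_unitary {E t : R} (h : star E * E = 1) (h' : E * star E = 1)
    (ht : Commute E t) : Commute (star E) t := by
  calc star E * t = star E * (t * E) * star E := by rw [mul_assoc, mul_assoc, h', mul_one]
    _ = t * star E := by rw [← ht.eq, ← mul_assoc, h, one_mul]

/-- The data of one side of the construction, as elements of a star ring. -/
structure SideData (V Y E J G : R) : Prop where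
  posY : pos (1 - (Y * Y + Y * Y))
  hE : (1 - Complex.I • Y) * E = 1 + Complex.I • Y
  E_star_mul : star E * E = 1
  E_mul_star : E * star E = 1
  J_star : star J = J
  J_sq : J * J = 1
  Jq : Commute J (E * V)
  posJ : pos (J * imPart (E * V))
  posG : pos G
  posGq : pos (G + G - rePart (E * V))
  hG : G * G = G * rePart (E * V)

lemma SideData.exists_side {Z : Set R} {hZ : ∀ a ∈ Z, ∀ b ∈ Z, Commute a b} {V E J G : R}
    {x y c S H w : Bi Z hZ} (hV : V ∈ Z) (hVs : star V ∈ Z) (hV1 : star V * V = 1)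
    (hV2 : V * star V = 1)
    (hc : Bi.val Z hZ c = rePart V) (hS : Bi.val Z hZ S = imPart V)
    (cH : c * H = x) (SH : S * H = (1 - x * x) * y) (posH : RealAction.Pos R H)
    (posx : RealAction.Pos R (1 - x * x)) (posw : RealAction.Pos R w) (hw : w + w = 1 + x)
    (d : SideData V (Bi.val Z hZ (w * w * y)) E J G) :
    ∃ q I A G' : Bi Z hZ, RealAction.Side (Bi Z hZ) R x y c S H w (w * w * y) q I A G' J ∧
      Bi.val Z hZ G' = G := by
  set Y := w * w * y with hYdef
  set φ := Bi.val Z hZ with hφ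
  have inj := Bi.val_injective Z hZ
  have hYs : star (φ Y) = φ Y := Bi.star_val Y
  have cE : ∀ t, (∀ z ∈ Z, Commute z t) → Commute E t := by
    intro t ht
    have hYt : Commute (φ Y) t := Bi.commute_val Y ht
    have hYt' : Commute (1 - Complex.I • φ Y) t :=
      (Commute.one_left t).sub_left (hYt.smul_left _)
    rw [Commute, SemiconjBy, ← sub_eq_zero]
    apply eq_zero_of_one_sub hYs
    rw [mul_sub, ← mul_assoc, d.hE, ← mul_assoc, hYt'.eq, mul_assoc, d.hE, add_mul, mul_add,
      smul_mul_assoc, hYt.eq, mul_smul_comm, one_mul, mul_one, sub_self]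
  have cEs : ∀ t, (∀ z ∈ Z, Commute z t) → Commute (star E) t := fun t ht =>
    commute_star_of_unitary d.E_star_mul d.E_mul_star (cE t ht)
  set q := E * V with hq
  have cq : ∀ t, (∀ z ∈ Z, Commute z t) → Commute q t := fun t ht => (cE t ht).mul_left (ht V hV)
  have cqs : ∀ t, (∀ z ∈ Z, Commute z t) → Commute (star q) t := fun t ht => by
    rw [hq, star_mul]; exact (ht _ hVs).mul_left (cEs t ht)
  have hq1 : star q * q = 1 := by
    rw [hq, star_mul, mul_assoc, ← mul_assoc _ E, d.E_star_mul, one_mul, hV1]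
  have hq2 : q * star q = 1 := by
    rw [hq, star_mul, mul_assoc, ← mul_assoc V, hV2, one_mul, d.E_mul_star]
  obtain ⟨qr, hqr⟩ := Bi.exists_val hZ (star_rePart q) fun t ht => commute_rePart (cq t ht) (cqs t ht)
  obtain ⟨qi, hqi⟩ := Bi.exists_val hZ (star_imPart q) fun t ht => commute_imPart (cq t ht) (cqs t ht)
  have hJqs : Commute J (star q) := by
    have := d.Jq.star_star; rwa [d.J_star] at this
  have hJr : Commute J (rePart q) := (commute_rePart d.Jq.symm hJqs.symm).symm
  have hJi : Commute J (imPart q) := (commute_imPart d.Jq.symm hJqs.symm).symm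
  have hAA : J * imPart q * (J * imPart q) = imPart q * imPart q := by
    rw [mul_assoc, ← mul_assoc (imPart q), ← hJi.eq, ← mul_assoc, ← mul_assoc, d.J_sq, one_mul]
  obtain ⟨A, hA⟩ := Bi.exists_val hZ (a := J * imPart q) (pos_star d.posJ) fun t ht => by
    refine pos_comm d.posJ ?_
    rw [hAA, ← hqi]
    exact (Bi.commute_val qi ht).mul_left (Bi.commute_val qi ht)
  have cG0 : ∀ t, Commute (rePart q) t → Commute G t := fun t ht => by
    have h1 : Commute (G + G - rePart q) t := by
      refine pos_comm d.posGq ?_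
      have hGq : Commute G (rePart q) := by
        have := congrArg star d.hG
        rw [star_mul, star_mul, star_rePart, pos_star d.posG, d.hG] at this
        exact this
      have : (G + G - rePart q) * (G + G - rePart q) = rePart q * rePart q := by
        have e : (G + G - rePart q) * (G + G - rePart q) = (4 : ℕ) • (G * G) -
          (2 : ℕ) • (G * rePart q) - (2 : ℕ) • (rePart q * G) + rePart q * rePart q := by
          noncomm_ring
        rw [e, ← hGq.eq, d.hG]; abel
      rw [this]; exact ht.mul_left ht
    have h2 : Commute (G + G) t := by simpa using h1.add_left ht
    have h3 : G = (1 / 2 : ℂ) • (G + G) := by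
      rw [← two_smul ℂ, smul_smul]; norm_num
    rw [h3]; exact h2.smul_left _
  obtain ⟨G', hG'⟩ := Bi.exists_val hZ (pos_star d.posG) fun t ht =>
    cG0 t (by rw [← hqr]; exact Bi.commute_val qr ht)
  have hYV : Commute (φ Y) V := Bi.commute_val Y fun z hz => hZ z hz V hV
  have hrel : (φ (qr + Y * qi) : R) + Complex.I • φ (qi - Y * qr)
      = φ (c - Y * S) + Complex.I • φ (S + Y * c) := by
    have h1 : (1 + Complex.I • -φ Y) * (rePart q + Complex.I • imPart q)
        = (1 + Complex.I • φ Y) * (rePart V + Complex.I • imPart V) := by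
      rw [rePart_add_imPart, rePart_add_imPart, smul_neg, ← sub_eq_add_neg, hq, ← mul_assoc, d.hE]
    rw [part_mul, part_mul, ← hqr, ← hqi, ← hc, ← hS] at h1
    simp only [map_add, map_sub, map_mul]
    convert h1 using 2
    · noncomm_ring
    · congr 1; noncomm_ring
    · noncomm_ring
    · congr 1; noncomm_ring
  have hs : ∀ a : Bi Z hZ, star (φ a) = φ a := Bi.star_val
  refine ⟨qr, qi, A, G', ⟨cH, SH, ?_, posH, posx, posw, hw, rfl, ?_, ?_, ?_, ?_, ?_, ?_, ?_, ?_, ?_,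
    d.J_star, d.J_sq, ?_, ?_, ?_⟩, hG'⟩
  · apply inj
    rw [map_add, map_mul, map_mul, map_one, hc, hS, rePart_sq_add_imPart_sq hV1 hV2]
  · rw [Bi.pos_iff]
    convert d.posY using 1
    simp [two_mul, hφ]
  · apply inj
    rw [map_add, map_mul, map_mul, map_one, hqr, hqi, rePart_sq_add_imPart_sq hq1 hq2]
  · apply inj
    rw [← hφ, ← rePart_eq rfl (hs _) (hs (qi - Y * qr)), hrel, rePart_eq rfl (hs _) (hs _)]
  · apply inj
    rw [← hφ, ← imPart_eq rfl (hs (qr + Y * qi)) (hs _), hrel, imPart_eq rfl (hs _) (hs _)]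
  · rw [Bi.pos_iff, hA]; exact d.posJ
  · apply inj
    rw [map_mul, map_mul, hA, hqi, hAA]
  · rw [Bi.pos_iff, hG']; exact d.posG
  · rw [Bi.pos_iff, map_sub, two_mul, map_add, hG', hqr]; exact d.posGq
  · apply inj
    rw [map_mul, map_mul, hG', hqr, d.hG]
  · rw [Bi.smul_one, Bi.smul_one, hqi, hA]
  · rw [Bi.smul_one, hqr]; exact hJr
  · rw [Bi.smul_one, hG']; exact (cG0 J hJr.symm).symm

end exact

section polar
open PosCone

variable {R : Type*} [Ring R] [StarRing R] [Algebra ℂ R] [StarModule ℂ R] [PosCone R]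

lemma commutator_eq_zero {V z : R} (hV : star V * V = 1) (hz : star z = z)
    (h1 : z * (V * z - z * V) = 0) (h2 : z * star (V * z - z * V) = 0) : V * z - z * V = 0 := by
  apply proper
  have e1 : star (V * z - z * V) = z * star V - star V * z := by
    rw [star_sub, star_mul, star_mul, hz]
  have e2 : z * star V * z = z * z * star V := by
    rw [e1, mul_sub, sub_eq_zero] at h2
    rw [mul_assoc, ← h2, mul_assoc]
  rw [e1, sub_mul, mul_assoc (star V), h1, mul_zero, sub_zero, mul_sub, ← mul_assoc (z * star V) z V,
    e2, mul_assoc z (star V), ← mul_assoc (star V), hV, one_mul, mul_assoc (z * z), hV, mul_one,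
    sub_self]

variable {x t V H : R}

structure PolarData (x t V H : R) : Prop where
  hx : star x = x
  ht : star t = t
  cxt : Commute x t
  V_star_mul : star V * V = 1
  V_mul_star : V * star V = 1
  posH : pos H
  VH : V * H = x + Complex.I • t

namespace PolarData

lemma HH (d : PolarData x t V H) : H * H = x * x + t * t := by
  have h : star (V * H) * (V * H) = H * H := by
    rw [star_mul, pos_star d.posH, mul_assoc, ← mul_assoc (star V), d.V_star_mul, one_mul]
  rw [← h, d.VH, star_add, star_smul, d.hx, d.ht, Complex.star_def, Complex.conj_I, neg_smul,
    ← smul_neg, part_mul]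
  simp [d.cxt.eq]

lemma commute_VH (d : PolarData x t V H) : Commute V H := by
  refine (pos_comm d.posH ?_).symm
  have h : V * (H * H) * star V = H * H := by
    have : V * (H * H) * star V = V * H * star (V * H) := by
      rw [star_mul, pos_star d.posH]; noncomm_ring
    rw [this, d.HH, d.VH, star_add, star_smul, d.hx, d.ht, Complex.star_def, Complex.conj_I,
      neg_smul, ← smul_neg, part_mul]
    simp [d.cxt.eq]
  rw [Commute, SemiconjBy]
  nth_rw 1 [← h]
  rw [mul_assoc, d.V_star_mul, mul_one]

lemma starV_mul (d : PolarData x t V H) : star V * H = x - Complex.I • t := by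
  have := congrArg star (d.commute_VH.eq.symm.trans d.VH)
  rw [star_mul, pos_star d.posH, star_add, star_smul, d.hx, d.ht, Complex.star_def, Complex.conj_I,
      neg_smul, ← sub_eq_add_neg] at this
  exact this

lemma commute_H (d : PolarData x t V H) {z : R} (hx : Commute x z) (ht : Commute t z) :
    Commute H z := by
  refine pos_comm d.posH ?_
  rw [d.HH]; exact (hx.mul_left hx).add_left (ht.mul_left ht)

lemma mul_eq_zero_of_H {f : R} (d : PolarData x t V H) (hf : H * f = 0) : x * f = 0 ∧ t * f = 0 := by
  have h1 : star f * (x * x) * f + star f * (t * t) * f = 0 := by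
    rw [← add_mul, ← mul_add, ← d.HH, ← mul_assoc, mul_assoc, hf, mul_zero]
  have p1 := pos_conj f (pos_mul_self d.hx)
  have p2 := pos_conj f (pos_mul_self d.ht)
  have h2 := eq_zero_of_pos_add p1 p2 h1
  have h3 := eq_zero_of_pos_add p2 p1 (by rwa [add_comm])
  exact ⟨mul_eq_zero_of_mul_self d.hx (mul_eq_zero_of_conj (pos_mul_self d.hx) h2),
    mul_eq_zero_of_mul_self d.ht (mul_eq_zero_of_conj (pos_mul_self d.ht) h3)⟩

lemma commute_V (d : PolarData x t V H) {z : R} (hz : star z = z) (cx : Commute x z)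
    (ct : Commute t z) (hker : ∀ f, x * f = 0 → t * f = 0 → z * f = 0) : Commute V z := by
  have cH := d.commute_H cx ct
  have h1 : (V * z - z * V) * H = 0 := by
    rw [sub_mul, mul_assoc, ← cH.eq, ← mul_assoc, mul_assoc z, d.VH, add_mul, mul_add,
      smul_mul_assoc, mul_smul_comm, cx.eq, ct.eq, sub_self]
  have h2 : (star V * z - z * star V) * H = 0 := by
    rw [sub_mul, mul_assoc, ← cH.eq, ← mul_assoc, mul_assoc z, d.starV_mul, sub_mul, mul_sub,
      smul_mul_assoc, mul_smul_comm, cx.eq, ct.eq, sub_self]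
  have h3 : H * star (V * z - z * V) = 0 := by
    have := congrArg star h1; rwa [star_mul, star_zero, pos_star d.posH] at this
  have h4 : H * (V * z - z * V) = 0 := by
    have := congrArg star h2
    rw [star_mul, star_zero, pos_star d.posH, star_sub, star_mul, star_mul, hz, star_star] at this
    rw [← neg_sub, mul_neg, this, neg_zero]
  refine sub_eq_zero.1 (commutator_eq_zero d.V_star_mul hz ?_ ?_)
  · exact hker _ (d.mul_eq_zero_of_H h4).1 (d.mul_eq_zero_of_H h4).2
  · exact hker _ (d.mul_eq_zero_of_H h3).1 (d.mul_eq_zero_of_H h3).2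

lemma re_mul (d : PolarData x t V H) : rePart V * H = x := by
  rw [rePart, smul_mul_assoc, add_mul, d.VH, d.starV_mul, add_add_sub_cancel, ← two_smul ℂ,
    smul_smul]
  norm_num

lemma im_mul (d : PolarData x t V H) : imPart V * H = t := by
  rw [imPart, smul_mul_assoc, sub_mul, d.VH, d.starV_mul, add_sub_sub_cancel, ← two_smul ℂ,
    smul_smul, smul_smul]
  have : -Complex.I / 2 * (2 * Complex.I) = 1 := by
    ring_nf; rw [Complex.I_sq]; norm_num
  rw [← mul_assoc] at this
  rw [this, one_smul]

end PolarData

/-- The gap property in the exact limit. -/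
theorem eq_zero_of_exact {x y b m β w w' V H E J G Y E' J' G' Y' T p κ : R}
    (hy : star y = y) (hb : star b = b) (cxy : Commute x y) (cxb : Commute x b)
    (cyb : Commute y b) (cym : Commute y m) (hbm : b = β + m * y) (hβ : ∀ f, Commute β f)
    (hβs : star β = β) (posb : pos b) (posx : pos (1 - x * x)) (hw : w + w = 1 + x)
    (posw : pos w) (hw' : w' + w' = 1 - x) (posw' : pos w') (hY : Y = w * w * y)
    (hY' : Y' = w' * w' * y)
    (d : PolarData x ((1 - x * x) * y) V H)
    (s : SideData V Y E J G) (s' : SideData (-star V) Y' E' J' G')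
    (hT : T = -(imPart V + J * G + J' * G')) (hTp : T * p = κ) (hκ : b * κ = y * p)
    (hbig : ∃ c r : R, pos c ∧ c + star p * p = r * (star p * (b * p) + star κ * (y * p))) : p = 0 := by
  have h2 : ∀ f : R, f + f = 0 → f = 0 := fun f hf => by
    have e : (2⁻¹ : ℂ) • (f + f) = f := by rw [← two_smul ℂ, smul_smul]; norm_num
    rw [← e, hf, smul_zero]
  have cxt : ∀ z, Commute x z → Commute y z → Commute ((1 - x * x) * y) z := fun z hx hy =>
    ((Commute.one_left z).sub_left (hx.mul_left hx)).mul_left hy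
  have kery : ∀ f, x * f = 0 → (1 - x * x) * y * f = 0 → y * f = 0 := fun f h1 h2 => by
    have : y * f = (1 - x * x) * y * f + x * y * (x * f) := by
      have : x * y * (x * f) = x * x * y * f := by
        rw [mul_assoc, ← mul_assoc y, ← cxy.eq]; noncomm_ring
      rw [this]; noncomm_ring
    rw [this, h1, h2]; simp
  have cVx : Commute V x := d.commute_V d.hx (.refl x) (cxt x (.refl x) cxy.symm) fun f h _ => h
  have cVy : Commute V y := d.commute_V hy cxy (cxt y cxy (.refl y)) kery
  have cβ : Commute V β := (hβ V).symm
  have hBs : star (b - β) = b - β := by rw [star_sub, hb, hβs]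
  have hB0 : b - β = m * y := by rw [hbm]; abel
  have cVB : Commute V (b - β) := by
    have cxB : Commute x (b - β) := cxb.sub_right (hβ x).symm
    refine d.commute_V hBs cxB (cxt _ cxB (cyb.sub_right (hβ y).symm)) fun f h1 h2 => ?_
    rw [hB0, mul_assoc, kery f h1 h2, mul_zero]
  have cVb : Commute V b := by simpa using cVB.add_right cβ
  have star_comm : ∀ z, star z = z → Commute V z → Commute (star V) z := fun z hz h => by
    have := h.star_star; rwa [hz] at this
  have cVs : Commute V (star V) := by rw [Commute, SemiconjBy, d.V_star_mul, d.V_mul_star]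
  let Z : Set R := {x, y, b, V, star V, -V, -star V}
  have hZ : ∀ a ∈ Z, ∀ b ∈ Z, Commute a b := by
    have h1 := star_comm x d.hx cVx
    have h2 := star_comm y hy cVy
    have h3 := star_comm b hb cVb
    rintro a (rfl | rfl | rfl | rfl | rfl | rfl | rfl) c
      (rfl | rfl | rfl | rfl | rfl | rfl | rfl) <;>
      (try apply Commute.neg_left) <;> (try apply Commute.neg_right) <;>
      first
        | exact Commute.refl _
        | assumption
        | (apply Commute.symm; assumption)
  have hxZ : x ∈ Z := by simp [Z]
  have hyZ : y ∈ Z := by simp [Z]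
  have hbZ : b ∈ Z := by simp [Z]
  have hVZ : V ∈ Z := by simp [Z]
  have hVZ' : star V ∈ Z := by simp [Z]
  have hVn : -star V ∈ Z := by simp [Z]
  have hVn' : star (-star V) ∈ Z := by simp [Z]
  obtain ⟨X, hX⟩ := Bi.exists_val hZ d.hx fun t ht => ht x hxZ
  obtain ⟨yy, hyy⟩ := Bi.exists_val hZ hy fun t ht => ht y hyZ
  obtain ⟨bb, hbb⟩ := Bi.exists_val hZ hb fun t ht => ht b hbZ
  obtain ⟨B, hB⟩ := Bi.exists_val hZ hBs fun t ht => (ht b hbZ).sub_left (hβ t)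
  obtain ⟨h, hh⟩ := Bi.exists_val hZ (pos_star d.posH) fun t ht =>
    d.commute_H (ht x hxZ) (cxt t (ht x hxZ) (ht y hyZ))
  obtain ⟨c, hc⟩ := Bi.exists_val hZ (star_rePart V) fun t ht =>
    commute_rePart (ht V hVZ) (ht _ hVZ')
  obtain ⟨S, hS⟩ := Bi.exists_val hZ (star_imPart V) fun t ht =>
    commute_imPart (ht V hVZ) (ht _ hVZ')
  have hwx : w = (2⁻¹ : ℂ) • (1 + x) := by rw [← hw, ← two_smul ℂ, smul_smul]; norm_num
  have hwx' : w' = (2⁻¹ : ℂ) • (1 - x) := by rw [← hw', ← two_smul ℂ, smul_smul]; norm_num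
  obtain ⟨W, hW⟩ := Bi.exists_val hZ (pos_star posw) fun t ht => by
    rw [hwx]; exact ((Commute.one_left t).add_left (ht x hxZ)).smul_left _
  obtain ⟨W', hW'⟩ := Bi.exists_val hZ (pos_star posw') fun t ht => by
    rw [hwx']; exact ((Commute.one_left t).sub_left (ht x hxZ)).smul_left _
  have inj := Bi.val_injective Z hZ
  have cH : c * h = X := inj (by rw [map_mul, hc, hh, hX, d.re_mul])
  have SH : S * h = (1 - X * X) * yy := inj (by simp [hS, hh, hX, hyy, d.im_mul])
  have pH : RealAction.Pos R h := by rw [Bi.pos_iff, hh]; exact d.posH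
  have pX : RealAction.Pos R (1 - X * X) := by
    rw [Bi.pos_iff]; simpa [hX] using posx
  have pW : RealAction.Pos R W := by rw [Bi.pos_iff, hW]; exact posw
  have pW' : RealAction.Pos R W' := by rw [Bi.pos_iff, hW']; exact posw'
  have eW : W + W = 1 + X := inj (by simp [hW, hX, hw])
  have eW' : W' + W' = 1 + -X := inj (by simp [hW', hX, hw', sub_eq_add_neg])
  obtain ⟨q, I, A, G1, s1, hG1⟩ := SideData.exists_side (hZ := hZ) (x := X) (y := yy) (w := W)
    (H := h) (E := E) (J := J) (G := G)
    hVZ hVZ' d.V_star_mul d.V_mul_star hc hS cH SH pH pX pW eW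
    (by simpa [hX, hyy, hW, hY] using s)
  have hreV : rePart (-star V) = -rePart V := by
    rw [rePart, rePart, star_neg, star_star, ← smul_neg]; congr 1; abel
  have himV : imPart (-star V) = imPart V := by
    rw [imPart, imPart, star_neg, star_star]; congr 1; abel
  obtain ⟨q', I', A', G1', s1', hG1'⟩ := SideData.exists_side (hZ := hZ) (x := -X) (y := yy)
    (w := W') (H := h) (E := E') (J := J') (G := G') (c := -c) (S := S) (V := -star V)
    hVn hVn' (by simp [d.V_mul_star]) (by simp [d.V_star_mul])
    (by rw [map_neg, hc, hreV]) (by rw [hS, himV]) (by rw [neg_mul, cH]) (by rw [SH]; ring) pH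
    (by rwa [neg_mul_neg]) pW' eW'
    (by simpa [hX, hyy, hW', hY'] using s')
  refine RealAction.eq_zero_of_side (b := bb) (B := B) (β := β) h2 s1 s1' ?_ ?_ hβ ?_
    (T := T) (p := p) (κ := κ) ?_ hTp ?_ ?_
  · rw [Bi.pos_iff, hbb]; exact posb
  · rw [Bi.smul_one, Bi.smul_one, hbb, hB]; abel
  · intro f hf
    rw [Bi.smul_eq, hyy] at hf
    rw [Bi.smul_eq, hB, hB0, mul_assoc, hf, mul_zero]
  · rw [Bi.smul_one, Bi.smul_one, Bi.smul_one, hS, hG1, hG1', hT]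
  · rw [Bi.smul_eq, Bi.smul_eq, hbb, hyy, hκ]
  · simp only [Bi.smul_eq, hbb, hyy]; exact hbig

end polar

section corona
open PosCone Filter Topology

variable (A : ℕ → Type*) [∀ j, CStarAlgebra (A j)]

/-- Bounded sequences. -/
def BddSeq : StarSubalgebra ℂ (∀ j, A j) where
  carrier := {f | ∃ C : ℝ, ∀ j, ‖f j‖ ≤ C}
  mul_mem' := by
    rintro f g ⟨C, hC⟩ ⟨D, hD⟩
    exact ⟨C * D, fun j => (norm_mul_le _ _).trans
      (mul_le_mul (hC j) (hD j) (norm_nonneg _) ((norm_nonneg _).trans (hC j)))⟩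
  add_mem' := by
    rintro f g ⟨C, hC⟩ ⟨D, hD⟩
    exact ⟨C + D, fun j => (norm_add_le _ _).trans (add_le_add (hC j) (hD j))⟩
  algebraMap_mem' := fun r => ⟨‖r‖ * 1, fun j => by
    rw [Pi.algebraMap_apply, Algebra.algebraMap_eq_smul_one, norm_smul]
    gcongr
    cases subsingleton_or_nontrivial (A j)
    · simp [Subsingleton.elim (1 : A j) 0]
    · simp⟩
  star_mem' := by
    rintro f ⟨C, hC⟩
    exact ⟨C, fun j => by simpa using hC j⟩

/-- Sequences modulo null sequences. -/
def nullCon : RingCon (BddSeq A) where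
  r f g := Tendsto (fun j => ‖f.1 j - g.1 j‖) atTop (𝓝 0)
  iseqv :=
    { refl := fun f => by simp
      symm := fun {f g} h => by simpa [norm_sub_rev] using h
      trans := fun {f g h} h1 h2 => by
        refine squeeze_zero (fun j => norm_nonneg _) (fun j => ?_) (by simpa using h1.add h2)
        exact norm_sub_le_norm_sub_add_norm_sub _ _ _ }
  add' := fun {f g f' g'} h1 h2 => by
    refine squeeze_zero (fun j => norm_nonneg _) (fun j => ?_) (by simpa using h1.add h2)
    change ‖(f.1 j + f'.1 j) - (g.1 j + g'.1 j)‖ ≤ _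
    rw [add_sub_add_comm]; exact norm_add_le _ _
  mul' := fun {f g f' g'} h1 h2 => by
    obtain ⟨C, hC⟩ := f'.2
    obtain ⟨D, hD⟩ := g.2
    refine squeeze_zero (fun j => norm_nonneg _) (fun j => ?_)
      (by simpa using (h1.mul_const C).add (h2.const_mul D))
    change ‖(f.1 j * f'.1 j) - (g.1 j * g'.1 j)‖ ≤ _
    have : f.1 j * f'.1 j - g.1 j * g'.1 j
      = (f.1 j - g.1 j) * f'.1 j + g.1 j * (f'.1 j - g'.1 j) := by noncomm_ring
    rw [this]
    refine (norm_add_le _ _).trans (add_le_add ?_ ?_) <;> refine (norm_mul_le _ _).trans ?_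
    · gcongr; exact hC j
    · gcongr; exact hD j

/-- The corona algebra. -/
def Corona : Type _ := (nullCon A).Quotient

instance : Ring (Corona A) := inferInstanceAs (Ring (nullCon A).Quotient)
instance : Algebra ℂ (Corona A) := inferInstanceAs (Algebra ℂ (nullCon A).Quotient)

/-- The quotient map. -/
def Corona.mk : BddSeq A →ₐ[ℂ] Corona A where
  toFun := fun f => ((f : (nullCon A).Quotient) : Corona A)
  map_one' := rfl
  map_mul' _ _ := rfl
  map_zero' := rfl
  map_add' _ _ := rfl
  commutes' _ := rfl

variable {A}

lemma Corona.mk_eq_iff {f g : BddSeq A} :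
    Corona.mk A f = Corona.mk A g ↔ Tendsto (fun j => ‖f.1 j - g.1 j‖) atTop (𝓝 0) :=
  (nullCon A).eq

lemma Corona.mk_surjective : Function.Surjective (Corona.mk A) := Quotient.mk''_surjective

instance : StarRing (Corona A) where
  star := Quotient.map' star fun f g (h : Tendsto _ _ _) =>
    (show Tendsto (fun j => ‖star (f.1 j) - star (g.1 j)‖) atTop (𝓝 0) by
      simpa [← star_sub] using h)
  star_involutive := by
    intro x; obtain ⟨f, rfl⟩ := Corona.mk_surjective x
    exact congrArg (Corona.mk A) (star_star f)
  star_mul := by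
    intro x y; obtain ⟨f, rfl⟩ := Corona.mk_surjective x
    obtain ⟨g, rfl⟩ := Corona.mk_surjective y
    exact congrArg (Corona.mk A) (star_mul f g)
  star_add := by
    intro x y; obtain ⟨f, rfl⟩ := Corona.mk_surjective x
    obtain ⟨g, rfl⟩ := Corona.mk_surjective y
    exact congrArg (Corona.mk A) (star_add f g)

lemma Corona.mk_star (f : BddSeq A) : Corona.mk A (star f) = star (Corona.mk A f) := rfl

instance : StarModule ℂ (Corona A) where
  star_smul := by
    intro c x; obtain ⟨f, rfl⟩ := Corona.mk_surjective x
    rw [← map_smul, ← Corona.mk_star, ← Corona.mk_star, ← map_smul, star_smul]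

lemma exists_polynomial_near_sqrt (C : ℝ) {ε : ℝ} (hε : 0 < ε) :
    ∃ p : Polynomial ℝ, ∀ j, ∀ a : A j, IsSelfAdjoint a → (∀ t ∈ spectrum ℝ a, 0 ≤ t) → ‖a‖ ≤ C →
      ‖a - Polynomial.aeval (a * a) p‖ ≤ ε := by
  obtain ⟨p, hp⟩ := exists_polynomial_near_of_continuousOn 0 (C ^ 2) Real.sqrt
    Real.continuous_sqrt.continuousOn ε hε
  refine ⟨p, fun j a ha ha0 haC => ?_⟩
  cases subsingleton_or_nontrivial (A j)
  · rw [Subsingleton.elim (a - _) 0, norm_zero]; exact hε.le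
  have e : a - Polynomial.aeval (a * a) p = cfc (fun t : ℝ => t - (p.comp (.X ^ 2)).eval t) a := by
    rw [cfc_sub .., cfc_id' .., cfc_polynomial .., Polynomial.aeval_comp]
    simp [sq]
  rw [e]
  refine norm_cfc_le hε.le fun t ht => ?_
  have h0 := ha0 t ht
  have h1 : t ≤ C := (le_abs_self t).trans ((spectrum.norm_le_norm_of_mem ht).trans haC)
  have := hp (t ^ 2) ⟨by positivity, by gcongr⟩
  rw [Real.sqrt_sq h0, abs_sub_comm] at this
  simpa using this.le

variable [∀ j, PartialOrder (A j)] [∀ j, StarOrderedRing (A j)]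

instance : PosCone (Corona A) where
  pos x := ∃ f : BddSeq A, (∀ j, 0 ≤ f.1 j) ∧ Corona.mk A f = x
  pos_one := ⟨1, fun j => zero_le_one, map_one _⟩
  pos_add := by
    rintro _ _ ⟨f, hf, rfl⟩ ⟨g, hg, rfl⟩
    exact ⟨f + g, fun j => add_nonneg (hf j) (hg j), map_add _ _ _⟩
  pos_conj := by
    rintro _ c ⟨f, hf, rfl⟩
    obtain ⟨c, rfl⟩ := Corona.mk_surjective c
    exact ⟨star c * f * c, fun j => star_left_conjugate_nonneg (hf j) _, rfl⟩
  pos_star := by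
    rintro _ ⟨f, hf, rfl⟩
    rw [← Corona.mk_star]
    congr 1
    ext j
    exact (IsSelfAdjoint.of_nonneg (hf j)).star_eq
  pos_antisymm := by
    rintro _ ⟨f, hf, rfl⟩ ⟨g, hg, h⟩
    rw [← map_neg, Corona.mk_eq_iff] at h
    rw [← map_zero (Corona.mk A), Corona.mk_eq_iff]
    refine squeeze_zero (fun j => norm_nonneg _) (fun j => ?_) h
    change ‖f.1 j - 0‖ ≤ ‖g.1 j - -f.1 j‖
    rw [sub_zero, sub_neg_eq_add]
    exact CStarAlgebra.norm_le_norm_of_nonneg_of_le (hf j) (le_add_of_nonneg_left (hg j))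
  proper := by
    intro x h; obtain ⟨f, rfl⟩ := Corona.mk_surjective x
    rw [← Corona.mk_star, ← map_mul, ← map_zero (Corona.mk A), Corona.mk_eq_iff] at h
    rw [← map_zero (Corona.mk A), Corona.mk_eq_iff]
    have h' : Tendsto (fun j => ‖f.1 j‖ * ‖f.1 j‖) atTop (𝓝 0) := by
      refine h.congr fun j => ?_
      change ‖star (f.1 j) * f.1 j - 0‖ = _
      rw [sub_zero, CStarRing.norm_star_mul_self]
    have := h'.sqrt
    simpa using this
  pos_sqrt := by
    rintro _ ⟨f, hf, rfl⟩
    obtain ⟨C, hC⟩ := f.2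
    refine ⟨_, ⟨⟨fun j => CFC.sqrt (f.1 j), √C, fun j => ?_⟩, fun j => CFC.sqrt_nonneg _, rfl⟩, ?_⟩
    · apply Real.le_sqrt_of_sq_le
      rw [sq, ← CStarRing.norm_star_mul_self,
        (IsSelfAdjoint.of_nonneg (CFC.sqrt_nonneg _)).star_eq, CFC.sqrt_mul_sqrt_self _ (hf j)]
      exact hC j
    · rw [← map_mul]
      congr 1
      ext j
      exact CFC.sqrt_mul_sqrt_self _ (hf j)
  pos_comm := by
    rintro _ z ⟨f, hf, rfl⟩ h
    obtain ⟨z, rfl⟩ := Corona.mk_surjective z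
    obtain ⟨C, hC⟩ := f.2
    obtain ⟨D, hD⟩ := z.2
    have hpoly : ∀ p : Polynomial ℝ,
        Tendsto (fun j => ‖Polynomial.aeval (f.1 j * f.1 j) p * z.1 j
          - z.1 j * Polynomial.aeval (f.1 j * f.1 j) p‖) atTop (𝓝 0) := by
      intro p
      have hc : Commute (Corona.mk A (Polynomial.aeval (f * f) p)) (Corona.mk A z) := by
        induction p using Polynomial.induction_on' with
        | add p q hp hq => rw [map_add, map_add]; exact hp.add_left hq
        | monomial n c =>
          rw [Polynomial.aeval_monomial, ← Algebra.smul_def,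
            show c • (f * f) ^ n = (c : ℂ) • (f * f) ^ n from (Complex.coe_smul _ _).symm, map_smul,
            map_pow, map_mul]
          exact (h.pow_left n).smul_left _
      rw [Commute, SemiconjBy, ← map_mul, ← map_mul, Corona.mk_eq_iff] at hc
      refine hc.congr fun j => ?_
      let π : BddSeq A →ₐ[ℝ] A j :=
        ((Pi.evalAlgHom ℂ A j).comp (BddSeq A).subtype.toAlgHom).restrictScalars ℝ
      have : (Polynomial.aeval (f * f) p : BddSeq A).1 j = Polynomial.aeval (f.1 j * f.1 j) p :=
        (Polynomial.aeval_algHom_apply π (f * f) p).symm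
      change ‖(Polynomial.aeval (f * f) p : BddSeq A).1 j * z.1 j
        - z.1 j * (Polynomial.aeval (f * f) p : BddSeq A).1 j‖ = _
      rw [this]
    rw [Commute, SemiconjBy, ← map_mul, ← map_mul, Corona.mk_eq_iff, Metric.tendsto_atTop]
    intro ε hε
    have hD0 : 0 ≤ D := (norm_nonneg _).trans (hD 0)
    obtain ⟨p, hp⟩ := exists_polynomial_near_sqrt (A := A) C
      (show 0 < ε / (4 * (D + 1)) by positivity)
    obtain ⟨N, hN⟩ := Metric.tendsto_atTop.1 (hpoly p) (ε / 2) (by positivity)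
    refine ⟨N, fun j hj => ?_⟩
    have h1 := hN j hj
    have h2 := hp j (f.1 j) (.of_nonneg (hf j)) (fun t ht => spectrum_nonneg_of_nonneg (hf j) ht)
      (hC j)
    rw [dist_zero_right, norm_norm] at h1 ⊢
    set b := Polynomial.aeval (f.1 j * f.1 j) p
    change ‖f.1 j * z.1 j - z.1 j * f.1 j‖ < ε
    have e : f.1 j * z.1 j - z.1 j * f.1 j = (f.1 j - b) * z.1 j - z.1 j * (f.1 j - b)
        + (b * z.1 j - z.1 j * b) := by noncomm_ring
    have h3 : ‖f.1 j - b‖ * ‖z.1 j‖ ≤ ε / 4 := by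
      calc ‖f.1 j - b‖ * ‖z.1 j‖ ≤ ε / (4 * (D + 1)) * (D + 1) := by
            gcongr; exact (hD j).trans (by linarith)
        _ = ε / 4 := by field_simp
    rw [e]
    have h4 := norm_mul_le (f.1 j - b) (z.1 j)
    have h5 := norm_mul_le (z.1 j) (f.1 j - b)
    rw [mul_comm] at h5
    have h6 := norm_add_le ((f.1 j - b) * z.1 j - z.1 j * (f.1 j - b)) (b * z.1 j - z.1 j * b)
    have h7 := norm_sub_le ((f.1 j - b) * z.1 j) (z.1 j * (f.1 j - b))
    linarith

end corona

section gap
open PosCone Filter Topology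

namespace Corona

variable {A : ℕ → Type*} [∀ j, CStarAlgebra (A j)]

lemma mk_eq {f g : BddSeq A} (h : ∀ j, f.1 j = g.1 j) : mk A f = mk A g :=
  congrArg _ (Subtype.ext (funext h))

lemma mk_eq_of_le {η : ℕ → ℝ} (hη : Tendsto η atTop (𝓝 0)) {f g : BddSeq A}
    (h : ∀ j, ‖f.1 j - g.1 j‖ ≤ η j) : mk A f = mk A g :=
  mk_eq_iff.2 (squeeze_zero (fun _ => norm_nonneg _) h hη)

variable [∀ j, PartialOrder (A j)] [∀ j, StarOrderedRing (A j)]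

lemma pos_mk {f : BddSeq A} (h : ∀ j, 0 ≤ f.1 j) : pos (mk A f) := ⟨f, h, rfl⟩

/-- The class of a sequence bounded by `C`. -/
def lift (A : ℕ → Type*) [∀ j, CStarAlgebra (A j)] (C : ℝ) (f : ∀ j, A j) (h : ∀ j, ‖f j‖ ≤ C) :
    BddSeq A := ⟨f, C, h⟩

end Corona

/-- The operators entering the definition of the spectral flow element. -/
structure GapData (A : Type*) where
  (β : ℝ)
  (x y b m k V H E J G Y E' J' G' Y' : A)

variable {A : Type*} [CStarAlgebra A] [PartialOrder A]

/-- The Cayley transform `E` of `Y`, the sign `J` of `Im (E V)` and the positive part `G` of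
`Re (E V)`. -/
structure IsSideData (V Y E J G : A) : Prop where
  posY : 0 ≤ 1 - (Y * Y + Y * Y)
  hE : (1 - Complex.I • Y) * E = 1 + Complex.I • Y
  E_star_mul : star E * E = 1
  E_mul_star : E * star E = 1
  J_star : star J = J
  J_sq : J * J = 1
  Jq : J * (E * V) = E * V * J
  posJ : 0 ≤ J * imPart (E * V)
  posG : 0 ≤ G
  posGq : 0 ≤ G + G - rePart (E * V)
  hG : G * G = G * rePart (E * V)

namespace GapData

/-- The half-winding weight. -/
def w (D : GapData A) : A := (1 / 2 : ℂ) • (1 + D.x)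
/-- The complementary half-winding weight. -/
def w' (D : GapData A) : A := (1 / 2 : ℂ) • (1 - D.x)

/-- The operator that is compared with `k`. -/
def T (D : GapData A) : A := -(imPart D.V + D.J * D.G + D.J' * D.G')

structure Approx (D : GapData A) (η : ℝ) : Prop where
  hβ : |D.β| ≤ 100
  bx : ‖D.x‖ ≤ 100
  by' : ‖D.y‖ ≤ 100
  bb : ‖D.b‖ ≤ 100
  bm : ‖D.m‖ ≤ 100
  bV : ‖D.V‖ ≤ 100
  bH : ‖D.H‖ ≤ 100
  bE : ‖D.E‖ ≤ 100
  bJ : ‖D.J‖ ≤ 100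
  bG : ‖D.G‖ ≤ 100
  bY : ‖D.Y‖ ≤ 100
  bE' : ‖D.E'‖ ≤ 100
  bJ' : ‖D.J'‖ ≤ 100
  bG' : ‖D.G'‖ ≤ 100
  bY' : ‖D.Y'‖ ≤ 100
  xs : star D.x = D.x
  ys : star D.y = D.y
  bk : D.b * D.k = D.y
  kb : D.k * D.b = D.y
  ks : star D.k = D.k
  ym : D.y * D.m = D.m * D.y
  bm_eq : D.b = (D.β : ℂ) • 1 + D.m * D.y
  posb : 0 ≤ D.b
  posx : 0 ≤ 1 - D.x * D.x
  posw : 0 ≤ D.w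
  posw' : 0 ≤ D.w'
  xy : ‖D.x * D.y - D.y * D.x‖ ≤ η
  xb : ‖D.x * D.b - D.b * D.x‖ ≤ η
  hY : ‖D.Y - D.w * D.w * D.y‖ ≤ η
  hY' : ‖D.Y' - D.w' * D.w' * D.y‖ ≤ η
  V_star_mul : star D.V * D.V = 1
  V_mul_star : D.V * star D.V = 1
  posH : 0 ≤ D.H
  VH : ‖D.V * D.H - (D.x + Complex.I • ((1 - D.x * D.x) * D.y))‖ ≤ η
  side : IsSideData D.V D.Y D.E D.J D.G
  side' : IsSideData (-star D.V) D.Y' D.E' D.J' D.G'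
  big : 0 ≤ (8 : ℂ) • (D.b + D.k * D.y) - 1

end GapData

variable {A : ℕ → Type} [∀ j, CStarAlgebra (A j)] [∀ j, PartialOrder (A j)]
  [∀ j, StarOrderedRing (A j)]

lemma IsSideData.corona {V Y E J G : BddSeq A}
    (h : ∀ j, IsSideData (V.1 j) (Y.1 j) (E.1 j) (J.1 j) (G.1 j)) :
    SideData (Corona.mk A V) (Corona.mk A Y) (Corona.mk A E) (Corona.mk A J) (Corona.mk A G) where
  posY := Corona.pos_mk (f := 1 - (Y * Y + Y * Y)) fun j => (h j).posY
  hE := Corona.mk_eq (f := (1 - Complex.I • Y) * E) (g := 1 + Complex.I • Y) fun j => (h j).hE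
  E_star_mul := Corona.mk_eq (f := star E * E) (g := 1) fun j => (h j).E_star_mul
  E_mul_star := Corona.mk_eq (f := E * star E) (g := 1) fun j => (h j).E_mul_star
  J_star := Corona.mk_eq (f := star J) (g := J) fun j => (h j).J_star
  J_sq := Corona.mk_eq (f := J * J) (g := 1) fun j => (h j).J_sq
  Jq := Corona.mk_eq (f := J * (E * V)) (g := E * V * J) fun j => (h j).Jq
  posJ := Corona.pos_mk (f := J * imPart (E * V)) fun j => (h j).posJ
  posG := Corona.pos_mk fun j => (h j).posG
  posGq := Corona.pos_mk (f := G + G - rePart (E * V)) fun j => (h j).posGq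
  hG := Corona.mk_eq (f := G * G) (g := G * rePart (E * V)) fun j => (h j).hG

lemma GapData.tendsto_zero_absurd {D : ∀ j, GapData (A j)} {η : ℕ → ℝ} (hη : Tendsto η atTop (𝓝 0))
    (hη' : ∀ j, η j ≤ 1)
    (h : ∀ j, (D j).Approx (η j)) {p : ∀ j, A j} (hp : ∀ j, ‖p j‖ = 1)
    (hTp : ∀ j, ‖((D j).T - (D j).k) * p j‖ ≤ η j) : False := by
  set L := Corona.lift A 100
  let x := L _ fun j => (h j).bx
  let y := L _ fun j => (h j).by'
  let b := L _ fun j => (h j).bb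
  let m := L _ fun j => (h j).bm
  let V := L _ fun j => (h j).bV
  let H := L _ fun j => (h j).bH
  let E := L _ fun j => (h j).bE
  let J := L _ fun j => (h j).bJ
  let G := L _ fun j => (h j).bG
  let Y := L _ fun j => (h j).bY
  let E' := L _ fun j => (h j).bE'
  let J' := L _ fun j => (h j).bJ'
  let G' := L _ fun j => (h j).bG'
  let Y' := L _ fun j => (h j).bY'
  let P := Corona.lift A 1 _ fun j => (hp j).le
  let β : BddSeq A := Corona.lift A 100 (fun j => ((D j).β : ℂ) • 1) fun j => by
    cases subsingleton_or_nontrivial (A j)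
    · rw [Subsingleton.elim (((D j).β : ℂ) • (1 : A j)) 0, norm_zero]; norm_num
    · rw [norm_smul, Complex.norm_real, CStarRing.norm_one, mul_one]; exact (h j).hβ
  let w : BddSeq A := (1 / 2 : ℂ) • (1 + x)
  let w' : BddSeq A := (1 / 2 : ℂ) • (1 - x)
  let T : BddSeq A := -(imPart V + J * G + J' * G')
  obtain ⟨C, hC⟩ := (T * P).2
  let K : BddSeq A := Corona.lift A (C + 1) (fun j => (D j).k * p j) fun j => by
    have := hTp j
    have h2 : (D j).k * p j = (D j).T * p j - ((D j).T - (D j).k) * p j := by noncomm_ring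
    rw [h2]
    exact (norm_sub_le _ _).trans (add_le_add (hC j) (this.trans (hη' j)))
  have cxy : Commute (Corona.mk A x) (Corona.mk A y) :=
    Corona.mk_eq_of_le hη (f := x * y) (g := y * x) fun j => (h j).xy
  have hx : star (Corona.mk A x) = Corona.mk A x :=
    Corona.mk_eq (f := star x) (g := x) fun j => (h j).xs
  have hy : star (Corona.mk A y) = Corona.mk A y :=
    Corona.mk_eq (f := star y) (g := y) fun j => (h j).ys
  have ct : Commute (Corona.mk A x * Corona.mk A x) (Corona.mk A y) := cxy.mul_left cxy
  have key : Corona.mk A P = 0 := by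
    refine eq_zero_of_exact (x := Corona.mk A x) (y := Corona.mk A y) (b := Corona.mk A b)
      (m := Corona.mk A m) (β := Corona.mk A β) (w := Corona.mk A w) (w' := Corona.mk A w')
      (V := Corona.mk A V) (H := Corona.mk A H) (T := Corona.mk A T) (κ := Corona.mk A K)
      ?_ ?_ ?_ ?_ ?_ ?_ ?_ ?_ ?_ ?_ ?_ ?_ ?_ ?_ ?_ ?_ ?_ ?_ (IsSideData.corona (V := V) (Y := Y) (E := E) (J := J) (G := G) fun j => (h j).side)
      (IsSideData.corona (V := -star V) (Y := Y') (E := E') (J := J') (G := G') fun j => (h j).side') ?_ ?_ ?_ ?_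
    · exact hy
    · exact Corona.mk_eq (f := star b) (g := b) fun j => (IsSelfAdjoint.of_nonneg (h j).posb).star_eq
    · exact cxy
    · exact Corona.mk_eq_of_le hη (f := x * b) (g := b * x) fun j => (h j).xb
    · refine Corona.mk_eq (f := y * b) (g := b * y) fun j => ?_
      change (D j).y * (D j).b = (D j).b * (D j).y
      rw [← (h j).bk, mul_assoc, (h j).kb, (h j).bk]
    · exact Corona.mk_eq (f := y * m) (g := m * y) fun j => (h j).ym
    · exact Corona.mk_eq (f := b) (g := β + m * y) fun j => (h j).bm_eq
    · intro f
      obtain ⟨f, rfl⟩ := Corona.mk_surjective f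
      refine Corona.mk_eq (f := β * f) (g := f * β) fun j => ?_
      change (((D j).β : ℂ) • (1 : A j)) * f.1 j = f.1 j * (((D j).β : ℂ) • (1 : A j))
      simp
    · refine Corona.mk_eq (f := star β) (g := β) fun j => ?_
      change star (((D j).β : ℂ) • (1 : A j)) = (((D j).β : ℂ) • (1 : A j))
      simp
    · exact Corona.pos_mk fun j => (h j).posb
    · exact Corona.pos_mk (f := 1 - x * x) fun j => (h j).posx
    · refine (Corona.mk_eq (f := w + w) (g := 1 + x) fun j => ?_)
      change (1 / 2 : ℂ) • (1 + (D j).x) + (1 / 2 : ℂ) • (1 + (D j).x) = 1 + (D j).x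
      module
    · exact Corona.pos_mk fun j => (h j).posw
    · refine (Corona.mk_eq (f := w' + w') (g := 1 - x) fun j => ?_)
      change (1 / 2 : ℂ) • (1 - (D j).x) + (1 / 2 : ℂ) • (1 - (D j).x) = 1 - (D j).x
      module
    · exact Corona.pos_mk fun j => (h j).posw'
    · exact Corona.mk_eq_of_le hη (f := Y) (g := w * w * y) fun j => (h j).hY
    · exact Corona.mk_eq_of_le hη (f := Y') (g := w' * w' * y) fun j => (h j).hY'
    · exact
       {hx := hx
        ht := by
          rw [star_mul, star_sub, star_mul, star_one, hx, hy]
          exact ((Commute.one_left _).sub_left ct).eq.symm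
        cxt := ((Commute.one_right _).sub_right ((Commute.refl _).mul_right (.refl _))).mul_right cxy
        V_star_mul := Corona.mk_eq (f := star V * V) (g := 1) fun j => (h j).V_star_mul
        V_mul_star := Corona.mk_eq (f := V * star V) (g := 1) fun j => (h j).V_mul_star
        posH := Corona.pos_mk fun j => (h j).posH
        VH := Corona.mk_eq_of_le hη (f := V * H) (g := x + Complex.I • ((1 - x * x) * y))
          fun j => (h j).VH }
    · rfl
    · exact Corona.mk_eq_of_le hη (f := T * P) (g := K) fun j => by
        have := hTp j
        rw [sub_mul] at this
        exact this
    · refine Corona.mk_eq (f := b * K) (g := y * P) fun j => ?_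
      change (D j).b * ((D j).k * p j) = (D j).y * p j
      rw [← mul_assoc, (h j).bk]
    · let r : BddSeq A := (8 : ℂ) • 1
      let c := r * (star P * (b * P) + star K * (y * P)) - star P * P
      refine ⟨Corona.mk A c, Corona.mk A r, Corona.pos_mk fun j => ?_,
        Corona.mk_eq (f := c + star P * P) (g := r * (star P * (b * P) + star K * (y * P)))
          fun j => congrFun (congrArg Subtype.val (sub_add_cancel _ _)) j⟩
      have e : c.1 j = star (p j) * ((8 : ℂ) • ((D j).b + (D j).k * (D j).y) - 1) * p j := by
        change ((8 : ℂ) • (1 : A j)) * (star (p j) * ((D j).b * p j)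
          + star ((D j).k * p j) * ((D j).y * p j)) - star (p j) * p j = _
        rw [star_mul, (h j).ks, smul_mul_assoc, one_mul, mul_sub, sub_mul, mul_one,
          mul_smul_comm, smul_mul_assoc]
        congr 2
        noncomm_ring
      rw [e]
      exact star_left_conjugate_nonneg (h j).big _
  rw [← map_zero (Corona.mk A), Corona.mk_eq_iff] at key
  have key' : Tendsto (fun _ : ℕ => (1 : ℝ)) atTop (𝓝 0) := key.congr fun j => by
    change ‖p j - 0‖ = 1
    rw [sub_zero, hp j]
  exact one_ne_zero (tendsto_nhds_unique tendsto_const_nhds key')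

open scoped Matrix.Norms.L2Operator MatrixOrder

/-- The gap property. -/
theorem GapData.exists_gap : ∃ η : ℝ, 0 < η ∧ ∃ c : ℝ, 0 < c ∧ ∀ (n : ℕ)
    (D : GapData (Matrix (Fin n) (Fin n) ℂ)), D.Approx η → ∀ p : Matrix (Fin n) (Fin n) ℂ,
      c * ‖p‖ ≤ ‖(D.T - D.k) * p‖ := by
  by_contra! hcon
  have hpos : ∀ j : ℕ, (0 : ℝ) < 1 / ((j : ℝ) + 1) := fun j => by positivity
  choose n D hD p hp using fun j : ℕ => hcon (1 / ((j : ℝ) + 1)) (hpos j) (1 / ((j : ℝ) + 1)) (hpos j)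
  have hp0 : ∀ j, 0 < ‖p j‖ := fun j => by
    by_contra! h0
    have := hp j
    rw [norm_le_zero_iff.1 h0] at this
    simp at this
  refine tendsto_zero_absurd (A := fun j => Matrix (Fin (n j)) (Fin (n j)) ℂ) (D := D)
    (η := fun j : ℕ => 1 / ((j : ℝ) + 1)) tendsto_one_div_add_atTop_nhds_zero_nat (fun j => ?_) hD
    (p := fun j => ((‖p j‖⁻¹ : ℝ) : ℂ) • p j) (fun j => ?_) (fun j => ?_)
  · rw [div_le_one (by positivity)]; linarith [(Nat.cast_nonneg j : (0 : ℝ) ≤ j)]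
  · rw [norm_smul, Complex.norm_real, norm_inv, norm_norm, inv_mul_cancel₀ (hp0 j).ne']
  · rw [mul_smul_comm, norm_smul, Complex.norm_real, norm_inv, norm_norm]
    rw [inv_mul_le_iff₀ (hp0 j), mul_comm]
    exact (hp j).le

end gap

section kpart

/-- A truncated dyadic sum comparable to `1 / (1 + |t|)`. -/
def dyadic (J : ℕ) (t : ℝ) : ℝ :=
  ∑ j ∈ Finset.range J, (1 / 8) * (1 / 2) ^ j * (1 + ((1 / 2) ^ j * t) ^ 2)⁻¹

lemma dyadic_neg (J : ℕ) (t : ℝ) : dyadic J (-t) = dyadic J t := by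
  simp [dyadic]

lemma dyadic_abs (J : ℕ) (t : ℝ) : dyadic J |t| = dyadic J t := by
  rcases abs_choice t with h | h <;> rw [h]
  exact dyadic_neg J t

lemma dyadic_term_le (J : ℕ) (t : ℝ) {j : ℕ} (hj : j < J) :
    (1 / 8) * (1 / 2) ^ j * (1 + ((1 / 2) ^ j * t) ^ 2)⁻¹ ≤ dyadic J t :=
  Finset.single_le_sum (f := fun j => (1 / 8) * (1 / 2) ^ j * (1 + ((1 / 2) ^ j * t) ^ 2)⁻¹)
    (fun _ _ => by positivity) (Finset.mem_range.2 hj)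

lemma dyadic_nonneg (J : ℕ) (t : ℝ) : 0 ≤ dyadic J t :=
  Finset.sum_nonneg fun _ _ => by positivity

lemma dyadic_lower {J : ℕ} (hJ : 0 < J) (t : ℝ) : 1 ≤ 8 * dyadic J t * (1 + t ^ 2) := by
  have h := dyadic_term_le J t hJ
  have h1 : (0 : ℝ) < 1 + t ^ 2 := by positivity
  simp only [pow_zero, mul_one, one_mul] at h
  rw [← div_eq_mul_inv, div_le_iff₀ h1] at h
  linarith

lemma mul_dyadic_aux {t : ℝ} (ht : 0 ≤ t) (J : ℕ) :
    t * dyadic J t ≤ (7 / 16) * (2 * t / (1 + 2 * t)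
      - 2 * ((1 / 2) ^ J * t) / (1 + 2 * ((1 / 2) ^ J * t))) := by
  induction J with
  | zero => simp [dyadic]
  | succ J ih =>
    have e : dyadic (J + 1) t = dyadic J t
        + (1 / 8) * (1 / 2) ^ J * (1 + ((1 / 2) ^ J * t) ^ 2)⁻¹ := Finset.sum_range_succ _ _
    set z := (1 / 2 : ℝ) ^ J * t with hz
    have hz0 : 0 ≤ z := by positivity
    have e2 : 2 * ((1 / 2 : ℝ) ^ (J + 1) * t) = z := by rw [hz]; ring
    rw [e, e2]
    have : t * ((1 / 8) * (1 / 2) ^ J * (1 + z ^ 2)⁻¹)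
        ≤ (7 / 16) * (2 * z / (1 + 2 * z) - z / (1 + z)) := by
      have e3 : t * ((1 / 8) * (1 / 2) ^ J * (1 + z ^ 2)⁻¹) = z / (8 * (1 + z ^ 2)) := by
        rw [hz]; field_simp
      have e4 : (7 / 16) * (2 * z / (1 + 2 * z) - z / (1 + z))
          = 7 * z / (16 * ((1 + 2 * z) * (1 + z))) := by field_simp; ring
      rw [e3, e4, div_le_div_iff₀ (by positivity) (by positivity)]
      nlinarith [mul_nonneg hz0 (sq_nonneg (z - 1)), mul_nonneg hz0 (sq_nonneg z)]
    linarith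

lemma abs_mul_dyadic (J : ℕ) (t : ℝ) : |t * dyadic J t| ≤ 1 / 2 := by
  rw [abs_mul, abs_of_nonneg (dyadic_nonneg J t), ← dyadic_abs]
  have h := mul_dyadic_aux (abs_nonneg t) J
  have h1 : 2 * |t| / (1 + 2 * |t|) ≤ 1 := by
    rw [div_le_one (by positivity)]; linarith
  have h2 : 0 ≤ 2 * ((1 / 2) ^ J * |t|) / (1 + 2 * ((1 / 2) ^ J * |t|)) := by positivity
  linarith

lemma sum_geom_le (r : ℝ) (h0 : 0 ≤ r) (h1 : r < 1) (J : ℕ) :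
    ∑ j ∈ Finset.range J, r ^ j ≤ 1 / (1 - r) := by
  rw [one_div, ← tsum_geometric_of_lt_one h0 h1]
  exact (summable_geometric_of_lt_one h0 h1).sum_le_tsum _ fun _ _ => by positivity

lemma dyadic_le (J : ℕ) (t : ℝ) : dyadic J t ≤ 1 / 4 := by
  calc dyadic J t ≤ ∑ j ∈ Finset.range J, (1 / 8) * (1 / 2 : ℝ) ^ j := by
        refine Finset.sum_le_sum fun j _ => ?_
        refine mul_le_of_le_one_right (by positivity) (inv_le_one_of_one_le₀ ?_)
        nlinarith [sq_nonneg ((1 / 2) ^ j * t)]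
    _ ≤ 1 / 4 := by
        rw [← Finset.mul_sum]
        linarith [sum_geom_le (1 / 2) (by norm_num) (by norm_num) J]

lemma dyadic_zero_sub (J : ℕ) (t : ℝ) : |dyadic J t - dyadic J 0| ≤ t ^ 2 / 7 := by
  rw [dyadic, dyadic, ← Finset.sum_sub_distrib]
  calc |∑ j ∈ Finset.range J, ((1 / 8) * (1 / 2) ^ j * (1 + ((1 / 2) ^ j * t) ^ 2)⁻¹
        - (1 / 8) * (1 / 2) ^ j * (1 + ((1 / 2) ^ j * 0) ^ 2)⁻¹)|
      ≤ ∑ j ∈ Finset.range J, (1 / 8) * t ^ 2 * (1 / 8 : ℝ) ^ j := by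
        refine (Finset.abs_sum_le_sum_abs _ _).trans (Finset.sum_le_sum fun j _ => ?_)
        set l := (1 / 2 : ℝ) ^ j with hl
        have hl0 : 0 < l := by positivity
        have e : (1 / 8 : ℝ) ^ j = l ^ 3 := by rw [hl, ← pow_mul, mul_comm, pow_mul]; norm_num
        have h1 : 0 < 1 + (l * t) ^ 2 := by positivity
        have e2 : (1 / 8) * l * (1 + (l * t) ^ 2)⁻¹ - (1 / 8) * l * (1 + (l * 0) ^ 2)⁻¹
            = -((1 / 8) * t ^ 2 * l ^ 3 * (1 + (l * t) ^ 2)⁻¹) := by field_simp; ring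
        rw [e, e2, abs_neg, abs_of_nonneg (by positivity)]
        refine mul_le_of_le_one_right (by positivity) (inv_le_one_of_one_le₀ ?_)
        nlinarith [sq_nonneg (l * t)]
    _ ≤ t ^ 2 / 7 := by
        rw [← Finset.mul_sum]
        nlinarith [sum_geom_le (1 / 8) (by norm_num) (by norm_num) J, sq_nonneg t]

lemma abs_dyadic_quot {J : ℕ} (hJ : 0 < J) {t : ℝ} (ht : |t| < 2 ^ J) :
    |(dyadic J t - dyadic J 0) / (t * dyadic J t)| ≤ 12 := by
  rcases eq_or_ne t 0 with rfl | h0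
  · simp
  have hb : 0 < dyadic J t := by
    have := dyadic_lower hJ t
    by_contra! h
    nlinarith [sq_nonneg t, dyadic_nonneg J t]
  have ht0 : 0 < |t| := abs_pos.2 h0
  rw [abs_div, abs_mul, abs_of_pos hb, div_le_iff₀ (by positivity)]
  rcases le_total |t| 1 with h1 | h1
  · have h2 := dyadic_lower hJ t
    have h3 : t ^ 2 ≤ |t| := by rw [← sq_abs]; nlinarith
    have h4 : 1 / 16 ≤ dyadic J t := by nlinarith
    have := dyadic_zero_sub J t
    nlinarith
  · obtain ⟨j, hj1, hj2⟩ := exists_nat_pow_near h1 (by norm_num : (1 : ℝ) < 2)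
    have hjJ : j < J := by
      by_contra! h
      have : (2 : ℝ) ^ J ≤ 2 ^ j := pow_le_pow_right₀ (by norm_num) h
      linarith
    have h2 := dyadic_term_le J t hjJ
    have hz : |t| * ((1 / 8) * (1 / 2) ^ j * (1 + ((1 / 2) ^ j * t) ^ 2)⁻¹) ≥ 1 / 20 := by
      have e : ((1 / 2) ^ j * t) ^ 2 = ((1 / 2) ^ j * |t|) ^ 2 := by
        rw [mul_pow, mul_pow, sq_abs]
      set z := (1 / 2 : ℝ) ^ j * |t| with hz
      have hp : (0 : ℝ) < 2 ^ j := by positivity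
      have hz1 : 1 ≤ z := by
        rw [hz, one_div, inv_pow, inv_mul_eq_div, le_div_iff₀ hp]; linarith
      have hz2 : z < 2 := by
        rw [hz, one_div, inv_pow, inv_mul_eq_div, div_lt_iff₀ hp]
        rw [pow_succ] at hj2; linarith
      rw [e]
      have e2 : |t| * ((1 / 8) * (1 / 2) ^ j * (1 + z ^ 2)⁻¹) = (1 / 8) * (z / (1 + z ^ 2)) := by
        rw [hz]; ring
      have h5 : 2 / 5 ≤ z / (1 + z ^ 2) := by
        rw [div_le_div_iff₀ (by norm_num) (by positivity)]; nlinarith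
      rw [e2]; linarith
    have h6 : 1 / 20 ≤ |t| * dyadic J t := hz.le.trans (mul_le_mul_of_nonneg_left h2 ht0.le)
    have h7 : |dyadic J t - dyadic J 0| ≤ 1 / 4 := by
      rw [abs_le]
      constructor <;> linarith [dyadic_le J t, dyadic_le J 0, dyadic_nonneg J t, dyadic_nonneg J 0]
    linarith

end kpart

/-- Algebras in which every element has finite spectrum. -/
class FinSpec (A : Type*) [Ring A] [Algebra ℂ A] : Prop where
  fin : ∀ a : A, (spectrum ℂ a).Finite

section finspec

variable {A : Type*} [CStarAlgebra A] [FinSpec A]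

lemma contC (f : ℂ → ℂ) (a : A) : ContinuousOn f (spectrum ℂ a) := (FinSpec.fin a).continuousOn f

lemma contR (f : ℝ → ℝ) (a : A) : ContinuousOn f (spectrum ℝ a) := by
  refine Set.Finite.continuousOn ?_ f
  rw [← spectrum.preimage_algebraMap (R := ℝ) ℂ]
  exact (FinSpec.fin a).preimage ((algebraMap ℝ ℂ).injective.injOn)

lemma cfcR_mul (f g : ℝ → ℝ) (a : A) : cfc (fun t => f t * g t) a = cfc f a * cfc g a :=
  cfc_mul f g a (contR f a) (contR g a)

lemma cfcC_mul (f g : ℂ → ℂ) (a : A) : cfc (fun t => f t * g t) a = cfc f a * cfc g a :=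
  cfc_mul f g a (contC f a) (contC g a)

lemma cfcR_sub (f g : ℝ → ℝ) (a : A) : cfc (fun t => f t - g t) a = cfc f a - cfc g a :=
  cfc_sub f g a (contR f a) (contR g a)

lemma cfcC_sub (f g : ℂ → ℂ) (a : A) : cfc (fun t => f t - g t) a = cfc f a - cfc g a :=
  cfc_sub f g a (contC f a) (contC g a)

lemma cfcR_add (f g : ℝ → ℝ) (a : A) : cfc (fun t => f t + g t) a = cfc f a + cfc g a :=
  cfc_add a f g (contR f a) (contR g a)

lemma cfcC_add (f g : ℂ → ℂ) (a : A) : cfc (fun t => f t + g t) a = cfc f a + cfc g a :=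
  cfc_add a f g (contC f a) (contC g a)

lemma norm_cfcR_le {f : ℝ → ℝ} {a : A} {c : ℝ} (hc : 0 ≤ c) (h : ∀ t ∈ spectrum ℝ a, |f t| ≤ c) :
    ‖cfc f a‖ ≤ c := norm_cfc_le hc h

end finspec

section kpart

variable {A : Type*} [CStarAlgebra A] [PartialOrder A] [StarOrderedRing A] [FinSpec A]
  [Nontrivial A]

lemma norm_resolvent_commutator {k : A} (hk : IsSelfAdjoint k) {l : ℝ} (hl : 0 ≤ l) (U : A) :
    ‖U * cfc (fun t : ℝ => (1 + (l * t) ^ 2)⁻¹) k - cfc (fun t : ℝ => (1 + (l * t) ^ 2)⁻¹) k * U‖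
      ≤ l * ‖U * k - k * U‖ ∧
    ‖U * (k * cfc (fun t : ℝ => (1 + (l * t) ^ 2)⁻¹) k)
      - k * cfc (fun t : ℝ => (1 + (l * t) ^ 2)⁻¹) k * U‖ ≤ (9 / 4) * ‖U * k - k * U‖ := by
  set f := cfc (fun t : ℝ => (1 + (l * t) ^ 2)⁻¹) k with hf
  set g := cfc (fun t : ℝ => (l * t) * (1 + (l * t) ^ 2)⁻¹) k with hg
  have hid : cfc (fun t : ℝ => t) k = k := cfc_id' ℝ k
  have hlk : cfc (fun t : ℝ => l * t) k = l • k := by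
    rw [cfc_const_mul _ _ _ (contR _ _), hid]
  have hgk : g = l • (k * f) := by
    rw [hg, cfcR_mul, hlk, smul_mul_assoc]
  have hfk : k * f = f * k := by
    nth_rw 1 [← hid]; nth_rw 2 [← hid]
    exact (cfc_commute_cfc _ _ _).eq
  have nf : ‖f‖ ≤ 1 := norm_cfcR_le one_pos.le fun t _ => by
    rw [abs_of_pos (by positivity)]
    exact inv_le_one_of_one_le₀ (by nlinarith [sq_nonneg (l * t)])
  have ng : ‖g‖ ≤ 1 / 2 := norm_cfcR_le (by norm_num) fun t _ => by
    rw [← div_eq_mul_inv, abs_div, abs_of_pos (by positivity : 0 < 1 + (l * t) ^ 2),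
      div_le_iff₀ (by positivity), ← sq_abs]
    nlinarith [sq_nonneg (|l * t| - 1)]
  have hinv : f * (1 + (l ^ 2) • (k * k)) = 1 := by
    have e : cfc (fun t : ℝ => 1 + (l * t) ^ 2) k = 1 + (l ^ 2) • (k * k) := by
      rw [cfcR_add, cfc_const_one ℝ k]
      congr 1
      rw [show (fun t : ℝ => (l * t) ^ 2) = fun t => (l * t) * (l * t) by ext t; ring, cfcR_mul,
        hlk, smul_mul_smul_comm, sq]
    rw [← e, hf, ← cfcR_mul, ← cfc_const_one ℝ k]
    refine cfc_congr fun t _ => inv_mul_cancel₀ (by positivity)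
  have hinv' : (1 + (l ^ 2) • (k * k)) * f = 1 := by
    have h : Commute (k * k) f := Commute.mul_left hfk hfk
    rw [add_mul, smul_mul_assoc, h.eq, ← mul_smul_comm, one_mul, ← hinv, mul_add, mul_one]
  set C := U * k - k * U with hC
  have h1 : U * f - f * U = -((l • (f * C * g)) + l • (g * C * f)) := by
    have : U * f - f * U = -(f * (U * (1 + (l ^ 2) • (k * k)) - (1 + (l ^ 2) • (k * k)) * U) * f) := by
      rw [mul_sub, sub_mul, ← mul_assoc f _ U, hinv, one_mul, mul_assoc f, mul_assoc U,
        hinv', mul_one, neg_sub]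
    rw [this, hgk]
    congr 1
    simp only [mul_add, add_mul, mul_one, one_mul, smul_mul_assoc, mul_smul_comm, smul_smul, hC]
    rw [add_sub_add_left_eq_sub, ← smul_sub, mul_smul_comm, smul_mul_assoc, ← sq, ← smul_add]
    congr 1
    · ring
    · rw [show k * f * (U * k - k * U) * f = f * k * (U * k - k * U) * f by rw [hfk]]
      noncomm_ring
  have b1 : ‖l • (f * C * g)‖ ≤ l * (‖C‖ * (1 / 2)) := by
    rw [norm_smul, Real.norm_of_nonneg hl]
    refine mul_le_mul_of_nonneg_left ?_ hl
    calc ‖f * C * g‖ ≤ ‖f‖ * ‖C‖ * ‖g‖ :=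
          (norm_mul_le _ _).trans (mul_le_mul_of_nonneg_right (norm_mul_le _ _) (norm_nonneg _))
      _ ≤ 1 * ‖C‖ * (1 / 2) := by gcongr
      _ = _ := by ring
  have b2 : ‖l • (g * C * f)‖ ≤ l * (‖C‖ * (1 / 2)) := by
    rw [norm_smul, Real.norm_of_nonneg hl]
    refine mul_le_mul_of_nonneg_left ?_ hl
    calc ‖g * C * f‖ ≤ ‖g‖ * ‖C‖ * ‖f‖ :=
          (norm_mul_le _ _).trans (mul_le_mul_of_nonneg_right (norm_mul_le _ _) (norm_nonneg _))
      _ ≤ (1 / 2) * ‖C‖ * 1 := by gcongr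
      _ = _ := by ring
  constructor
  · rw [h1, norm_neg]
    refine (norm_add_le _ _).trans ?_
    linarith
  · have e : U * (k * f) - k * f * U = C * f - (g * C * g + l • (k * g) * C * f) := by
      have : U * (k * f) - k * f * U = C * f + k * (U * f - f * U) := by rw [hC]; noncomm_ring
      rw [this, h1, mul_neg, mul_add, ← sub_eq_add_neg]
      congr 2
      · rw [hgk]; simp [mul_assoc]
      · simp [mul_assoc]
    have ng2 : ‖l • (k * g)‖ ≤ 1 := by
      have : l • (k * g) = cfc (fun t : ℝ => (l * t) * ((l * t) * (1 + (l * t) ^ 2)⁻¹)) k := by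
        rw [cfcR_mul, hlk, smul_mul_assoc]
      rw [this]
      refine norm_cfcR_le one_pos.le fun t _ => ?_
      rw [← mul_assoc, abs_of_nonneg (mul_nonneg (mul_self_nonneg _) (by positivity)),
        ← div_eq_mul_inv, div_le_one (by positivity)]
      nlinarith
    rw [e]
    have c1 : ‖C * f‖ ≤ ‖C‖ * 1 :=
      (norm_mul_le _ _).trans (mul_le_mul_of_nonneg_left nf (norm_nonneg _))
    have c2 : ‖g * C * g‖ ≤ (1 / 2) * ‖C‖ * (1 / 2) :=
      calc ‖g * C * g‖ ≤ ‖g‖ * ‖C‖ * ‖g‖ :=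
          (norm_mul_le _ _).trans (mul_le_mul_of_nonneg_right (norm_mul_le _ _) (norm_nonneg _))
        _ ≤ _ := by gcongr
    have c3 : ‖l • (k * g) * C * f‖ ≤ 1 * ‖C‖ * 1 :=
      calc ‖l • (k * g) * C * f‖ ≤ ‖l • (k * g)‖ * ‖C‖ * ‖f‖ :=
          (norm_mul_le _ _).trans (mul_le_mul_of_nonneg_right (norm_mul_le _ _) (norm_nonneg _))
        _ ≤ _ := by gcongr
    have := norm_sub_le (C * f) (g * C * g + l • (k * g) * C * f)
    have := norm_add_le (g * C * g) (l • (k * g) * C * f)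
    linarith

/-- A bounded function `y` of `k`, with the auxiliary functions `b = y / k` and
`m = (b - b(0)) / y`. -/
structure KPart (k : A) (β : ℝ) (b y m : A) : Prop where
  hβ : |β| ≤ 1
  bb : ‖b‖ ≤ 1
  by' : ‖y‖ ≤ 1 / 2
  bm : ‖m‖ ≤ 12
  ys : star y = y
  bk : b * k = y
  kb : k * b = y
  ym : y * m = m * y
  bm_eq : b = (β : ℂ) • 1 + m * y
  posb : 0 ≤ b
  big : 0 ≤ (8 : ℂ) • (b + k * y) - 1
  comm_b : ∀ U : A, ‖U * b - b * U‖ ≤ ‖U * k - k * U‖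
  comm_y : ∀ U : A, ‖U * y - y * U‖ ≤ ‖U * k - k * U‖

theorem exists_kPart {k : A} (hk : IsSelfAdjoint k) : ∃ β b y m, KPart k β b y m := by
  obtain ⟨J', hJ'⟩ := pow_unbounded_of_one_lt ‖k‖ (by norm_num : (1 : ℝ) < 2)
  obtain ⟨J, hJ, hJk⟩ : ∃ J : ℕ, 0 < J ∧ ‖k‖ < 2 ^ J :=
    ⟨J' + 1, Nat.succ_pos _, hJ'.trans (pow_lt_pow_right₀ (by norm_num) (Nat.lt_succ_self _))⟩
  have hid : cfc (fun t : ℝ => t) k = k := cfc_id' ℝ k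
  have hspec : ∀ t ∈ spectrum ℝ k, |t| < 2 ^ J := fun t ht =>
    (spectrum.norm_le_norm_of_mem ht).trans_lt hJk
  set b := cfc (dyadic J) k with hb
  set f : ℕ → A := fun j => cfc (fun t : ℝ => (1 + ((1 / 2) ^ j * t) ^ 2)⁻¹) k with hf
  have hbs : b = ∑ j ∈ Finset.range J, ((1 / 8 : ℝ) * (1 / 2) ^ j) • f j := by
    have : dyadic J = ∑ j ∈ Finset.range J,
      fun t : ℝ => (1 / 8 : ℝ) * (1 / 2) ^ j * (1 + ((1 / 2) ^ j * t) ^ 2)⁻¹ := by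
        ext t; simp [dyadic]
    rw [hb, this, cfc_sum _ _ _ (fun _ _ => contR _ _)]
    exact Finset.sum_congr rfl fun j _ => cfc_const_mul _ _ _ (contR _ _)
  have hy : cfc (fun t => t * dyadic J t) k = k * b := by rw [cfcR_mul, hid]
  have hbk : b * k = k * b := by
    nth_rw 1 [← hid]; nth_rw 2 [← hid]
    exact (cfc_commute_cfc _ _ _).eq
  have hys : k * b = ∑ j ∈ Finset.range J, ((1 / 8 : ℝ) * (1 / 2) ^ j) • (k * f j) := by
    rw [hbs, Finset.mul_sum]
    exact Finset.sum_congr rfl fun j _ => mul_smul_comm _ _ _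
  refine ⟨dyadic J 0, b, k * b,
    cfc (fun t => (dyadic J t - dyadic J 0) / (t * dyadic J t)) k, ?_⟩
  constructor
  · rw [abs_of_nonneg (dyadic_nonneg _ _)]; linarith [dyadic_le J 0]
  · refine norm_cfcR_le one_pos.le fun t _ => ?_
    rw [abs_of_nonneg (dyadic_nonneg _ _)]; linarith [dyadic_le J t]
  · rw [← hy]
    exact norm_cfcR_le (by norm_num) fun t _ => abs_mul_dyadic J t
  · exact norm_cfcR_le (by norm_num) fun t ht => abs_dyadic_quot hJ (hspec t ht)
  · rw [← hy]; exact (cfc_predicate (R := ℝ) _ k : IsSelfAdjoint _)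
  · exact hbk
  · rfl
  · rw [← hy]; exact (cfc_commute_cfc _ _ _).eq
  · rw [← hy, ← cfcR_mul, Complex.coe_smul, ← Algebra.algebraMap_eq_smul_one,
      ← cfc_const (dyadic J 0) k, ← cfcR_add]
    refine cfc_congr fun t _ => ?_
    rcases eq_or_ne t 0 with rfl | h0
    · simp
    have : dyadic J t ≠ 0 := fun h => by
      have := dyadic_lower hJ t
      rw [h] at this; norm_num at this
    rw [div_mul_cancel₀ _ (mul_ne_zero h0 this)]; ring
  · exact cfc_nonneg fun t _ => dyadic_nonneg J t
  · have e : (8 : ℂ) • (b + k * (k * b)) - 1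
        = cfc (fun t => 8 * (dyadic J t + t * (t * dyadic J t)) - 1) k := by
      rw [cfcR_sub, cfc_const_mul _ _ _ (contR _ _), cfcR_add, cfcR_mul (fun t => t), hy, hid,
        cfc_const_one ℝ k, ← Complex.coe_smul (8 : ℝ), ← hb]
      norm_num
    rw [e]
    refine cfc_nonneg fun t _ => ?_
    linarith [dyadic_lower hJ t]
  · intro U
    have e : U * b - b * U = ∑ j ∈ Finset.range J,
        ((1 / 8 : ℝ) * (1 / 2) ^ j) • (U * f j - f j * U) := by
      rw [hbs, Finset.mul_sum, Finset.sum_mul, ← Finset.sum_sub_distrib]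
      exact Finset.sum_congr rfl fun j _ => by rw [smul_sub, mul_smul_comm, smul_mul_assoc]
    rw [e]
    calc _ ≤ ∑ j ∈ Finset.range J, (1 / 8) * ‖U * k - k * U‖ * (1 / 2 : ℝ) ^ j := by
          refine norm_sum_le_of_le _ fun j _ => ?_
          rw [norm_smul, Real.norm_of_nonneg (by positivity)]
          have h1 := (norm_resolvent_commutator hk (l := (1 / 2) ^ j) (by positivity) U).1
          have h2 : (1 / 2 : ℝ) ^ j ≤ 1 := pow_le_one₀ (by norm_num) (by norm_num)
          have h3 : (1 / 2 : ℝ) ^ j * ‖U * k - k * U‖ ≤ ‖U * k - k * U‖ :=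
            mul_le_of_le_one_left (norm_nonneg _) h2
          have h4 := h1.trans h3
          calc (1 / 8) * (1 / 2) ^ j * ‖U * f j - f j * U‖
              ≤ (1 / 8) * (1 / 2) ^ j * ‖U * k - k * U‖ := by gcongr
            _ = _ := by ring
      _ ≤ _ := by
          rw [← Finset.mul_sum]
          nlinarith [sum_geom_le (1 / 2) (by norm_num) (by norm_num) J, norm_nonneg (U * k - k * U)]
  · intro U
    have e : U * (k * b) - k * b * U = ∑ j ∈ Finset.range J,
        ((1 / 8 : ℝ) * (1 / 2) ^ j) • (U * (k * f j) - k * f j * U) := by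
      rw [hys, Finset.mul_sum, Finset.sum_mul, ← Finset.sum_sub_distrib]
      exact Finset.sum_congr rfl fun j _ => by rw [smul_sub, mul_smul_comm, smul_mul_assoc]
    rw [e]
    calc _ ≤ ∑ j ∈ Finset.range J, (9 / 32) * ‖U * k - k * U‖ * (1 / 2 : ℝ) ^ j := by
          refine norm_sum_le_of_le _ fun j _ => ?_
          rw [norm_smul, Real.norm_of_nonneg (by positivity)]
          have h1 := (norm_resolvent_commutator hk (l := (1 / 2) ^ j) (by positivity) U).2
          calc (1 / 8) * (1 / 2) ^ j * ‖U * (k * f j) - k * f j * U‖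
              ≤ (1 / 8) * (1 / 2) ^ j * ((9 / 4) * ‖U * k - k * U‖) := by gcongr
            _ = _ := by ring
      _ ≤ _ := by
          rw [← Finset.mul_sum]
          nlinarith [sum_geom_le (1 / 2) (by norm_num) (by norm_num) J, norm_nonneg (U * k - k * U)]

end kpart

section label
open Complex ComplexConjugate

/-- `κ` rounds unit complex numbers to a nearest `L`-th root of `τ`. -/
structure IsLabel (κ : ℂ → ℂ) (L : ℕ) (τ : ℂ) : Prop where
  pow_eq : ∀ z, ‖z‖ = 1 → κ z ^ L = τ
  norm_eq : ∀ z, ‖z‖ = 1 → ‖κ z‖ = 1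
  cos_le : ∀ z, ‖z‖ = 1 → Real.cos (Real.pi / L) ≤ (conj (κ z) * z).re
  eq_of_lt : ∀ z, ‖z‖ = 1 → ∀ c, c ^ L = τ → Real.cos (Real.pi / L) < (conj c * z).re → κ z = c

/-- Rounding to the nearest `L`-th root of `τ`. -/
def lab (L : ℕ) (τ z : ℂ) : ℂ := z * exp (-(((z ^ L / τ).arg / L : ℝ) : ℂ) * I)

variable {L : ℕ} {τ : ℂ}

lemma exp_arg_of_norm {w : ℂ} (hw : ‖w‖ = 1) : exp ((w.arg : ℂ) * I) = w := by
  have := norm_mul_exp_arg_mul_I w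
  rwa [hw, ofReal_one, one_mul] at this

lemma norm_exp_neg_real (x : ℝ) : ‖exp (-(x : ℂ) * I)‖ = 1 := by
  rw [← ofReal_neg]; exact norm_exp_ofReal_mul_I _

lemma conj_mul_self_of_norm {z : ℂ} (hz : ‖z‖ = 1) : conj z * z = 1 := by
  rw [mul_comm, mul_conj, normSq_eq_norm_sq, hz]; simp

lemma conj_exp_neg (x : ℝ) : conj (exp (-(x : ℂ) * I)) = exp ((x : ℂ) * I) := by
  rw [← exp_conj]; simp

lemma norm_lab {z : ℂ} (hz : ‖z‖ = 1) : ‖lab L τ z‖ = 1 := by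
  rw [lab, norm_mul, hz, one_mul, norm_exp_neg_real]

lemma conj_lab_mul {z : ℂ} (hz : ‖z‖ = 1) :
    conj (lab L τ z) * z = exp ((((z ^ L / τ).arg / L : ℝ) : ℂ) * I) := by
  rw [lab, map_mul, conj_exp_neg, mul_right_comm, conj_mul_self_of_norm hz, one_mul]

lemma lab_pow (hL : L ≠ 0) (hτ : ‖τ‖ = 1) {z : ℂ} (hz : ‖z‖ = 1) : lab L τ z ^ L = τ := by
  have hw : ‖z ^ L / τ‖ = 1 := by rw [norm_div, norm_pow, hz, hτ]; simp
  have h0 : τ ≠ 0 := norm_ne_zero_iff.1 (by rw [hτ]; exact one_ne_zero)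
  have e : (L : ℂ) * (-(((z ^ L / τ).arg / L : ℝ) : ℂ) * I) = -(((z ^ L / τ).arg : ℂ) * I) := by
    push_cast; field_simp
  rw [lab, mul_pow, ← exp_nat_mul, e, exp_neg, exp_arg_of_norm hw]
  have h1 : z ^ L ≠ 0 := pow_ne_zero _ (norm_ne_zero_iff.1 (by rw [hz]; exact one_ne_zero))
  field_simp

lemma lab_eq_of_angle (hL : L ≠ 0) {c : ℂ} (hτ : ‖τ‖ = 1) (hc : c ^ L = τ) {x : ℝ}
    (hx : L * |x| < Real.pi) : lab L τ (c * exp ((x : ℂ) * I)) = c := by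
  have h0 : τ ≠ 0 := norm_ne_zero_iff.1 (by rw [hτ]; exact one_ne_zero)
  have e : (c * exp ((x : ℂ) * I)) ^ L / τ = exp (((L * x : ℝ) : ℂ) * I) := by
    rw [mul_pow, hc, ← exp_nat_mul, mul_div_cancel_left₀ _ h0]; push_cast; ring_nf
  have hLp : (0 : ℝ) < L := by positivity
  have e2 : (exp (((L * x : ℝ) : ℂ) * I)).arg = L * x := by
    have h1 : |(L : ℝ) * x| < Real.pi := by rwa [abs_mul, abs_of_pos hLp]
    rw [exp_mul_I]
    exact arg_cos_add_sin_mul_I ⟨(abs_lt.1 h1).1, (abs_lt.1 h1).2.le⟩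
  rw [lab, e, e2, mul_div_cancel_left₀ _ hLp.ne', mul_assoc, ← exp_add]
  simp

lemma eq_mul_exp_arg {c z : ℂ} (hc : ‖c‖ = 1) (hz : ‖z‖ = 1) :
    z = c * exp (((conj c * z).arg : ℂ) * I) := by
  rw [exp_arg_of_norm (by rw [norm_mul, RCLike.norm_conj, hc, hz, one_mul]), ← mul_assoc,
    mul_comm c, conj_mul_self_of_norm hc, one_mul]

lemma re_eq_cos_arg {w : ℂ} (hw : ‖w‖ = 1) : w.re = Real.cos w.arg := by
  nth_rw 1 [← exp_arg_of_norm hw]; exact exp_ofReal_mul_I_re _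

lemma abs_arg_lt_of_cos_lt {w : ℂ} (hw : ‖w‖ = 1) {θ : ℝ} (h0 : 0 ≤ θ) (h : Real.cos θ < w.re) :
    |w.arg| < θ := by
  rw [re_eq_cos_arg hw, ← Real.cos_abs w.arg] at h
  by_contra! hle
  have := Real.cos_le_cos_of_nonneg_of_le_pi h0 (abs_arg_le_pi w) hle
  linarith

lemma norm_of_pow_eq (hL : L ≠ 0) (hτ : ‖τ‖ = 1) {c : ℂ} (hc : c ^ L = τ) : ‖c‖ = 1 := by
  have := congrArg norm hc
  rw [norm_pow, hτ] at this
  exact (pow_eq_one_iff_of_nonneg (norm_nonneg _) hL).1 this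

lemma isLabel_lab (hL : L ≠ 0) (hτ : ‖τ‖ = 1) : IsLabel (lab L τ) L τ where
  pow_eq z hz := lab_pow hL hτ hz
  norm_eq z hz := norm_lab hz
  cos_le z hz := by
    have hLp : (0 : ℝ) < L := by positivity
    have h1L : (1 : ℝ) ≤ L := by exact_mod_cast Nat.one_le_iff_ne_zero.2 hL
    rw [conj_lab_mul hz, exp_ofReal_mul_I_re, ← Real.cos_abs ((z ^ L / τ).arg / L)]
    refine Real.cos_le_cos_of_nonneg_of_le_pi (abs_nonneg _) ?_ ?_
    · exact div_le_self Real.pi_pos.le h1L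
    · rw [abs_div, abs_of_pos hLp]
      gcongr
      exact abs_arg_le_pi _
  eq_of_lt z hz c hc h := by
    have hLp : (0 : ℝ) < L := by positivity
    have hcn := norm_of_pow_eq hL hτ hc
    have hw : ‖conj c * z‖ = 1 := by rw [norm_mul, RCLike.norm_conj, hcn, hz, one_mul]
    have h2 := abs_arg_lt_of_cos_lt hw (by positivity) h
    rw [eq_mul_exp_arg hcn hz]
    refine lab_eq_of_angle hL hτ hc ?_
    rwa [lt_div_iff₀' hLp] at h2

/-- Rounding first to a `2M`-th root of `-1` and then to an `M`-th root of `τ = ±1`. -/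
lemma isLabel_lab_lab {M : ℕ} (hM : M ≠ 0) (hτ : τ = 1 ∨ τ = -1) :
    IsLabel (fun z => lab M τ (lab (2 * M) (-1) z)) M τ := by
  have hτn : ‖τ‖ = 1 := by rcases hτ with rfl | rfl <;> simp
  have hMp : (0 : ℝ) < M := by positivity
  have hM2 : (0 : ℝ) < 2 * M := by positivity
  have hM1 : (1 : ℝ) ≤ M := by exact_mod_cast Nat.one_le_iff_ne_zero.2 hM
  have hM2' : 2 * M ≠ 0 := by omega
  have hW := isLabel_lab (L := 2 * M) (τ := -1) hM2' (by simp)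
  have hsq : ∀ z : ℂ, ‖z‖ = 1 → (lab (2 * M) (-1) z) ^ M / τ = I ∨
      (lab (2 * M) (-1) z) ^ M / τ = -I := fun z hz => by
    have h := hW.pow_eq z hz
    have h1 : τ ^ 2 = 1 := by rcases hτ with rfl | rfl <;> norm_num
    have h2 : ((lab (2 * M) (-1) z) ^ M / τ) ^ 2 = I ^ 2 := by
      rw [div_pow, h1, div_one, ← pow_mul, mul_comm M, h, I_sq]
    exact sq_eq_sq_iff_eq_or_eq_neg.1 h2
  refine ⟨fun z hz => lab_pow hM hτn (norm_lab hz), fun z hz => norm_lab (norm_lab hz),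
    fun z hz => ?_, fun z hz c hc h => ?_⟩
  · have harg : |((lab (2 * M) (-1) z) ^ M / τ).arg| ≤ Real.pi / 2 := by
      rcases hsq z hz with h | h <;> rw [h]
      · rw [arg_I, abs_of_pos (by positivity)]
      · rw [arg_neg_I, abs_of_neg (by linarith [Real.pi_pos])]; linarith
    have e : conj (lab M τ (lab (2 * M) (-1) z)) * z
        = (conj (lab M τ (lab (2 * M) (-1) z)) * lab (2 * M) (-1) z)
          * (conj (lab (2 * M) (-1) z) * z) := by
      have := conj_mul_self_of_norm (norm_lab (L := 2 * M) (τ := -1) hz)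
      rw [mul_comm] at this
      rw [mul_assoc, ← mul_assoc (lab (2 * M) (-1) z), this, one_mul]
    rw [e, conj_lab_mul (norm_lab hz), conj_lab_mul hz, ← exp_add, ← add_mul, ← ofReal_add,
      exp_ofReal_mul_I_re, ← Real.cos_abs (_ + _)]
    refine Real.cos_le_cos_of_nonneg_of_le_pi (abs_nonneg _) (div_le_self Real.pi_pos.le hM1) ?_
    refine (abs_add_le _ _).trans ?_
    rw [abs_div, abs_div, abs_of_pos hMp, Nat.cast_mul, Nat.cast_two, abs_of_pos hM2]
    have h1 : |((lab (2 * M) (-1) z) ^ M / τ).arg| / M ≤ Real.pi / 2 / M := by gcongr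
    have h2 : |(z ^ (2 * M) / -1).arg| / (2 * M) ≤ Real.pi / (2 * M) := by
      gcongr; exact abs_arg_le_pi _
    have h3 : Real.pi / 2 / M + Real.pi / (2 * M) = Real.pi / M := by field_simp; ring
    linarith
  · have hcn := norm_of_pow_eq hM hτn hc
    have hw : ‖conj c * z‖ = 1 := by rw [norm_mul, RCLike.norm_conj, hcn, hz, one_mul]
    have h2 := abs_arg_lt_of_cos_lt hw (by positivity) h
    set x := (conj c * z).arg with hx
    set y := (z ^ (2 * M) / -1).arg / ((2 * M : ℕ) : ℝ) with hy
    have hyle : |y| ≤ Real.pi / (2 * M) := by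
      rw [hy, abs_div, Nat.cast_mul, Nat.cast_two, abs_of_pos hM2]
      gcongr; exact abs_arg_le_pi _
    have e : lab (2 * M) (-1) z = c * exp (((x - y : ℝ) : ℂ) * I) := by
      have h3 : lab (2 * M) (-1) z = z * exp (-(y : ℂ) * I) := rfl
      rw [h3]
      nth_rw 1 [eq_mul_exp_arg hcn hz]
      rw [mul_assoc, ← exp_add, ← hx]
      congr 2
      push_cast; ring
    have hlt : M * |x - y| < Real.pi + Real.pi / 2 := by
      have h3 := abs_sub x y
      have h4 : M * |x| < Real.pi := by rwa [lt_div_iff₀' hMp] at h2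
      have h5 : M * |y| ≤ Real.pi / 2 := by
        have := mul_le_mul_of_nonneg_left hyle hMp.le
        have h6 : M * (Real.pi / (2 * M)) = Real.pi / 2 := by field_simp
        linarith
      nlinarith
    show lab M τ (lab (2 * M) (-1) z) = c
    have hq := hsq z hz
    rw [e] at hq ⊢
    refine lab_eq_of_angle hM hτn hc ?_
    by_contra! hge
    have h0 : τ ≠ 0 := norm_ne_zero_iff.1 (by rw [hτn]; exact one_ne_zero)
    have e3 : (c * exp (((x - y : ℝ) : ℂ) * I)) ^ M / τ = exp (((M * (x - y) : ℝ) : ℂ) * I) := by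
      rw [mul_pow, hc, ← exp_nat_mul, mul_div_cancel_left₀ _ h0]; push_cast; ring_nf
    have hre : (exp (((M * (x - y) : ℝ) : ℂ) * I)).re = 0 := by
      rw [← e3]; rcases hq with h | h <;> rw [h] <;> simp
    rw [exp_ofReal_mul_I_re, ← Real.cos_abs, abs_mul, abs_of_pos hMp] at hre
    have := Real.cos_neg_of_pi_div_two_lt_of_lt (x := M * |x - y|)
      (by linarith [Real.pi_pos]) (by linarith)
    linarith

lemma abs_sin_nat_mul_le (M : ℕ) (a : ℝ) : |Real.sin (M * a)| ≤ M * |Real.sin a| := by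
  induction M with
  | zero => simp
  | succ M ih =>
    rw [Nat.cast_succ, add_one_mul, Real.sin_add, add_one_mul]
    refine (abs_add_le _ _).trans (add_le_add ?_ ?_)
    · rw [abs_mul]
      exact (mul_le_of_le_one_right (abs_nonneg _) (Real.abs_cos_le_one _)).trans ih
    · rw [abs_mul]
      exact mul_le_of_le_one_left (abs_nonneg _) (Real.abs_cos_le_one _)

lemma abs_cos_nat_mul_sub_le (M : ℕ) (a b : ℝ) :
    |Real.cos (M * a) - Real.cos (M * b)| ≤ M ^ 2 * |Real.cos a - Real.cos b| := by
  rw [Real.cos_sub_cos, Real.cos_sub_cos, abs_mul, abs_mul, abs_mul, abs_mul,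
    ← mul_add, ← mul_sub, mul_div_assoc, mul_div_assoc]
  have h1 := abs_sin_nat_mul_le M ((a + b) / 2)
  have h2 := abs_sin_nat_mul_le M ((a - b) / 2)
  have := mul_le_mul h1 h2 (abs_nonneg _) (by positivity)
  calc _ = |(-2 : ℝ)| * (|Real.sin (M * ((a + b) / 2))| * |Real.sin (M * ((a - b) / 2))|) := by
        rw [mul_assoc]
    _ ≤ |(-2 : ℝ)| * (M * |Real.sin ((a + b) / 2)| * (M * |Real.sin ((a - b) / 2)|)) := by gcongr
    _ = _ := by ring

lemma norm_sub_label {κ : ℂ → ℂ} (h : IsLabel κ L τ) {z : ℂ} (hz : ‖z‖ = 1) :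
    ‖z - κ z‖ ≤ Real.pi / L := by
  have h1 := h.cos_le z hz
  have h2 := Real.one_sub_sq_div_two_le_cos (x := Real.pi / L)
  have e : ‖z - κ z‖ ^ 2 = 2 - 2 * (conj (κ z) * z).re := by
    have hk := h.norm_eq z hz
    have := norm_sub_sq_real z (κ z)
    rw [this, hz, hk]
    have : inner ℝ z (κ z) = (conj (κ z) * z).re := by
      rw [real_inner_comm]; simp [Complex.inner, mul_comm]
    rw [this]; ring
  refine abs_le_of_sq_le_sq' ?_ (by positivity) |>.2
  rw [e]; linarith

/-- The scalar estimate behind the pinching bounds. -/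
lemma abs_le_of_cos {M : ℕ} {θ γ : ℝ} (hγ : |γ| ≤ 1) {c z : ℂ} (hc : ‖c‖ = 1) (hz : ‖z‖ = 1)
    {W : ℝ} (hW1 : |W| ≤ 1)
    (hW : W = γ * (((conj c * z) ^ M).re - Real.cos (M * θ))) :
    |W| ≤ M * √|(conj c * z).re - Real.cos θ| := by
  have hw : ‖conj c * z‖ = 1 := by rw [norm_mul, RCLike.norm_conj, hc, hz, one_mul]
  have e : ((conj c * z) ^ M).re = Real.cos (M * (conj c * z).arg) := by
    nth_rw 1 [← exp_arg_of_norm hw]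
    rw [← exp_nat_mul, ← exp_ofReal_mul_I_re]
    push_cast; ring_nf
  have h1 := abs_cos_nat_mul_sub_le M (conj c * z).arg θ
  rw [← re_eq_cos_arg hw, ← e] at h1
  have h2 : |W| ≤ M ^ 2 * |(conj c * z).re - Real.cos θ| := by
    rw [hW, abs_mul]
    exact (mul_le_of_le_one_left (abs_nonneg _) hγ).trans h1
  have h3 : |W| ^ 2 ≤ M ^ 2 * |(conj c * z).re - Real.cos θ| := by
    nlinarith [abs_nonneg W]
  rw [← Real.sqrt_sq (abs_nonneg W)]
  refine (Real.sqrt_le_sqrt h3).trans ?_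
  rw [Real.sqrt_mul (by positivity), Real.sqrt_sq (by positivity)]

end label

section agm

variable {A : Type*} [CStarAlgebra A] [PartialOrder A] [StarOrderedRing A] [Nontrivial A]

lemma abs_le_norm_add_star {a : A} {r : ℝ} (hr : r ∈ spectrum ℝ a) :
    2 * |r| ≤ ‖a + star a‖ := by
  by_contra! hlt
  obtain ⟨s, hs, hsr⟩ : ∃ s : ℝ, s * s = 1 ∧ s * r = |r| := by
    rcases le_total 0 r with h | h
    · exact ⟨1, by norm_num, by rw [one_mul, abs_of_nonneg h]⟩
    · exact ⟨-1, by norm_num, by rw [abs_of_nonpos h]; ring⟩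
  set c := 2 * |r| - ‖a + star a‖ with hc
  have hc0 : 0 < c := by linarith
  set d : A := s • (algebraMap ℝ A r - a) with hd
  have hs1 : |s| = 1 := by
    rw [← sq_eq_sq₀ (abs_nonneg s) one_pos.le, sq_abs, sq, hs, one_pow]
  have hdd : algebraMap ℝ A c ≤ d + star d := by
    have e : d + star d = algebraMap ℝ A (2 * |r|) - s • (a + star a) := by
      rw [hd, star_smul, star_sub, ← algebraMap_star_comm, star_trivial, star_trivial, ← hsr,
        Algebra.algebraMap_eq_smul_one, Algebra.algebraMap_eq_smul_one]
      module
    have h1 : s • (a + star a) ≤ algebraMap ℝ A ‖a + star a‖ := by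
      have hsa : IsSelfAdjoint (s • (a + star a)) :=
        IsSelfAdjoint.smul (IsSelfAdjoint.all s) (IsSelfAdjoint.add_star_self a)
      have := hsa.le_algebraMap_norm_self
      rwa [norm_smul, Real.norm_eq_abs, hs1, one_mul] at this
    rw [e, hc, map_sub]
    exact sub_le_sub_left h1 _
  obtain ⟨ε, hε, hε1, hε2⟩ : ∃ ε : ℝ, 0 < ε ∧ ε * ‖d‖ ^ 2 < c ∧ ε * c ≤ 1 := by
    refine ⟨min (c / (‖d‖ ^ 2 + 1)) (1 / c), by positivity, ?_, ?_⟩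
    · calc _ ≤ c / (‖d‖ ^ 2 + 1) * ‖d‖ ^ 2 := by gcongr; exact min_le_left _ _
        _ < c := by rw [div_mul_eq_mul_div, div_lt_iff₀ (by positivity)]; nlinarith
    · calc _ ≤ 1 / c * c := by gcongr; exact min_le_right _ _
        _ = 1 := by field_simp
  have h2 : star (1 - ε • d) * (1 - ε • d) ≤ algebraMap ℝ A (1 - ε * c + ε ^ 2 * ‖d‖ ^ 2) := by
    have e : star (1 - ε • d) * (1 - ε • d)
        = 1 - ε • (d + star d) + ε ^ 2 • (star d * d) := by
      rw [star_sub, star_one, star_smul, star_trivial]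
      simp only [sub_mul, mul_sub, smul_mul_smul_comm, one_mul, mul_one, smul_add, sq]
      abel
    rw [e, map_add, map_sub, map_one]
    refine add_le_add (sub_le_sub_left ?_ _) ?_
    · rw [Algebra.algebraMap_eq_smul_one, mul_smul, ← Algebra.algebraMap_eq_smul_one]
      exact smul_le_smul_of_nonneg_left hdd hε.le
    · rw [Algebra.algebraMap_eq_smul_one, mul_smul, ← Algebra.algebraMap_eq_smul_one]
      exact smul_le_smul_of_nonneg_left CStarAlgebra.star_mul_le_algebraMap_norm_sq (by positivity)
  have h3 : ‖1 - ε • d‖ < 1 := by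
    have := (CStarAlgebra.norm_le_iff_le_algebraMap (star (1 - ε • d) * (1 - ε • d))
      (r := 1 - ε * c + ε ^ 2 * ‖d‖ ^ 2) (by nlinarith [sq_nonneg (ε * ‖d‖)])
      (star_mul_self_nonneg _)).2 h2
    rw [CStarRing.norm_star_mul_self] at this
    nlinarith [norm_nonneg (1 - ε • d)]
  have h4 := isUnit_one_sub_of_norm_lt_one h3
  rw [sub_sub_cancel, hd, smul_smul] at h4
  have hs0 : ε * s ≠ 0 := mul_ne_zero hε.ne' fun h => by rw [h] at hs; norm_num at hs
  refine (spectrum.mem_iff.1 hr) ?_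
  exact (isUnit_smul_iff (Units.mk0 _ hs0) (algebraMap ℝ A r - a)).1 h4

/-- The operator arithmetic-geometric mean inequality for self-adjoint elements. -/
lemma norm_conj_le {S X : A} (hS : star S = S) (hX : star X = X) :
    2 * ‖S * X * S‖ ≤ ‖X * (S * S) + S * S * X‖ := by
  have hsa : IsSelfAdjoint (S * X * S) := by
    rw [isSelfAdjoint_iff]; simp [hS, hX, mul_assoc]
  obtain ⟨r, hr, hrs⟩ : ∃ r : ℝ, |r| = ‖S * X * S‖ ∧ r ∈ spectrum ℝ (S * X * S) := by
    rcases CStarAlgebra.norm_or_neg_norm_mem_spectrum hsa with h | h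
    · exact ⟨_, abs_of_nonneg (norm_nonneg _), h⟩
    · exact ⟨_, by rw [abs_neg, abs_of_nonneg (norm_nonneg _)], h⟩
  rw [← hr]
  rcases eq_or_ne r 0 with rfl | h0
  · simp
  have hmem : r ∈ spectrum ℝ (X * S * S) \ {0} := by
    rw [spectrum.nonzero_mul_comm, ← mul_assoc]
    exact ⟨hrs, h0⟩
  have := abs_le_norm_add_star hmem.1
  rwa [star_mul, star_mul, hS, hX, mul_assoc, ← mul_assoc S] at this

lemma norm_proj_le {P : A} (hs : star P = P) (hm : P * P = P) : ‖P‖ ≤ 1 := by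
  have h : ‖P‖ * ‖P‖ = ‖P‖ := by rw [← CStarRing.norm_star_mul_self, hs, hm]
  nlinarith [norm_nonneg P]

lemma norm_mul_three_le (a b c : A) : ‖a * b * c‖ ≤ ‖a‖ * ‖b‖ * ‖c‖ :=
  (norm_mul_le _ _).trans (mul_le_mul_of_nonneg_right (norm_mul_le _ _) (norm_nonneg _))

lemma norm_proj_mul_mul_le {P Q : A} (hs : ‖P‖ ≤ 1) (hm : ‖Q‖ ≤ 1) (a : A) :
    ‖P * a * Q‖ ≤ ‖a‖ :=
  calc ‖P * a * Q‖ ≤ ‖P‖ * ‖a‖ * ‖Q‖ := norm_mul_three_le _ _ _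
    _ ≤ 1 * ‖a‖ * 1 := by gcongr
    _ = ‖a‖ := by ring

/-- Off-diagonal corners with respect to the sign of `S * S * (2P - 1)`. -/
lemma norm_corner_le {S P y : A} (hS : star S = S) (hP : star P = P) (hPP : P * P = P)
    (hSP : S * P = P * S) (hy : star y = y) :
    ‖P * (S * y * S) * (1 - P)‖
      ≤ ‖S * S * (P - (1 - P)) * y - y * (S * S * (P - (1 - P)))‖ := by
  set Q := 1 - P with hQ
  have hQs : star Q = Q := by rw [hQ, star_sub, star_one, hP]
  have hQQ : Q * Q = Q := by rw [hQ, sub_mul, mul_sub, mul_sub, hPP]; simp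
  have hPQ : P * Q = 0 := by rw [hQ, mul_sub, hPP, mul_one, sub_self]
  have hQP : Q * P = 0 := by rw [hQ, sub_mul, hPP, one_mul, sub_self]
  have hSQ : S * Q = Q * S := by rw [hQ, mul_sub, sub_mul, hSP, one_mul, mul_one]
  have nP := norm_proj_le hP hPP
  have nQ := norm_proj_le hQs hQQ
  set Z := S * S * (P - Q) * y - y * (S * S * (P - Q)) with hZ
  set X : A := Complex.I • (P * y * Q - Q * y * P) with hX
  have hXs : star X = X := by
    rw [hX, star_smul, star_sub]
    simp only [star_mul, hP, hQs, hy, Complex.star_def, Complex.conj_I, mul_assoc]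
    rw [neg_smul, ← smul_neg, neg_sub]
  have h1 : P * (S * y * S) * Q = (-Complex.I) • (P * (S * X * S) * Q) := by
    have : P * (S * X * S) * Q = Complex.I • (P * (S * y * S) * Q) := by
      rw [hX, mul_smul_comm, smul_mul_assoc, mul_smul_comm, smul_mul_assoc]
      congr 1
      have e1 : P * (S * (P * y * Q - Q * y * P) * S) * Q
          = (P * S) * P * y * (Q * (S * Q)) - (P * S) * Q * y * (P * (S * Q)) := by noncomm_ring
      rw [e1, hSQ, ← mul_assoc Q, hQQ, ← mul_assoc P Q, hPQ, ← hSP, mul_assoc S P P, hPP, hSP]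
      simp [mul_assoc, hSQ]
    rw [this, smul_smul]; simp
  have h2 : X * (S * S) + S * S * X = Complex.I • (P * Z * Q + Q * Z * P) := by
    have s1 : S * S * P = P * (S * S) := by rw [mul_assoc, hSP, ← mul_assoc, hSP, mul_assoc]
    have s2 : S * S * Q = Q * (S * S) := by rw [mul_assoc, hSQ, ← mul_assoc, hSQ, mul_assoc]
    have e1 : S * S * (P - Q) * P = S * S * P := by
      rw [mul_assoc, sub_mul, hPP, hQP, sub_zero]
    have e2 : S * S * (P - Q) * Q = -(S * S * Q) := by
      rw [mul_assoc, sub_mul, hQQ, hPQ, zero_sub, mul_neg]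
    have e3 : P * (S * S * (P - Q)) = S * S * P := by
      rw [← mul_assoc, ← s1, mul_assoc, mul_sub, hPP, hPQ, sub_zero]
    have e4 : Q * (S * S * (P - Q)) = -(S * S * Q) := by
      rw [← mul_assoc, ← s2, mul_assoc, mul_sub, hQQ, hQP, zero_sub, mul_neg]
    have e5 : P * Z * Q = S * S * (P * y * Q) + P * y * Q * (S * S) := by
      have : P * Z * Q = P * (S * S * (P - Q)) * y * Q - P * y * (S * S * (P - Q) * Q) := by
        rw [hZ]; noncomm_ring
      rw [this, e2, e3, s2]; noncomm_ring
    have e6 : Q * Z * P = -(S * S * (Q * y * P) + Q * y * P * (S * S)) := by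
      have : Q * Z * P = Q * (S * S * (P - Q)) * y * P - Q * y * (S * S * (P - Q) * P) := by
        rw [hZ]; noncomm_ring
      rw [this, e1, e4, s1]; noncomm_ring
    rw [e5, e6, hX, smul_mul_assoc, mul_smul_comm, ← smul_add]
    congr 1
    noncomm_ring
  have h3 := norm_conj_le hS hXs
  rw [h2, norm_smul, Complex.norm_I, one_mul] at h3
  have h4 := norm_add_le (P * Z * Q) (Q * Z * P)
  have h5 := norm_proj_mul_mul_le nP nQ Z
  have h6 := norm_proj_mul_mul_le nQ nP Z
  have h7 := norm_proj_mul_mul_le nP nQ (S * X * S)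
  rw [h1, norm_smul, norm_neg, Complex.norm_I, one_mul]
  linarith

end agm

section pinch

variable {A : Type*} [CStarAlgebra A] [PartialOrder A] [StarOrderedRing A] [Nontrivial A]
  {ι : Type*}

/-- A finite partition of unity into orthogonal projections. -/
structure IsPVM (S : Finset ι) (P : ι → A) : Prop where
  star_eq : ∀ c, star (P c) = P c
  mul_self : ∀ c, P c * P c = P c
  orth : ∀ c d, c ≠ d → P c * P d = 0
  sum_eq : ∑ c ∈ S, P c = 1

/-- The block diagonal part. -/
def pinch (S : Finset ι) (P : ι → A) (a : A) : A := ∑ c ∈ S, P c * a * P c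

variable {S : Finset ι} {P : ι → A}

lemma star_pinch (h : IsPVM S P) (a : A) : star (pinch S P a) = pinch S P (star a) := by
  simp [pinch, star_sum, h.star_eq, mul_assoc]

lemma mul_pinch (h : IsPVM S P) (a : A) {c : ι} (hc : c ∈ S) :
    P c * pinch S P a = P c * a * P c := by
  rw [pinch, Finset.mul_sum, Finset.sum_eq_single_of_mem c hc]
  · rw [← mul_assoc, ← mul_assoc, h.mul_self]
  · intro d _ hd
    rw [← mul_assoc, ← mul_assoc, h.orth c d hd.symm, zero_mul, zero_mul]

lemma pinch_mul (h : IsPVM S P) (a : A) {c : ι} (hc : c ∈ S) :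
    pinch S P a * P c = P c * a * P c := by
  rw [pinch, Finset.sum_mul, Finset.sum_eq_single_of_mem c hc]
  · rw [mul_assoc, h.mul_self]
  · intro d _ hd
    rw [mul_assoc, h.orth d c hd, mul_zero]

lemma sub_pinch (h : IsPVM S P) (a : A) :
    a - pinch S P a = ∑ c ∈ S, P c * a * (1 - P c) := by
  have : a = ∑ c ∈ S, P c * a := by rw [← Finset.sum_mul, h.sum_eq, one_mul]
  nth_rw 1 [this]
  rw [pinch, ← Finset.sum_sub_distrib]
  exact Finset.sum_congr rfl fun c _ => by rw [mul_sub, mul_one]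

lemma norm_pinch_le (h : IsPVM S P) (a : A) : ‖pinch S P a‖ ≤ ‖a‖ := by
  have e : star (pinch S P a) * pinch S P a
      = ∑ c ∈ S, star (a * P c) * P c * (a * P c) := by
    rw [star_pinch h]
    nth_rw 1 [pinch]
    rw [Finset.sum_mul]
    refine Finset.sum_congr rfl fun c hc => ?_
    rw [mul_assoc, mul_pinch h a hc, star_mul, h.star_eq]
    have := h.mul_self c
    simp only [mul_assoc]
  have h1 : star (pinch S P a) * pinch S P a ≤ algebraMap ℝ A (‖a‖ ^ 2) := by
    rw [e]
    have : algebraMap ℝ A (‖a‖ ^ 2) = ∑ c ∈ S, star (P c) * algebraMap ℝ A (‖a‖ ^ 2) * P c := by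
      rw [Algebra.algebraMap_eq_smul_one]
      nth_rw 1 [← h.sum_eq]
      rw [Finset.smul_sum]
      exact Finset.sum_congr rfl fun c _ => by
        rw [mul_smul_comm, mul_one, smul_mul_assoc, h.star_eq, h.mul_self]
    rw [this]
    refine Finset.sum_le_sum fun c _ => ?_
    have hle : P c ≤ 1 := by
      rw [← sub_nonneg]
      have : 1 - P c = star (1 - P c) * (1 - P c) := by
        rw [star_sub, star_one, h.star_eq, sub_mul, mul_sub, mul_sub, h.mul_self]; simp
      rw [this]; exact star_mul_self_nonneg _
    calc star (a * P c) * P c * (a * P c) ≤ star (a * P c) * 1 * (a * P c) :=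
          star_left_conjugate_le_conjugate hle _
      _ = star (P c) * (star a * a) * P c := by rw [star_mul]; simp only [mul_one, mul_assoc]
      _ ≤ _ := star_left_conjugate_le_conjugate CStarAlgebra.star_mul_le_algebraMap_norm_sq _
  have h2 := (CStarAlgebra.norm_le_iff_le_algebraMap _ (sq_nonneg ‖a‖)
    (star_mul_self_nonneg (pinch S P a))).2 h1
  rw [CStarRing.norm_star_mul_self] at h2
  nlinarith [norm_nonneg a, norm_nonneg (pinch S P a)]

end pinch

section lvl
open ComplexConjugate

variable {A : Type*} [CStarAlgebra A] [PartialOrder A] [StarOrderedRing A] [FinSpec A]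
  [Nontrivial A]

open Classical in
/-- The spectral projection of `U` onto the level set `κ = c`. -/
def lvl (κ : ℂ → ℂ) (U : A) (c : ℂ) : A := cfc (fun z => if κ z = c then (1 : ℂ) else 0) U

open Classical in
/-- The finite set of `L`-th roots of `τ`. -/
def rootSet (L : ℕ) (τ : ℂ) : Finset ℂ := (Polynomial.nthRoots L τ).toFinset

lemma card_rootSet (L : ℕ) (τ : ℂ) : (rootSet L τ).card ≤ L :=
  (Multiset.toFinset_card_le _).trans (Polynomial.card_nthRoots L τ)

lemma mem_rootSet {L : ℕ} (hL : L ≠ 0) {τ c : ℂ} : c ∈ rootSet L τ ↔ c ^ L = τ := by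
  rw [rootSet, Multiset.mem_toFinset, Polynomial.mem_nthRoots (Nat.pos_of_ne_zero hL)]

lemma norm_of_mem_spectrum {U : A} (hU : U ∈ unitary A) {z : ℂ} (hz : z ∈ spectrum ℂ U) :
    ‖z‖ = 1 := by
  simpa using spectrum.subset_circle_of_unitary hU hz

variable {κ : ℂ → ℂ} {U : A}

lemma isPVM_lvl {S : Finset ℂ} (hU : U ∈ unitary A) (hS : ∀ z, ‖z‖ = 1 → κ z ∈ S) :
    IsPVM S (lvl κ U) where
  star_eq c := by
    rw [lvl, ← cfc_star]
    exact cfc_congr fun z _ => by split_ifs <;> simp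
  mul_self c := by
    rw [lvl, ← cfcC_mul]
    exact cfc_congr fun z _ => by split_ifs <;> simp
  orth c d hcd := by
    rw [lvl, lvl, ← cfcC_mul, ← cfc_const_zero ℂ U]
    refine cfc_congr fun z _ => ?_
    by_cases h : κ z = c
    · simp [h, hcd]
    · simp [h]
  sum_eq := by
    classical
    have := isStarNormal_of_mem_unitary hU
    rw [← cfc_const_one ℂ U]
    simp only [lvl]
    rw [← cfc_sum _ _ _ fun _ _ => contC _ _]
    refine cfc_congr fun z hz => ?_
    simp [Finset.sum_apply, hS z (norm_of_mem_spectrum hU hz)]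

/-- An operator commuting with the level projections commutes with functions of the label. -/
lemma commute_cfc_label {S : Finset ℂ} (hU : U ∈ unitary A) (hS : ∀ z, ‖z‖ = 1 → κ z ∈ S)
    {a : A} (ha : ∀ c ∈ S, Commute a (lvl κ U c)) (g : ℂ → ℂ) :
    Commute a (cfc (fun z => g (κ z)) U) := by
  classical
  have e : cfc (fun z => g (κ z)) U = ∑ c ∈ S, g c • lvl κ U c := by
    simp only [lvl]
    have : ∀ c ∈ S, g c • cfc (fun z => if κ z = c then (1 : ℂ) else 0) U
        = cfc (fun z => g c • if κ z = c then (1 : ℂ) else 0) U := fun c _ =>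
      (cfc_smul (g c) _ U (contC _ _)).symm
    rw [Finset.sum_congr rfl this, ← cfc_sum _ _ _ fun _ _ => contC _ _]
    refine cfc_congr fun z hz => ?_
    simp [Finset.sum_apply, hS z (norm_of_mem_spectrum hU hz)]
  rw [e]
  exact Commute.sum_right _ _ _ fun c hc => (ha c hc).smul_right _

variable {L : ℕ} {τ : ℂ}

/-- An operator commuting with the level projections almost commutes with `U`. -/
lemma norm_comm_le_of_label (h : IsLabel κ L τ) (hU : U ∈ unitary A) {a : A}
    (ha : Commute a (cfc κ U)) : ‖a * U - U * a‖ ≤ 2 * ‖a‖ * (Real.pi / L) := by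
  have := isStarNormal_of_mem_unitary hU
  have h1 : ‖U - cfc κ U‖ ≤ Real.pi / L := by
    nth_rw 1 [← cfc_id' ℂ U]
    rw [← cfcC_sub]
    exact norm_cfc_le (by positivity) fun z hz => norm_sub_label h (norm_of_mem_spectrum hU hz)
  have e : a * U - U * a = a * (U - cfc κ U) - (U - cfc κ U) * a := by
    rw [mul_sub, sub_mul, ha.eq]; abel
  rw [e]
  refine (norm_sub_le _ _).trans ?_
  have h2 := norm_mul_le a (U - cfc κ U)
  have h3 := norm_mul_le (U - cfc κ U) a
  nlinarith [norm_nonneg a, norm_nonneg (U - cfc κ U)]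

lemma star_cfc_ofReal (w : ℂ → ℝ) (U : A) :
    star (cfc (fun z => (w z : ℂ)) U) = cfc (fun z => (w z : ℂ)) U := by
  rw [← cfc_star]; exact cfc_congr fun z _ => by simp

lemma norm_comm_star (hU : U ∈ unitary A) (y : A) :
    ‖star U * y - y * star U‖ ≤ ‖U * y - y * U‖ := by
  have e : star U * y - y * star U = -(star U * (U * y - y * U) * star U) := by
    have h1 := (Unitary.mem_iff.1 hU).1
    have h2 := (Unitary.mem_iff.1 hU).2
    have : star U * (U * y - y * U) * star U = star U * U * y * star U - star U * y * (U * star U) := by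
      noncomm_ring
    rw [this, h1, h2]; simp
  rw [e, norm_neg]
  have h1 : ‖star U‖ ≤ 1 := by rw [norm_star]; exact (CStarRing.norm_of_mem_unitary hU).le
  exact norm_proj_mul_mul_le h1 h1 _

/-- Pinching a windowed operator costs little. -/
lemma norm_sub_pinch_le (hL : L ≠ 0) (h : IsLabel κ L τ) (hU : U ∈ unitary A) {y : A}
    (hy : star y = y) {w : ℂ → ℝ} {M : ℝ} (hM : 0 ≤ M)
    (hw : ∀ z, ‖z‖ = 1 → ∀ c, c ^ L = τ → ‖c‖ = 1 →
      |w z| ≤ M * √|(conj c * z).re - Real.cos (Real.pi / L)|) (hτ : ‖τ‖ = 1) :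
    ‖cfc (fun z => (w z : ℂ)) U * y * cfc (fun z => (w z : ℂ)) U
      - pinch (rootSet L τ) (lvl κ U) (cfc (fun z => (w z : ℂ)) U * y * cfc (fun z => (w z : ℂ)) U)‖
      ≤ L * (M ^ 2 * ‖U * y - y * U‖) := by
  have hn := isStarNormal_of_mem_unitary hU
  have hS : ∀ z, ‖z‖ = 1 → κ z ∈ rootSet L τ := fun z hz => (mem_rootSet hL).2 (h.pow_eq z hz)
  have hpvm := isPVM_lvl hU hS
  set W := cfc (fun z => (w z : ℂ)) U with hWdef
  rw [sub_pinch hpvm]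
  have key : ∀ c ∈ rootSet L τ, ‖lvl κ U c * (W * y * W) * (1 - lvl κ U c)‖
      ≤ M ^ 2 * ‖U * y - y * U‖ := by
    intro c hc
    have hcL := (mem_rootSet hL).1 hc
    have hc1 := norm_of_pow_eq hL hτ hcL
    set t := Real.cos (Real.pi / L)
    set s : ℂ → ℝ := fun z => √|(conj c * z).re - t| with hs
    set S := cfc (fun z => (s z : ℂ)) U with hSdef
    set V := cfc (fun z => ((w z / s z : ℝ) : ℂ)) U with hVdef
    set P := lvl κ U c with hPdef
    have hWV : W = S * V := by
      rw [hWdef, hSdef, hVdef, ← cfcC_mul]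
      refine cfc_congr fun z hz => ?_
      have := hw z (norm_of_mem_spectrum hU hz) c hcL hc1
      rcases eq_or_ne (s z) 0 with h0 | h0
      · have h1 : |w z| ≤ M * s z := this
        rw [h0, mul_zero] at h1
        simp [h0, abs_nonpos_iff.1 h1]
      · rw [← Complex.ofReal_mul, mul_div_cancel₀ _ h0]
    have hSV : S * V = V * S := (cfc_commute_cfc _ _ _).eq
    have hPS : S * P = P * S := (cfc_commute_cfc _ _ _).eq
    have hPV : V * P = P * V := (cfc_commute_cfc _ _ _).eq
    have nV : ‖V‖ ≤ M := norm_cfc_le hM fun z hz => by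
      rw [Complex.norm_real, Real.norm_eq_abs, abs_div, abs_of_nonneg (Real.sqrt_nonneg _)]
      exact div_le_of_le_mul₀ (Real.sqrt_nonneg _) hM
        (hw z (norm_of_mem_spectrum hU hz) c hcL hc1)
    have e1 : P * (W * y * W) * (1 - P) = V * (P * (S * y * S) * (1 - P)) * V := by
      have hQ : V * (1 - P) = (1 - P) * V := by rw [mul_sub, sub_mul, hPV]; simp
      calc P * (W * y * W) * (1 - P) = P * (V * S * y * (S * V)) * (1 - P) := by
            rw [hWV]; nth_rw 1 [hSV]
        _ = P * V * (S * y * S) * (V * (1 - P)) := by simp only [mul_assoc]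
        _ = _ := by rw [hQ, ← hPV]; simp only [mul_assoc]
    have e2 : S * S * (P - (1 - P)) = cfc (fun z => (((conj c * z).re - t : ℝ) : ℂ)) U := by
      rw [hSdef, hPdef, lvl, ← cfcC_mul]
      rw [← cfc_const_one ℂ U, ← cfcC_sub, ← cfcC_sub, ← cfcC_mul]
      refine cfc_congr fun z hz => ?_
      have hz1 := norm_of_mem_spectrum hU hz
      have hss : ((s z : ℝ) : ℂ) * (s z : ℂ) = ((|(conj c * z).re - t| : ℝ) : ℂ) := by
        rw [← Complex.ofReal_mul, Real.mul_self_sqrt (abs_nonneg _)]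
      rw [hss]
      by_cases hk : κ z = c
      · have := h.cos_le z hz1
        rw [hk] at this
        rw [if_pos hk, abs_of_nonneg (sub_nonneg.2 this)]; ring
      · have : (conj c * z).re ≤ t := by
          by_contra! hlt
          exact hk (h.eq_of_lt z hz1 c hcL hlt)
        rw [if_neg hk, abs_of_nonpos (sub_nonpos.2 this)]; push_cast; ring
    have e3 : cfc (fun z => (((conj c * z).re - t : ℝ) : ℂ)) U
        = (1 / 2 : ℂ) • (conj c • U + c • star U) - algebraMap ℂ A t := by
      have h1 : cfc (fun z : ℂ => conj c * z) U = conj c • U := cfc_const_mul_id _ _ hn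
      have h2 : cfc (fun z : ℂ => c * star z) U = c • star U := by
        rw [cfc_const_mul _ _ _ (contC _ _), cfc_star_id (a := U) (ha := hn)]
      rw [← h1, ← h2, ← cfcC_add, ← cfc_smul _ _ _ (contC _ _), ← cfc_const (t : ℂ) U, ← cfcC_sub]
      refine cfc_congr fun z _ => ?_
      have := Complex.add_conj (conj c * z)
      rw [map_mul, Complex.conj_conj] at this
      simp only [Complex.star_def, smul_eq_mul]
      rw [this]; push_cast; ring
    have h4 := norm_corner_le (star_cfc_ofReal s U) (hpvm.star_eq c) (hpvm.mul_self c) hPS hy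
    rw [← hSdef, ← hPdef, e2, e3] at h4
    have h5 : ‖((1 / 2 : ℂ) • (conj c • U + c • star U) - algebraMap ℂ A t) * y
        - y * ((1 / 2 : ℂ) • (conj c • U + c • star U) - algebraMap ℂ A t)‖
        ≤ ‖U * y - y * U‖ := by
      have e : ((1 / 2 : ℂ) • (conj c • U + c • star U) - algebraMap ℂ A t) * y
        - y * ((1 / 2 : ℂ) • (conj c • U + c • star U) - algebraMap ℂ A t)
        = (1 / 2 : ℂ) • (conj c • (U * y - y * U) + c • (star U * y - y * star U)) := by
        rw [Algebra.algebraMap_eq_smul_one]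
        simp only [sub_mul, mul_sub, add_mul, mul_add, smul_mul_assoc, mul_smul_comm, one_mul,
          mul_one, smul_sub, smul_add]
        abel
      rw [e, norm_smul]
      have h6 := norm_add_le (conj c • (U * y - y * U)) (c • (star U * y - y * star U))
      rw [norm_smul, norm_smul, RCLike.norm_conj, hc1, one_mul, one_mul] at h6
      have h7 := norm_comm_star hU y
      norm_num
      linarith
    rw [e1]
    calc _ ≤ ‖V‖ * ‖P * (S * y * S) * (1 - P)‖ * ‖V‖ := norm_mul_three_le _ _ _
      _ ≤ M * ‖U * y - y * U‖ * M := by gcongr; exact h4.trans h5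
      _ = _ := by ring
  refine (norm_sum_le_of_le _ key).trans ?_
  rw [Finset.sum_const, nsmul_eq_mul]
  have : ((rootSet L τ).card : ℝ) ≤ L := by exact_mod_cast card_rootSet L τ
  gcongr

end lvl

section polar
open ComplexConjugate

variable {A : Type*} [CStarAlgebra A] [PartialOrder A] [StarOrderedRing A] [FinSpec A]
  [Nontrivial A]

/-- Polar decomposition of an invertible element. -/
lemma exists_polar {N : A} (hN : IsUnit N) : ∃ V H : A, star V * V = 1 ∧ V * star V = 1 ∧ 0 ≤ H ∧
    V * H = N ∧ (∀ P, star P = P → Commute P N → Commute P V) ∧ ‖H - 1‖ ≤ ‖star N * N - 1‖ := by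
  set h := star N * N with hh
  have h0 : 0 ≤ h := star_mul_self_nonneg N
  have hsa : IsSelfAdjoint h := .of_nonneg h0
  have hu : IsUnit h := hN.star.mul hN
  have hpos : ∀ t ∈ spectrum ℝ h, 0 < t := fun t ht =>
    lt_of_le_of_ne (spectrum_nonneg_of_nonneg h0 ht) fun e => by
      rw [← e] at ht; exact (spectrum.zero_notMem_iff ℝ).2 hu ht
  set H := cfc (fun t : ℝ => √t) h with hH
  set g := cfc (fun t : ℝ => (√t)⁻¹) h with hg
  have hHg : H * g = 1 := by
    rw [hH, hg, ← cfcR_mul, ← cfc_const_one ℝ h]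
    exact cfc_congr fun t ht => mul_inv_cancel₀ (Real.sqrt_pos.2 (hpos t ht)).ne'
  have hgH : g * H = 1 := by rw [hg, hH, (cfc_commute_cfc _ _ h).eq]; exact hHg
  have hHH : H * H = h := by
    rw [hH, ← cfcR_mul]
    conv_rhs => rw [← cfc_id' ℝ h]
    exact cfc_congr fun t ht => Real.mul_self_sqrt (hpos t ht).le
  have hgs : star g = g := (IsSelfAdjoint.cfc (f := fun t : ℝ => (√t)⁻¹)).star_eq
  have hV1 : star (N * g) * (N * g) = 1 := by
    rw [star_mul, hgs]
    calc g * star N * (N * g) = g * (star N * N) * g := by simp only [mul_assoc]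
      _ = g * H * (H * g) := by rw [← hh, ← hHH]; simp only [mul_assoc]
      _ = 1 := by rw [hHg, hgH, mul_one]
  have hVu : IsUnit (N * g) := hN.mul ⟨⟨g, H, hgH, hHg⟩, rfl⟩
  refine ⟨N * g, H, hV1, ?_, cfc_nonneg fun t _ => Real.sqrt_nonneg t, ?_, ?_, ?_⟩
  · obtain ⟨v, hv⟩ := hVu
    rw [← hv] at hV1 ⊢
    rw [Units.mul_eq_one_iff_eq_inv.1 hV1, Units.mul_inv]
  · rw [mul_assoc, hgH, mul_one]
  · intro P hP hc
    have hc' : Commute P (star N) := by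
      have := hc.star_star
      rwa [hP] at this
    exact hc.mul_right (((hc'.mul_right hc).symm.cfc_real _).symm)
  · have e1 : H - 1 = cfc (fun t : ℝ => √t - 1) h := by
      rw [cfcR_sub, cfc_const_one ℝ h]
    have e2 : h - 1 = cfc (fun t : ℝ => t - 1) h := by
      rw [cfcR_sub, cfc_const_one ℝ h, cfc_id' ℝ h]
    rw [e1, e2]
    refine norm_cfcR_le (norm_nonneg _) fun t ht => ?_
    refine le_trans ?_ (norm_apply_le_norm_cfc (fun t : ℝ => t - 1) h ht (contR _ _))
    have hs := Real.sqrt_nonneg t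
    have : t - 1 = (√t - 1) * (√t + 1) := by
      have := Real.mul_self_sqrt (hpos t ht).le; linarith
    rw [Real.norm_eq_abs, this, abs_mul]
    have h3 : (1 : ℝ) ≤ |√t + 1| := by rw [abs_of_nonneg (by linarith)]; linarith
    nlinarith [abs_nonneg (√t - 1)]

lemma cfc_ofReal_nonneg {w : ℂ → ℝ} {U : A} (hw : ∀ z ∈ spectrum ℂ U, 0 ≤ w z) :
    0 ≤ cfc (fun z => (w z : ℂ)) U := by
  have e : cfc (fun z => (w z : ℂ)) U
      = star (cfc (fun z => (√(w z) : ℂ)) U) * cfc (fun z => (√(w z) : ℂ)) U := by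
    rw [star_cfc_ofReal (fun z => √(w z)), ← cfcC_mul]
    refine cfc_congr fun z hz => ?_
    rw [← Complex.ofReal_mul, Real.mul_self_sqrt (hw z hz)]
  rw [e]; exact star_mul_self_nonneg _

lemma imPart_eq_cfc {q : A} (hq : q ∈ unitary A) : imPart q = cfc (fun z => (z.im : ℂ)) q := by
  have hn := isStarNormal_of_mem_unitary hq
  have e : cfc (fun z => (z.im : ℂ)) q = cfc (fun z : ℂ => (-Complex.I / 2) • (z - star z)) q := by
    refine cfc_congr fun z _ => ?_
    simp only [smul_eq_mul, Complex.star_def]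
    rw [Complex.sub_conj]
    push_cast
    linear_combination (z.im : ℂ) * Complex.I_mul_I
  rw [e, cfc_smul _ _ _ (contC _ _), cfcC_sub, cfc_id' ℂ q, cfc_star_id (a := q) (ha := hn)]
  rfl

lemma rePart_eq_cfc {q : A} (hq : q ∈ unitary A) : rePart q = cfc (fun z => (z.re : ℂ)) q := by
  have hn := isStarNormal_of_mem_unitary hq
  have e : cfc (fun z => (z.re : ℂ)) q = cfc (fun z : ℂ => (1 / 2 : ℂ) • (z + star z)) q := by
    refine cfc_congr fun z _ => ?_
    simp only [smul_eq_mul, Complex.star_def]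
    rw [Complex.add_conj]; push_cast; ring
  rw [e, cfc_smul _ _ _ (contC _ _), cfcC_add, cfc_id' ℂ q, cfc_star_id (a := q) (ha := hn)]
  rfl

lemma norm_le_one_of_unitary {q : A} (h1 : star q * q = 1) (h2 : q * star q = 1) : ‖q‖ ≤ 1 :=
  (CStarRing.norm_of_mem_unitary (Unitary.mem_iff.2 ⟨h1, h2⟩)).le

theorem exists_isSideData {V Y : A} (hV : star V * V = 1) (hV' : V * star V = 1) (hY : star Y = Y)
    (hY1 : ‖Y‖ ≤ 1 / 2) : ∃ E J G, IsSideData V Y E J G ∧ ‖E‖ ≤ 1 ∧ ‖J‖ ≤ 1 ∧ ‖G‖ ≤ 1 ∧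
      star (J * G) = J * G ∧
      ∀ P, star P = P → Commute P V → Commute P Y → Commute P J ∧ Commute P G := by
  have hYs : IsSelfAdjoint Y := hY
  have hYn : IsStarNormal Y := hYs.isStarNormal
  have hreal : ∀ z ∈ spectrum ℂ Y, ∃ t : ℝ, z = t := fun z hz => ⟨z.re, hYs.mem_spectrum_eq_re hz⟩
  have hne : ∀ t : ℝ, (1 - Complex.I * t : ℂ) ≠ 0 := fun t h => by
    have := congrArg Complex.re h; simp at this
  have hne' : ∀ t : ℝ, (1 + Complex.I * t : ℂ) ≠ 0 := fun t h => by
    have := congrArg Complex.re h; simp at this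
  set E := cfc (fun z : ℂ => (1 + Complex.I * z) / (1 - Complex.I * z)) Y with hE
  have hE1 : star E * E = 1 := by
    rw [hE, ← cfc_star, ← cfcC_mul, ← cfc_const_one ℂ Y]
    refine cfc_congr fun z hz => ?_
    obtain ⟨t, rfl⟩ := hreal z hz
    have h1 := hne t
    have h2 := hne' t
    simp only [Complex.star_def, map_div₀, map_add, map_sub, map_mul, map_one, Complex.conj_I,
      Complex.conj_ofReal, neg_mul, sub_neg_eq_add, ← sub_eq_add_neg]
    field_simp
  have hE2 : E * star E = 1 := by
    rw [hE, ← cfc_star, (cfc_commute_cfc _ _ Y).eq, cfc_star, ← hE]; exact hE1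
  set q := E * V with hq
  have hqu : q ∈ unitary A :=
    mul_mem (Unitary.mem_iff.2 ⟨hE1, hE2⟩) (Unitary.mem_iff.2 ⟨hV, hV'⟩)
  set σ : ℂ → ℝ := fun z => if 0 ≤ z.im then 1 else -1 with hσ
  have hσσ : ∀ z, σ z * σ z = 1 := fun z => by simp only [hσ]; split_ifs <;> norm_num
  have hσi : ∀ z, σ z * z.im = |z.im| := fun z => by
    simp only [hσ]; split_ifs with h
    · rw [abs_of_nonneg h, one_mul]
    · rw [abs_of_neg (not_le.1 h)]; ring
  have hqn := isStarNormal_of_mem_unitary hqu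
  refine ⟨E, cfc (fun z => (σ z : ℂ)) q, cfc (fun z : ℂ => ((max z.re 0 : ℝ) : ℂ)) q,
    { posY := ?_, hE := ?_, E_star_mul := hE1, E_mul_star := hE2, J_star := star_cfc_ofReal _ _,
      J_sq := ?_, Jq := ?_, posJ := ?_, posG := ?_, posGq := ?_, hG := ?_ },
    norm_le_one_of_unitary hE1 hE2, ?_, ?_, ?_, ?_⟩
  · have e : 1 - (Y * Y + Y * Y) = cfc (fun t : ℝ => 1 - (t * t + t * t)) Y := by
      rw [cfcR_sub, cfcR_add, cfcR_mul, cfc_id' ℝ Y, cfc_const_one ℝ Y]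
    rw [e]
    refine cfc_nonneg fun t ht => ?_
    have h1 := norm_apply_le_norm_cfc (fun t : ℝ => t) Y ht (contR _ _)
    rw [cfc_id' ℝ Y, Real.norm_eq_abs] at h1
    have := abs_le.1 (h1.trans hY1)
    nlinarith [this.1, this.2]
  · have e1 : 1 - Complex.I • Y = cfc (fun z : ℂ => 1 - Complex.I * z) Y := by
      rw [cfcC_sub, cfc_const_one ℂ Y, cfc_const_mul_id _ _ hYn]
    have e2 : 1 + Complex.I • Y = cfc (fun z : ℂ => 1 + Complex.I * z) Y := by
      rw [cfcC_add, cfc_const_one ℂ Y, cfc_const_mul_id _ _ hYn]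
    rw [e1, e2, hE, ← cfcC_mul]
    refine cfc_congr fun z hz => ?_
    obtain ⟨t, rfl⟩ := hreal z hz
    exact mul_div_cancel₀ _ (hne t)
  · rw [← cfcC_mul, ← cfc_const_one ℂ q]
    refine cfc_congr fun z _ => ?_
    rw [← Complex.ofReal_mul, hσσ, Complex.ofReal_one]
  · have := cfc_commute_cfc (fun z => (σ z : ℂ)) (fun z : ℂ => z) q
    rw [cfc_id' ℂ q] at this
    exact this.eq
  · rw [imPart_eq_cfc hqu, ← cfcC_mul]
    have : cfc (fun z : ℂ => (σ z : ℂ) * (z.im : ℂ)) q = cfc (fun z : ℂ => ((|z.im| : ℝ) : ℂ)) q :=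
      cfc_congr fun z _ => by
        rw [← Complex.ofReal_mul, hσi]
    rw [this]
    exact cfc_ofReal_nonneg fun z _ => abs_nonneg _
  · exact cfc_ofReal_nonneg fun z _ => le_max_right _ _
  · rw [rePart_eq_cfc hqu, ← cfcC_add, ← cfcC_sub]
    have : cfc (fun z : ℂ => ((max z.re 0 : ℝ) : ℂ) + ((max z.re 0 : ℝ) : ℂ) - (z.re : ℂ)) q
        = cfc (fun z : ℂ => ((max z.re 0 + max z.re 0 - z.re : ℝ) : ℂ)) q :=
      cfc_congr fun z _ => by push_cast; rfl
    rw [this]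
    exact cfc_ofReal_nonneg fun z _ => by
      have h1 := le_max_left z.re 0
      have h2 := le_max_right z.re 0
      linarith
  · rw [rePart_eq_cfc hqu, ← cfcC_mul, ← cfcC_mul]
    refine cfc_congr fun z _ => ?_
    rw [← Complex.ofReal_mul, ← Complex.ofReal_mul]
    congr 1
    rcases max_cases z.re 0 with h | h
    · rw [h.1]
    · rw [h.1]; simp
  · refine norm_cfc_le zero_le_one fun z _ => ?_
    simp only [hσ]; split_ifs <;> simp
  · refine norm_cfc_le zero_le_one fun z hz => ?_
    rw [Complex.norm_real, Real.norm_eq_abs, abs_of_nonneg (le_max_right _ _)]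
    have := Complex.re_le_norm z
    rw [norm_of_mem_spectrum hqu hz] at this
    exact max_le this zero_le_one
  · rw [star_mul, star_cfc_ofReal, star_cfc_ofReal]
    exact (cfc_commute_cfc _ _ q).eq
  · intro P hP hPV hPY
    have h1 : Commute P E := (hYs.commute_cfc hPY.symm _).symm
    have h2 : Commute P q := h1.mul_right hPV
    have h3 : Commute P (star q) := by
      have := h2.star_star
      rwa [hP] at this
    exact ⟨(h2.symm.cfc h3.symm _).symm, (h2.symm.cfc h3.symm _).symm⟩

end polar

section windows
open ComplexConjugate

variable {A : Type*} [CStarAlgebra A] [PartialOrder A] [StarOrderedRing A] [FinSpec A]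
  [Nontrivial A]

lemma rePart_pow_eq_cfc {U : A} (hU : U ∈ unitary A) (M : ℕ) :
    rePart (U ^ M) = cfc (fun z => (((z ^ M).re : ℝ) : ℂ)) U := by
  have hn := isStarNormal_of_mem_unitary hU
  have e : cfc (fun z => (((z ^ M).re : ℝ) : ℂ)) U
      = cfc (fun z : ℂ => (1 / 2 : ℂ) • (z ^ M + star (z ^ M))) U := by
    refine cfc_congr fun z _ => ?_
    simp only [smul_eq_mul, Complex.star_def]
    rw [Complex.add_conj]; push_cast; ring
  rw [e, cfc_smul _ _ _ (contC _ _), cfcC_add, cfc_star (fun z => z ^ M), cfc_pow_id U M]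
  rfl

lemma imPart_pow_eq_cfc {U : A} (hU : U ∈ unitary A) (M : ℕ) :
    imPart (U ^ M) = cfc (fun z => (((z ^ M).im : ℝ) : ℂ)) U := by
  have hn := isStarNormal_of_mem_unitary hU
  have e : cfc (fun z => (((z ^ M).im : ℝ) : ℂ)) U
      = cfc (fun z : ℂ => (-Complex.I / 2) • (z ^ M - star (z ^ M))) U := by
    refine cfc_congr fun z _ => ?_
    simp only [smul_eq_mul, Complex.star_def]
    rw [Complex.sub_conj]
    push_cast
    linear_combination ((z ^ M).im : ℂ) * Complex.I_mul_I
  rw [e, cfc_smul _ _ _ (contC _ _), cfcC_sub, cfc_star (fun z => z ^ M), cfc_pow_id U M]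
  rfl

lemma norm_comm_pow {U : A} (hU : U ∈ unitary A) (y : A) (M : ℕ) :
    ‖U ^ M * y - y * U ^ M‖ ≤ M * ‖U * y - y * U‖ := by
  have h1 : ‖U‖ ≤ 1 := (CStarRing.norm_of_mem_unitary hU).le
  induction M with
  | zero => simp
  | succ M ih =>
    have hM : ‖U ^ M‖ ≤ 1 := (CStarRing.norm_of_mem_unitary (pow_mem hU M)).le
    have e : U ^ (M + 1) * y - y * U ^ (M + 1)
        = U ^ M * (U * y - y * U) + (U ^ M * y - y * U ^ M) * U := by
      rw [pow_succ]; noncomm_ring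
    rw [e]
    refine (norm_add_le _ _).trans ?_
    have h2 := norm_mul_le (U ^ M) (U * y - y * U)
    have h3 := norm_mul_le (U ^ M * y - y * U ^ M) U
    push_cast
    nlinarith [norm_nonneg (U * y - y * U), norm_nonneg (U ^ M * y - y * U ^ M)]

lemma norm_comm_rePart {u : A} (hu : u ∈ unitary A) (y : A) :
    ‖rePart u * y - y * rePart u‖ ≤ ‖u * y - y * u‖ := by
  have e : rePart u * y - y * rePart u
      = (1 / 2 : ℂ) • ((u * y - y * u) + (star u * y - y * star u)) := by
    rw [rePart]
    simp only [smul_mul_assoc, mul_smul_comm, add_mul, mul_add, ← smul_sub]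
    congr 1; abel
  rw [e, norm_smul]
  have := norm_comm_star hu y
  have h2 := norm_add_le (u * y - y * u) (star u * y - y * star u)
  norm_num
  linarith

lemma norm_comm_imPart {u : A} (hu : u ∈ unitary A) (y : A) :
    ‖imPart u * y - y * imPart u‖ ≤ ‖u * y - y * u‖ := by
  have e : imPart u * y - y * imPart u
      = (-Complex.I / 2 : ℂ) • ((u * y - y * u) - (star u * y - y * star u)) := by
    rw [imPart]
    simp only [smul_mul_assoc, mul_smul_comm, sub_mul, mul_sub, ← smul_sub]
    congr 1; abel
  rw [e, norm_smul]
  have := norm_comm_star hu y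
  have h2 := norm_sub_le (u * y - y * u) (star u * y - y * star u)
  norm_num
  linarith

lemma norm_rePart_le {u : A} (hu : ‖u‖ ≤ 1) : ‖rePart u‖ ≤ 1 := by
  rw [rePart, norm_smul]
  have := norm_add_le u (star u)
  rw [norm_star] at this
  norm_num
  linarith

lemma norm_imPart_le {u : A} (hu : ‖u‖ ≤ 1) : ‖imPart u‖ ≤ 1 := by
  rw [imPart, norm_smul]
  have := norm_sub_le u (star u)
  rw [norm_star] at this
  norm_num
  linarith

variable {U y : A} {M : ℕ}

lemma abs_re_pow_le {z : ℂ} (hz : ‖z‖ = 1) : |(z ^ M).re| ≤ 1 := by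
  have := Complex.abs_re_le_norm (z ^ M)
  rwa [norm_pow, hz, one_pow] at this

lemma abs_im_pow_le {z : ℂ} (hz : ‖z‖ = 1) : |(z ^ M).im| ≤ 1 := by
  have := Complex.abs_im_le_norm (z ^ M)
  rwa [norm_pow, hz, one_pow] at this

/-- Pinching of the operator windowed by `Im (U ^ M)`. -/
lemma norm_sub_pinch_im_le (hM : M ≠ 0) (hU : U ∈ unitary A) (hy : star y = y) :
    ‖imPart (U ^ M) * y * imPart (U ^ M) - pinch (rootSet (2 * M) (-1)) (lvl (lab (2 * M) (-1)) U)
      (imPart (U ^ M) * y * imPart (U ^ M))‖ ≤ 2 * M ^ 3 * ‖U * y - y * U‖ := by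
  have hM' : (M : ℝ) ≠ 0 := by exact_mod_cast hM
  have h2M : 2 * M ≠ 0 := by positivity
  rw [imPart_pow_eq_cfc hU]
  refine (norm_sub_pinch_le h2M (isLabel_lab h2M (by simp)) hU hy (M := M) (by positivity) ?_
    (by simp)).trans (le_of_eq (by push_cast; ring))
  intro z hz c hc hc1
  have hcos : Real.cos (M * (Real.pi / (2 * M : ℕ))) = 0 := by
    rw [show (M : ℝ) * (Real.pi / (2 * M : ℕ)) = Real.pi / 2 by push_cast; field_simp]
    exact Real.cos_pi_div_two
  have hci : c ^ M = Complex.I ∨ c ^ M = -Complex.I := by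
    rw [← sq_eq_sq_iff_eq_or_eq_neg, Complex.I_sq, ← pow_mul, mul_comm]; exact hc
  rcases hci with h | h
  · refine abs_le_of_cos (γ := 1) (by simp) hc1 hz (abs_im_pow_le hz) ?_
    rw [hcos, mul_pow, ← map_pow, h]; simp
  · refine abs_le_of_cos (γ := -1) (by simp) hc1 hz (abs_im_pow_le hz) ?_
    rw [hcos, mul_pow, ← map_pow, h]; simp

/-- The even or odd half-winding weight: `(1 + σ Re z ^ M) / 2` with `σ = ±1`. -/
lemma weight_eq_cfc (hU : U ∈ unitary A) (σ : ℝ) :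
    (1 / 2 : ℂ) • (1 + (σ : ℂ) • rePart (U ^ M))
      = cfc (fun z => (((1 + σ * (z ^ M).re) / 2 : ℝ) : ℂ)) U := by
  have hn := isStarNormal_of_mem_unitary hU
  rw [rePart_pow_eq_cfc hU, ← cfc_smul _ _ _ (contC _ _), ← cfc_const_one ℂ U, ← cfcC_add,
    ← cfc_smul _ _ _ (contC _ _)]
  refine cfc_congr fun z _ => ?_
  simp only [smul_eq_mul]; push_cast; ring

lemma weight_nonneg (hU : U ∈ unitary A) {σ : ℝ} (hσ : |σ| ≤ 1) :
    0 ≤ (1 / 2 : ℂ) • (1 + (σ : ℂ) • rePart (U ^ M)) := by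
  rw [weight_eq_cfc hU]
  refine cfc_ofReal_nonneg fun z hz => ?_
  have h1 : |σ * (z ^ M).re| ≤ 1 := by
    rw [abs_mul]
    exact mul_le_one₀ hσ (abs_nonneg _) (abs_re_pow_le (norm_of_mem_spectrum hU hz))
  linarith [(abs_le.1 h1).1]

/-- Pinching of the operator windowed by a half-winding weight. -/
lemma norm_sub_pinch_weight_le (hM : M ≠ 0) (hU : U ∈ unitary A) (hy : star y = y) {σ : ℝ} {τ : ℂ}
    (hσ : |σ| ≤ 1) (hτ : τ = 1 ∨ τ = -1) (hστ : τ = σ) {W : A}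
    (hW : W = (1 / 2 : ℂ) • (1 + (σ : ℂ) • rePart (U ^ M))) :
    ‖W * y * W - pinch (rootSet M τ) (lvl (fun z => lab M τ (lab (2 * M) (-1) z)) U) (W * y * W)‖
      ≤ M ^ 3 * ‖U * y - y * U‖ := by
  have hM' : (M : ℝ) ≠ 0 := by exact_mod_cast hM
  have hτn : ‖τ‖ = 1 := by rcases hτ with rfl | rfl <;> simp
  rw [hW, weight_eq_cfc hU]
  refine (norm_sub_pinch_le hM (isLabel_lab_lab hM hτ) hU hy (M := M) (by positivity) ?_
    hτn).trans (le_of_eq (by ring))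
  intro z hz c hc hc1
  have h1 : |σ * (z ^ M).re| ≤ 1 := by
    rw [abs_mul]; exact mul_le_one₀ hσ (abs_nonneg _) (abs_re_pow_le hz)
  refine abs_le_of_cos (γ := 1 / 2) (by rw [abs_le]; norm_num) hc1 hz ?_ ?_
  · rw [abs_le] at h1 ⊢
    constructor <;> linarith [h1.1, h1.2]
  · have hcos : Real.cos (M * (Real.pi / M)) = -1 := by
      rw [mul_div_cancel₀ _ hM']; exact Real.cos_pi
    rw [hcos, mul_pow, ← map_pow, hc, hστ, Complex.conj_ofReal, Complex.re_ofReal_mul]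
    ring

end windows

section approx
open ComplexConjugate

variable {A : Type*} [CStarAlgebra A] [PartialOrder A] [StarOrderedRing A] [FinSpec A]
  [Nontrivial A] {U y : A} {M : ℕ}

/-- Rounding to `M`-th roots of `τ` compatible with the windows. -/
def arcLab (M : ℕ) (τ : ℂ) (z : ℂ) : ℂ := lab M τ (lab (2 * M) (-1) z)

lemma commute_pinch {ι : Type*} {S : Finset ι} {P : ι → A} (h : IsPVM S P) (a : A) {c : ι}
    (hc : c ∈ S) : Commute (P c) (pinch S P a) :=
  (mul_pinch h a hc).trans (pinch_mul h a hc).symm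

lemma le_cube (hM : M ≠ 0) : (M : ℝ) ≤ M ^ 3 := by
  have : (1 : ℝ) ≤ M := by exact_mod_cast Nat.one_le_iff_ne_zero.2 hM
  nlinarith [sq_nonneg ((M : ℝ) - 1), sq_nonneg (M : ℝ)]

lemma arc_mem (hM : M ≠ 0) {τ : ℂ} (hτ : τ = 1 ∨ τ = -1) :
    ∀ z, ‖z‖ = 1 → arcLab M τ z ∈ rootSet M τ := fun z hz =>
  (mem_rootSet hM).2 ((isLabel_lab_lab hM hτ).pow_eq z hz)

/-- The pinched weight used as Cayley data. -/
lemma exists_side_weight (hM : M ≠ 0) (hU : U ∈ unitary A) (hy : star y = y) (hy1 : ‖y‖ ≤ 1 / 2)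
    {σ : ℝ} {τ : ℂ} (hσ : |σ| ≤ 1) (hτ : τ = 1 ∨ τ = -1) (hστ : τ = σ) {W : A}
    (hW : W = (1 / 2 : ℂ) • (1 + (σ : ℂ) • rePart (U ^ M))) :
    ∃ Y : A, ‖Y‖ ≤ 1 / 2 ∧ star Y = Y ∧ ‖Y - W * W * y‖ ≤ 2 * M ^ 3 * ‖U * y - y * U‖ ∧
      ∀ c ∈ rootSet M τ, Commute (lvl (arcLab M τ) U c) Y := by
  have hpvm := isPVM_lvl (κ := arcLab M τ) hU (arc_mem hM hτ)
  have hp := norm_sub_pinch_weight_le hM hU hy hσ hτ hστ hW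
  set x := rePart (U ^ M) with hx
  have hx1 : ‖x‖ ≤ 1 := norm_rePart_le (CStarRing.norm_of_mem_unitary (pow_mem hU M)).le
  have hσx : ‖(σ : ℂ) • x‖ ≤ 1 := by
    rw [norm_smul, Complex.norm_real, Real.norm_eq_abs]
    exact mul_le_one₀ hσ (norm_nonneg _) hx1
  have hW1 : ‖W‖ ≤ 1 := by
    rw [hW, norm_smul]
    have := norm_add_le (1 : A) ((σ : ℂ) • x)
    rw [CStarRing.norm_one] at this
    rw [show ‖(1 / 2 : ℂ)‖ = 1 / 2 by norm_num]
    linarith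
  have hWs : star W = W := by
    rw [hW]; simp [hx, star_rePart]
  have hWyW : ‖W * y * W‖ ≤ 1 / 2 := (norm_proj_mul_mul_le hW1 hW1 y).trans hy1
  refine ⟨pinch (rootSet M τ) (lvl (arcLab M τ) U) (W * y * W), (norm_pinch_le hpvm _).trans hWyW,
    ?_, ?_, fun c hc => commute_pinch hpvm _ hc⟩
  · rw [star_pinch hpvm, star_mul, star_mul, hWs, hy, mul_assoc]
  · have h1 : W * y * W - W * W * y = W * (y * W - W * y) := by noncomm_ring
    have h2 : y * W - W * y = -((σ / 2 : ℂ) • (x * y - y * x)) := by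
      rw [hW]
      simp only [mul_smul_comm, smul_mul_assoc, mul_add, add_mul, mul_one, one_mul]
      module
    have h3 : ‖x * y - y * x‖ ≤ M * ‖U * y - y * U‖ :=
      (norm_comm_rePart (pow_mem hU M) y).trans (norm_comm_pow hU y M)
    have h4 : ‖y * W - W * y‖ ≤ M * ‖U * y - y * U‖ := by
      rw [h2, norm_neg, norm_smul]
      have : ‖(σ / 2 : ℂ)‖ ≤ 1 := by
        rw [norm_div, Complex.norm_real, Real.norm_eq_abs]; norm_num; linarith
      exact (mul_le_of_le_one_left (norm_nonneg _) this).trans h3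
    have h5 : ‖W * y * W - W * W * y‖ ≤ M * ‖U * y - y * U‖ := by
      rw [h1]
      exact (norm_mul_le _ _).trans ((mul_le_of_le_one_left (norm_nonneg _) hW1).trans h4)
    have h6 := le_cube hM
    have h7 := norm_sub_le_norm_sub_add_norm_sub
      (pinch (rootSet M τ) (lvl (arcLab M τ) U) (W * y * W)) (W * y * W) (W * W * y)
    rw [norm_sub_rev] at hp
    have hp' : ‖pinch (rootSet M τ) (lvl (arcLab M τ) U) (W * y * W) - W * y * W‖
      ≤ M ^ 3 * ‖U * y - y * U‖ := hp
    nlinarith [norm_nonneg (U * y - y * U)]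

/-- Data on one family of arcs. -/
lemma exists_arc_side (hM : M ≠ 0) (hU : U ∈ unitary A) {V Y : A} {τ : ℂ} (hτ : τ = 1 ∨ τ = -1)
    (hV : star V * V = 1) (hV' : V * star V = 1) (hYs : star Y = Y) (hY : ‖Y‖ ≤ 1 / 2)
    (hcV : ∀ c ∈ rootSet M τ, Commute (lvl (arcLab M τ) U c) V)
    (hcY : ∀ c ∈ rootSet M τ, Commute (lvl (arcLab M τ) U c) Y) :
    ∃ E J G, IsSideData V Y E J G ∧ ‖E‖ ≤ 1 ∧ ‖J‖ ≤ 1 ∧ ‖G‖ ≤ 1 ∧ star (J * G) = J * G ∧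
      ‖J * G * U - U * (J * G)‖ ≤ 14 / M := by
  obtain ⟨E, J, G, h, hE, hJ, hG, hJG, hc⟩ := exists_isSideData hV hV' hYs hY
  have hpvm := isPVM_lvl (κ := arcLab M τ) hU (arc_mem hM hτ)
  refine ⟨E, J, G, h, hE, hJ, hG, hJG, ?_⟩
  have hc' : ∀ c ∈ rootSet M τ, Commute (J * G) (lvl (arcLab M τ) U c) := fun c hc1 =>
    have := hc _ (hpvm.star_eq c) (hcV c hc1) (hcY c hc1)
    this.1.symm.mul_left this.2.symm
  have h1 := norm_comm_le_of_label (isLabel_lab_lab hM hτ) hU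
    (commute_cfc_label hU (arc_mem hM hτ) hc' fun z => z)
  have h2 : ‖J * G‖ ≤ 1 := (norm_mul_le _ _).trans (mul_le_one₀ hJ (norm_nonneg _) hG)
  refine h1.trans ?_
  have hMp : (0 : ℝ) < M := by positivity
  rw [mul_div_assoc', div_le_div_iff_of_pos_right hMp]
  have := Real.pi_lt_d2
  nlinarith [Real.pi_pos, norm_nonneg (J * G)]

/-- A small shift makes an operator invertible. -/
lemma exists_shift_isUnit (N : A) {r : ℝ} (hr : 0 < r) :
    ∃ t : ℝ, 0 < t ∧ t ≤ r ∧ IsUnit (N + (t : ℂ) • 1) := by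
  have hinf : ((fun t : ℝ => (-t : ℂ)) '' Set.Ioc 0 r).Infinite :=
    (Set.Ioc_infinite hr).image fun a _ b _ h => by simpa using h
  obtain ⟨z, ⟨t, ht, rfl⟩, hz⟩ := hinf.exists_notMem_finite (FinSpec.fin N)
  refine ⟨t, ht.1, ht.2, ?_⟩
  rw [spectrum.notMem_iff] at hz
  have e : N + (t : ℂ) • 1 = -(algebraMap ℂ A (-t : ℂ) - N) := by
    rw [Algebra.algebraMap_eq_smul_one]; module
  rw [e]; exact hz.neg

/-- The unitary of the windowed problem. -/
lemma exists_window_unitary (hM : M ≠ 0) (hU : U ∈ unitary A) (hy : star y = y)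
    (hy1 : ‖y‖ ≤ 1 / 2) {η : ℝ} (hη : 0 < η) (hη1 : 6 * M ^ 3 * ‖U * y - y * U‖ ≤ η) :
    ∃ V H : A, star V * V = 1 ∧ V * star V = 1 ∧ 0 ≤ H ∧ ‖H‖ ≤ 100 ∧
      ‖V * H - (rePart (U ^ M) + Complex.I •
        ((1 - rePart (U ^ M) * rePart (U ^ M)) * y))‖ ≤ η ∧
      ‖V * U - U * V‖ ≤ 4 / M ∧
      ∀ τ : ℂ, τ = 1 ∨ τ = -1 → ∀ c ∈ rootSet M τ, Commute (lvl (arcLab M τ) U c) V := by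
  have h2M : 2 * M ≠ 0 := by positivity
  have hlab : IsLabel (lab (2 * M) (-1)) (2 * M) (-1) := isLabel_lab h2M (by simp)
  have hS : ∀ z, ‖z‖ = 1 → lab (2 * M) (-1) z ∈ rootSet (2 * M) (-1) := fun z hz =>
    (mem_rootSet h2M).2 (hlab.pow_eq z hz)
  have hpvm := isPVM_lvl hU hS
  have hp := norm_sub_pinch_im_le hM hU hy
  have hu := pow_mem hU M
  have hQ1 : ‖imPart (U ^ M)‖ ≤ 1 := norm_imPart_le (CStarRing.norm_of_mem_unitary hu).le
  have hx1 : ‖rePart (U ^ M)‖ ≤ 1 := norm_rePart_le (CStarRing.norm_of_mem_unitary hu).le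
  have hQc : ‖imPart (U ^ M) * y - y * imPart (U ^ M)‖ ≤ M * ‖U * y - y * U‖ :=
    (norm_comm_imPart hu y).trans (norm_comm_pow hU y M)
  have hxQ := rePart_sq_add_imPart_sq (Unitary.mem_iff.1 hu).1 (Unitary.mem_iff.1 hu).2
  set Q := imPart (U ^ M) with hQ
  set x := rePart (U ^ M) with hx
  set R := pinch (rootSet (2 * M) (-1)) (lvl (lab (2 * M) (-1)) U) (Q * y * Q) with hR
  have hR1 : ‖R‖ ≤ 1 / 2 :=
    (norm_pinch_le hpvm _).trans ((norm_proj_mul_mul_le hQ1 hQ1 y).trans hy1)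
  obtain ⟨t, ht0, ht, hN⟩ := exists_shift_isUnit (x + Complex.I • R)
    (lt_min (half_pos hη) zero_lt_one)
  obtain ⟨V, H, hV, hV', hH, hVH, hcomm, -⟩ := exists_polar hN
  have hV1 := norm_le_one_of_unitary hV hV'
  have hlvl : ∀ c ∈ rootSet (2 * M) (-1), Commute V (lvl (lab (2 * M) (-1)) U c) := fun c hc => by
    refine (hcomm _ (hpvm.star_eq c) ?_).symm
    refine ((?_ : Commute _ x).add_right ((commute_pinch hpvm _ hc).smul_right _)).add_right
      ((Commute.one_right _).smul_right _)
    rw [hx, rePart_pow_eq_cfc hU]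
    exact cfc_commute_cfc _ _ _
  have hn : ‖x + Complex.I • R + (t : ℂ) • (1 : A)‖ ≤ 3 := by
    refine (norm_add₃_le).trans ?_
    rw [norm_smul, norm_smul, CStarRing.norm_one, Complex.norm_I, Complex.norm_real,
      Real.norm_eq_abs, abs_of_pos ht0]
    have := ht.trans (min_le_right _ _)
    linarith
  refine ⟨V, H, hV, hV', hH, ?_, ?_, ?_, ?_⟩
  · have e : H = star V * (x + Complex.I • R + (t : ℂ) • (1 : A)) := by
      rw [← hVH, ← mul_assoc, hV, one_mul]
    rw [e]
    refine (norm_mul_le _ _).trans ?_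
    rw [norm_star]
    nlinarith [norm_nonneg V, norm_nonneg (x + Complex.I • R + (t : ℂ) • (1 : A))]
  · have e : V * H - (x + Complex.I • ((1 - x * x) * y))
        = (t : ℂ) • (1 : A) + Complex.I • ((R - Q * y * Q) - Q * (Q * y - y * Q)) := by
      have : (1 - x * x) * y = Q * Q * y := by
        rw [← hxQ]; noncomm_ring
      rw [hVH, this, mul_sub, ← mul_assoc, ← mul_assoc]
      module
    rw [e]
    refine (norm_add_le _ _).trans ?_
    rw [norm_smul, norm_smul, CStarRing.norm_one, Complex.norm_I, Complex.norm_real,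
      Real.norm_eq_abs, abs_of_pos ht0, mul_one, one_mul]
    have h1 := norm_sub_le (R - Q * y * Q) (Q * (Q * y - y * Q))
    have h2 : ‖Q * (Q * y - y * Q)‖ ≤ M * ‖U * y - y * U‖ :=
      (norm_mul_le _ _).trans ((mul_le_of_le_one_left (norm_nonneg _) hQ1).trans hQc)
    rw [norm_sub_rev] at hp
    have h3 := le_cube hM
    have h4 := ht.trans (min_le_left _ _)
    nlinarith [norm_nonneg (U * y - y * U)]
  · have h1 := norm_comm_le_of_label hlab hU (commute_cfc_label hU hS hlvl fun z => z)
    refine h1.trans ?_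
    have hMp : (0 : ℝ) < M := by positivity
    have : 2 * ‖V‖ * (Real.pi / (2 * M : ℕ)) = ‖V‖ * Real.pi / M := by
      push_cast; field_simp
    rw [this, div_le_div_iff_of_pos_right hMp]
    have := Real.pi_lt_d2
    nlinarith [Real.pi_pos, norm_nonneg V]
  · intro τ _ c _
    have := commute_cfc_label hU hS hlvl fun w => if lab M τ w = c then 1 else 0
    exact this.symm

/-- For `U`, `k` almost commuting there are data for the gap theorem. -/
theorem exists_gapData {k : A} (hM : M ≠ 0) (hU : U ∈ unitary A) (hk : IsSelfAdjoint k) {η : ℝ}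
    (hη : 0 < η) (hη1 : 6 * M ^ 3 * ‖U * k - k * U‖ ≤ η) :
    ∃ D : GapData A, D.k = k ∧ D.Approx η ∧ star D.T = D.T ∧ ‖D.T‖ ≤ 3 ∧
      ‖D.T * U - U * D.T‖ ≤ 32 / M := by
  obtain ⟨β, b, y, m, hd⟩ := exists_kPart hk
  have hy := hd.comm_y U
  have hb := hd.comm_b U
  have hM3 : (0 : ℝ) ≤ M ^ 3 := by positivity
  have hηy : 6 * M ^ 3 * ‖U * y - y * U‖ ≤ η := le_trans (by gcongr) hη1
  have hηb : 6 * M ^ 3 * ‖U * b - b * U‖ ≤ η := le_trans (by gcongr) hη1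
  have hM3' := le_cube hM
  obtain ⟨V, H, hV, hV', hH, hH1, hVH, hVU, hcV⟩ :=
    exists_window_unitary hM hU hd.ys hd.by' hη hηy
  have hu := pow_mem hU M
  have hx1 : ‖rePart (U ^ M)‖ ≤ 1 := norm_rePart_le (CStarRing.norm_of_mem_unitary hu).le
  have hxQ := rePart_sq_add_imPart_sq (Unitary.mem_iff.1 hu).1 (Unitary.mem_iff.1 hu).2
  have hw := weight_nonneg (M := M) hU (σ := 1) (by simp)
  have hw' := weight_nonneg (M := M) hU (σ := -1) (by simp)
  obtain ⟨Y, hY1, hYs, hYw, hcY⟩ := exists_side_weight hM hU hd.ys hd.by' (σ := 1) (τ := 1)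
    (by simp) (by simp) (by simp) (W := (1 / 2 : ℂ) • (1 + rePart (U ^ M))) (by simp)
  obtain ⟨Y', hY1', hYs', hYw', hcY'⟩ := exists_side_weight hM hU hd.ys hd.by' (σ := -1) (τ := -1)
    (by simp) (by simp) (by simp) (W := (1 / 2 : ℂ) • (1 - rePart (U ^ M)))
    (by simp [sub_eq_add_neg])
  have hV2 : star (-star V) * (-star V) = 1 := by simp [hV']
  have hV2' : -star V * star (-star V) = 1 := by simp [hV]
  have hpvm' := isPVM_lvl (κ := arcLab M (-1)) hU (arc_mem hM (Or.inr rfl))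
  obtain ⟨E, J, G, hside, hE, hJ, hG, hJG, hJGU⟩ := exists_arc_side hM hU (τ := 1) (Or.inl rfl)
    hV hV' hYs hY1 (hcV 1 (Or.inl rfl)) hcY
  obtain ⟨E', J', G', hside', hE', hJ', hG', hJG', hJGU'⟩ := exists_arc_side hM hU (τ := -1)
    (Or.inr rfl) hV2 hV2' hYs' hY1' (fun c hc => by
      have := (hcV (-1) (Or.inr rfl) c hc).star_star
      rw [hpvm'.star_eq] at this
      exact this.neg_right) hcY'
  have hV1 := norm_le_one_of_unitary hV hV'
  have hcomm : ∀ z : A, 6 * M ^ 3 * ‖U * z - z * U‖ ≤ η →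
      ‖rePart (U ^ M) * z - z * rePart (U ^ M)‖ ≤ η := fun z hz => by
    have h1 := (norm_comm_rePart hu z).trans (norm_comm_pow hU z M)
    nlinarith [norm_nonneg (U * z - z * U)]
  have hJG1 : ‖J * G‖ ≤ 1 := (norm_mul_le _ _).trans (mul_le_one₀ hJ (norm_nonneg _) hG)
  have hJG1' : ‖J' * G'‖ ≤ 1 := (norm_mul_le _ _).trans (mul_le_one₀ hJ' (norm_nonneg _) hG')
  refine ⟨⟨β, rePart (U ^ M), y, b, m, k, V, H, E, J, G, Y, E', J', G', Y'⟩, rfl,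
    { hβ := ?_, bx := ?_, by' := ?_, bb := ?_, bm := ?_, bV := ?_, bH := hH1, bE := ?_, bJ := ?_,
      bG := ?_, bY := ?_, bE' := ?_, bJ' := ?_, bG' := ?_, bY' := ?_, xs := star_rePart _,
      ys := hd.ys, bk := hd.bk, kb := hd.kb, ks := hk, ym := hd.ym, bm_eq := hd.bm_eq,
      posb := hd.posb, posx := ?_, posw := ?_, posw' := ?_, xy := ?_, xb := ?_, hY := ?_,
      hY' := ?_, V_star_mul := hV, V_mul_star := hV', posH := hH, VH := hVH, side := hside,
      side' := hside', big := hd.big }, ?_, ?_, ?_⟩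
  · exact hd.hβ.trans (by norm_num)
  · exact hx1.trans (by norm_num)
  · exact hd.by'.trans (by norm_num)
  · exact hd.bb.trans (by norm_num)
  · exact hd.bm.trans (by norm_num)
  · exact hV1.trans (by norm_num)
  · exact hE.trans (by norm_num)
  · exact hJ.trans (by norm_num)
  · exact hG.trans (by norm_num)
  · exact hY1.trans (by norm_num)
  · exact hE'.trans (by norm_num)
  · exact hJ'.trans (by norm_num)
  · exact hG'.trans (by norm_num)
  · exact hY1'.trans (by norm_num)
  · have e : 1 - rePart (U ^ M) * rePart (U ^ M) = star (imPart (U ^ M)) * imPart (U ^ M) := by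
      rw [star_imPart, ← hxQ]; abel
    change 0 ≤ 1 - rePart (U ^ M) * rePart (U ^ M)
    rw [e]; exact star_mul_self_nonneg _
  · simpa [GapData.w] using hw
  · simpa [GapData.w', sub_eq_add_neg] using hw'
  · exact hcomm y hηy
  · exact hcomm b hηb
  · refine hYw.trans (le_trans ?_ hηy); nlinarith [norm_nonneg (U * y - y * U)]
  · refine hYw'.trans (le_trans ?_ hηy); nlinarith [norm_nonneg (U * y - y * U)]
  · simp only [GapData.T]
    rw [star_neg, star_add, star_add, star_imPart, hJG, hJG']
  · simp only [GapData.T]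
    rw [norm_neg]
    have := norm_imPart_le hV1
    refine norm_add₃_le.trans ?_
    linarith
  · simp only [GapData.T]
    have e : -(imPart V + J * G + J' * G') * U - U * -(imPart V + J * G + J' * G')
        = -((imPart V * U - U * imPart V) + (J * G * U - U * (J * G))
          + (J' * G' * U - U * (J' * G'))) := by
      simp only [neg_mul, mul_neg, add_mul, mul_add]; abel
    rw [e, norm_neg]
    have h1 := (norm_comm_imPart (Unitary.mem_iff.2 ⟨hV, hV'⟩) U).trans hVU
    refine norm_add₃_le.trans ((add_le_add (add_le_add h1 hJGU) hJGU').trans (le_of_eq ?_))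
    ring

end approx

section spectral

variable {A : Type*} [CStarAlgebra A] [PartialOrder A] [StarOrderedRing A] [FinSpec A]
  [Nontrivial A]

/-- The spectral projection of `a` onto `s`. -/
def ind (s : Set ℝ) (a : A) : A := cfc (s.indicator fun _ => (1 : ℝ)) a

variable {a b X : A} {s t : Set ℝ}

lemma star_ind (s : Set ℝ) (a : A) : star (ind s a) = ind s a :=
  (IsSelfAdjoint.cfc (f := s.indicator fun _ => (1 : ℝ))).star_eq

lemma ind_mul_ind (s t : Set ℝ) (a : A) : ind s a * ind t a = ind (s ∩ t) a := by
  rw [ind, ind, ind, ← cfcR_mul]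
  refine cfc_congr fun r _ => ?_
  by_cases hs : r ∈ s
  · by_cases ht : r ∈ t <;> simp [hs, ht]
  · simp [hs]

lemma ind_mul_self (s : Set ℝ) (a : A) : ind s a * ind s a = ind s a := by
  rw [ind_mul_ind, Set.inter_self]

lemma ind_compl (ha : IsSelfAdjoint a) (s : Set ℝ) : ind sᶜ a = 1 - ind s a := by
  rw [ind, ind, ← cfc_const_one ℝ a, ← cfcR_sub]
  refine cfc_congr fun r _ => ?_
  rw [Set.indicator_compl]; rfl

lemma ind_congr (h : ∀ r ∈ spectrum ℝ a, r ∈ s ↔ r ∈ t) : ind s a = ind t a := by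
  refine cfc_congr fun r hr => ?_
  by_cases hs : r ∈ s
  · simp [hs, (h r hr).1 hs]
  · have ht : r ∉ t := fun ht => hs ((h r hr).2 ht)
    simp [hs, ht]

lemma ind_eq_one (ha : IsSelfAdjoint a) (h : ∀ r ∈ spectrum ℝ a, r ∈ s) : ind s a = 1 := by
  rw [ind, ← cfc_const_one ℝ a]
  exact cfc_congr fun r hr => by simp [h r hr]

lemma ind_eq_zero (h : ∀ r ∈ spectrum ℝ a, r ∉ s) : ind s a = 0 := by
  rw [ind, ← cfc_const_zero ℝ a]
  exact cfc_congr fun r hr => by simp [h r hr]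

lemma commute_ind (ha : IsSelfAdjoint a) (s : Set ℝ) : Commute a (ind s a) := by
  have := cfc_commute_cfc (fun r : ℝ => r) (s.indicator fun _ => (1 : ℝ)) a
  rwa [cfc_id' ℝ a] at this

lemma abs_le_norm_of_mem (ha : IsSelfAdjoint a) {r : ℝ} (hr : r ∈ spectrum ℝ a) : |r| ≤ ‖a‖ := by
  have h1 := norm_apply_le_norm_cfc (fun t : ℝ => t) a hr (contR _ _)
  rwa [cfc_id' ℝ a] at h1

/-- A lower bound for the Sylvester operator of two operators with separated spectra. -/
lemma sylvester (ha : IsSelfAdjoint a) (hb : IsSelfAdjoint b) {α β : ℝ}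
    (hX : ind (Set.Iic α) a * X = X) (hX' : X * ind (Set.Ici β) b = X) :
    (β - α) * ‖X‖ ≤ ‖a * X - X * b‖ := by
  set R := ‖a‖ + ‖b‖ + |α| + |β| with hR
  have hR0 : 0 ≤ R := by positivity
  set f : ℝ → ℝ := fun r => (r + (R - α)) * (Set.Iic α).indicator (fun _ => (1 : ℝ)) r with hf
  set g : ℝ → ℝ := fun r => ((R + β) - r) * (Set.Ici β).indicator (fun _ => (1 : ℝ)) r with hg
  have hf1 : ‖cfc f a‖ ≤ R := norm_cfcR_le hR0 fun r hr => by
    have h1 := abs_le.1 (abs_le_norm_of_mem ha hr)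
    by_cases h : r ∈ Set.Iic α
    · have h2 : r ≤ α := h
      simp only [hf, Set.indicator_of_mem h, mul_one]
      rw [abs_le]
      have := le_abs_self α
      constructor <;> linarith [norm_nonneg b, abs_nonneg β, h1.1]
    · simp only [hf, Set.indicator_of_notMem h, mul_zero, abs_zero]; exact hR0
  have hg1 : ‖cfc g b‖ ≤ R := norm_cfcR_le hR0 fun r hr => by
    have h1 := abs_le.1 (abs_le_norm_of_mem hb hr)
    by_cases h : r ∈ Set.Ici β
    · have h2 : β ≤ r := h
      simp only [hg, Set.indicator_of_mem h, mul_one]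
      rw [abs_le]
      have := neg_abs_le β
      constructor <;> linarith [norm_nonneg a, abs_nonneg α, h1.2]
    · simp only [hg, Set.indicator_of_notMem h, mul_zero, abs_zero]; exact hR0
  have ef : cfc f a * X = a * X + (R - α) • X := by
    rw [hf, cfcR_mul, cfcR_add, cfc_id' ℝ a, cfc_const _ a]
    change (a + _) * ind (Set.Iic α) a * X = _
    rw [mul_assoc, hX, add_mul, Algebra.algebraMap_eq_smul_one, smul_mul_assoc, one_mul]
  have eg : X * cfc g b = (R + β) • X - X * b := by
    have : cfc g b = ind (Set.Ici β) b * (algebraMap ℝ A (R + β) - b) := by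
      rw [hg, cfcR_mul, cfcR_sub, cfc_id' ℝ b, cfc_const _ b]
      refine (Commute.sub_left ?_ (commute_ind hb _)).eq
      exact Algebra.commutes _ _
    rw [this, ← mul_assoc, hX', mul_sub, Algebra.algebraMap_eq_smul_one, mul_smul_comm, mul_one]
  have e : (2 * R + (β - α)) • X = cfc f a * X + X * cfc g b - (a * X - X * b) := by
    rw [ef, eg]; module
  have h1 := norm_smul (2 * R + (β - α)) X
  rw [e, Real.norm_eq_abs] at h1
  have h2 := norm_sub_le (cfc f a * X + X * cfc g b) (a * X - X * b)
  have h3 := norm_add_le (cfc f a * X) (X * cfc g b)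
  have h4 := norm_mul_le (cfc f a) X
  have h5 := norm_mul_le X (cfc g b)
  have h6 := le_abs_self (2 * R + (β - α))
  nlinarith [norm_nonneg X]

/-- A self-adjoint element that is bounded below has no spectrum near zero. -/
lemma le_abs_of_gap (ha : IsSelfAdjoint a) {c : ℝ} (h : ∀ p : A, c * ‖p‖ ≤ ‖a * p‖) {r : ℝ}
    (hr : r ∈ spectrum ℝ a) : c ≤ |r| := by
  set p := ind {r} a with hp
  have h1 : (1 : ℝ) ≤ ‖p‖ := by
    have := norm_apply_le_norm_cfc (({r} : Set ℝ).indicator fun _ => (1 : ℝ)) a hr (contR _ _)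
    rwa [Set.indicator_of_mem (Set.mem_singleton r), norm_one] at this
  have h2 : a * p = r • p := by
    rw [hp, ind]
    nth_rw 1 [← cfc_id' ℝ a]
    rw [← cfcR_mul, ← cfc_smul _ _ _ (contR _ _)]
    refine cfc_congr fun t _ => ?_
    by_cases ht : t = r
    · simp [ht]
    · simp [ht]
  have h3 := h p
  rw [h2, norm_smul, Real.norm_eq_abs] at h3
  exact le_of_mul_le_mul_right h3 (by linarith)

lemma norm_one_sub_le {P : A} (hs : star P = P) (hm : P * P = P) : ‖1 - P‖ ≤ 1 :=
  norm_proj_le (by simp [hs]) (by rw [mul_sub, sub_mul, sub_mul, hm]; simp)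

lemma norm_corner_ind_le (ha : IsSelfAdjoint a) {c : ℝ} (h : ∀ r ∈ spectrum ℝ a, c ≤ |r|)
    (hc : 0 < c) (U : A) :
    2 * c * ‖(1 - ind (Set.Ioi 0) a) * U * ind (Set.Ioi 0) a‖ ≤ ‖a * U - U * a‖ := by
  have e1 : ind (Set.Ioi 0) a = ind (Set.Ici c) a := ind_congr fun r hr => by
    have := h r hr
    constructor
    · intro h0; rwa [abs_of_pos h0] at this
    · intro h0; exact lt_of_lt_of_le hc h0
  have e2 : 1 - ind (Set.Ioi 0) a = ind (Set.Iic (-c)) a := by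
    rw [← ind_compl ha]
    refine ind_congr fun r hr => ?_
    have := h r hr
    rw [Set.compl_Ioi]
    constructor
    · intro h0; rw [abs_of_nonpos h0] at this; exact le_neg.1 this
    · intro h0
      have h1 : r ≤ -c := h0
      change r ≤ 0
      linarith
  rw [e2, e1]
  have h1 := sylvester (a := a) (b := a) (X := ind (Set.Iic (-c)) a * U * ind (Set.Ici c) a)
    (α := -c) (β := c) ha ha (by simp only [← mul_assoc, ind_mul_self])
    (by rw [mul_assoc, ind_mul_self])
  have e3 : a * (ind (Set.Iic (-c)) a * U * ind (Set.Ici c) a)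
      - ind (Set.Iic (-c)) a * U * ind (Set.Ici c) a * a
      = ind (Set.Iic (-c)) a * (a * U - U * a) * ind (Set.Ici c) a := by
    have h3 := (commute_ind ha (Set.Iic (-c))).eq
    have h4 := (commute_ind ha (Set.Ici c)).eq
    calc _ = a * ind (Set.Iic (-c)) a * U * ind (Set.Ici c) a
          - ind (Set.Iic (-c)) a * U * (ind (Set.Ici c) a * a) := by simp only [mul_assoc]
      _ = _ := by rw [h3, ← h4]; noncomm_ring
  rw [e3] at h1
  have h5 := norm_proj_mul_mul_le (norm_proj_le (star_ind (Set.Iic (-c)) a) (ind_mul_self _ a))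
    (norm_proj_le (star_ind (Set.Ici c) a) (ind_mul_self _ a)) (a * U - U * a)
  linarith

/-- The positive spectral projection of a gapped operator almost commutes with everything the
operator almost commutes with. -/
lemma norm_comm_ind_le (ha : IsSelfAdjoint a) {c : ℝ} (h : ∀ r ∈ spectrum ℝ a, c ≤ |r|)
    (hc : 0 < c) (U : A) :
    c * ‖ind (Set.Ioi 0) a * U - U * ind (Set.Ioi 0) a‖ ≤ ‖a * U - U * a‖ := by
  have h1 := norm_corner_ind_le ha h hc U
  have h2 := norm_corner_ind_le ha h hc (star U)
  have e1 : a * star U - star U * a = -star (a * U - U * a) := by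
    rw [star_sub, star_mul, star_mul, ha.star_eq]; abel
  rw [e1, norm_neg, norm_star] at h2
  set P := ind (Set.Ioi 0) a with hP
  have hPs : star P = P := star_ind _ a
  have e2 : (1 - P) * star U * P = star (P * U * (1 - P)) := by
    rw [star_mul, star_mul, star_sub, star_one, hPs, mul_assoc]
  rw [e2, norm_star] at h2
  have e3 : P * U - U * P = P * U * (1 - P) - (1 - P) * U * P := by noncomm_ring
  have h3 := norm_sub_le (P * U * (1 - P)) ((1 - P) * U * P)
  rw [← e3] at h3
  nlinarith

/-- Functions of an operator act on eigenspaces by scalars. -/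
lemma cfc_mul_eigen (ha : IsSelfAdjoint a) {r : ℝ} {p : A} (h : a * p = r • p) (f : ℝ → ℝ) :
    cfc f a * p = f r • p := by
  have e : cfc (fun t => f t - f r) a = cfc (fun t => (f t - f r) / (t - r)) a
      * (a - algebraMap ℝ A r) := by
    nth_rw 3 [← cfc_id' ℝ a]
    rw [← cfc_const r a, ← cfcR_sub, ← cfcR_mul]
    refine cfc_congr fun t _ => ?_
    by_cases ht : t = r
    · simp [ht]
    · exact (div_mul_cancel₀ _ (sub_ne_zero.2 ht)).symm
  rw [cfcR_sub, cfc_const _ a] at e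
  have e2 := congrArg (· * p) e
  simp only [sub_mul, mul_assoc, h, Algebra.algebraMap_eq_smul_one, smul_mul_assoc, one_mul,
    sub_self, mul_zero] at e2
  exact sub_eq_zero.1 e2

end spectral

section cut

variable {A : Type*} [CStarAlgebra A] [PartialOrder A] [StarOrderedRing A] [FinSpec A]
  [Nontrivial A]

lemma ind_reflect {a : A} (ha : IsSelfAdjoint a) (r : ℝ) (t : Set ℝ) :
    ind t (algebraMap ℝ A r - a) = ind {x | r - x ∈ t} a := by
  have e : algebraMap ℝ A r - a = cfc (fun x => r - x) a := by
    rw [cfcR_sub, cfc_const r a, cfc_id' ℝ a]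
  rw [ind, e, ← cfc_comp' _ _ a ?_ (contR _ _)]
  · rfl
  · refine (Set.Finite.image _ ?_).continuousOn _
    rw [← spectrum.preimage_algebraMap (R := ℝ) ℂ]
    exact (FinSpec.fin a).preimage ((algebraMap ℝ ℂ).injective.injOn)

variable {K T B U : A} {p q r s : ℝ}

lemma norm_locality_low (hK : IsSelfAdjoint K) (hT : IsSelfAdjoint T) (hT3 : ‖T‖ ≤ 3) (hs : 0 < s)
    (hB : B = s • T - (K - algebraMap ℝ A r)) :
    (r - p) * ‖(1 - ind (Set.Ioi 0) B) * ind (Set.Iic p) K‖ ≤ 3 * s := by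
  have hBs : IsSelfAdjoint B := by
    rw [hB]
    exact ((IsSelfAdjoint.all s).smul hT).sub (hK.sub ((IsSelfAdjoint.all r).algebraMap A))
  have hP : 1 - ind (Set.Ioi 0) B = ind (Set.Iic 0) B := by
    rw [← ind_compl hBs, Set.compl_Ioi]
  have hχ : ind (Set.Ici (r - p)) (algebraMap ℝ A r - K) = ind (Set.Iic p) K := by
    rw [ind_reflect hK]; congr 1; ext x; simp only [Set.mem_Ici, Set.mem_Iic, Set.mem_ofPred_eq]
    constructor <;> intro h <;> linarith
  have h := sylvester (a := B) (b := algebraMap ℝ A r - K) (α := 0) (β := r - p)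
    (X := ind (Set.Iic 0) B * ind (Set.Iic p) K) hBs (((IsSelfAdjoint.all r).algebraMap A).sub hK)
    (by rw [← mul_assoc, ind_mul_self]) (by rw [hχ, mul_assoc, ind_mul_self])
  have e : B * (ind (Set.Iic 0) B * ind (Set.Iic p) K)
      - ind (Set.Iic 0) B * ind (Set.Iic p) K * (algebraMap ℝ A r - K)
      = ind (Set.Iic 0) B * (s • T) * ind (Set.Iic p) K := by
    have h1 := (commute_ind hBs (Set.Iic 0)).eq
    have h0 : Commute (algebraMap ℝ A r) (ind (Set.Iic p) K) := Algebra.commutes _ _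
    have h2 := (h0.sub_left (commute_ind hK (Set.Iic p))).eq
    have h3 : s • T = B - (algebraMap ℝ A r - K) := by rw [hB]; abel
    rw [← mul_assoc, h1, mul_assoc, mul_assoc, ← h2, h3]
    noncomm_ring
  rw [e] at h
  have h5 := norm_proj_mul_mul_le (norm_proj_le (star_ind (Set.Iic 0) B) (ind_mul_self _ B))
    (norm_proj_le (star_ind (Set.Iic p) K) (ind_mul_self _ K)) (s • T)
  rw [norm_smul, Real.norm_eq_abs, abs_of_pos hs] at h5
  rw [hP]
  nlinarith

lemma norm_locality_high (hK : IsSelfAdjoint K) (hT : IsSelfAdjoint T) (hT3 : ‖T‖ ≤ 3)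
    (hs : 0 < s) (hB : B = s • T - (K - algebraMap ℝ A r)) :
    (q - r) * ‖ind (Set.Ioi 0) B * ind (Set.Ioi q) K‖ ≤ 3 * s := by
  have hBs : IsSelfAdjoint B := by
    rw [hB]
    exact ((IsSelfAdjoint.all s).smul hT).sub (hK.sub ((IsSelfAdjoint.all r).algebraMap A))
  have hχ : ind (Set.Iic (r - q)) (algebraMap ℝ A r - K) = ind (Set.Ici q) K := by
    rw [ind_reflect hK]; congr 1; ext x; simp only [Set.mem_Ici, Set.mem_Iic, Set.mem_ofPred_eq]
    constructor <;> intro h <;> linarith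
  have h := sylvester (a := algebraMap ℝ A r - K) (b := B) (α := r - q) (β := 0)
    (X := ind (Set.Ioi q) K * ind (Set.Ioi 0) B) (((IsSelfAdjoint.all r).algebraMap A).sub hK) hBs
    (by rw [hχ, ← mul_assoc, ind_mul_ind, Set.inter_eq_right.2 Set.Ioi_subset_Ici_self])
    (by rw [mul_assoc, ind_mul_ind, Set.inter_eq_left.2 Set.Ioi_subset_Ici_self])
  have e : (algebraMap ℝ A r - K) * (ind (Set.Ioi q) K * ind (Set.Ioi 0) B)
      - ind (Set.Ioi q) K * ind (Set.Ioi 0) B * B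
      = -(ind (Set.Ioi q) K * (s • T) * ind (Set.Ioi 0) B) := by
    have h1 := (commute_ind hBs (Set.Ioi 0)).eq
    have h0 : Commute (algebraMap ℝ A r) (ind (Set.Ioi q) K) := Algebra.commutes _ _
    have h2 := (h0.sub_left (commute_ind hK (Set.Ioi q))).eq
    have h3 : s • T = B - (algebraMap ℝ A r - K) := by rw [hB]; abel
    rw [← mul_assoc, h2, mul_assoc (ind (Set.Ioi q) K) _ B, ← h1, h3]
    noncomm_ring
  rw [e, norm_neg] at h
  have h5 := norm_proj_mul_mul_le (norm_proj_le (star_ind (Set.Ioi q) K) (ind_mul_self _ K))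
    (norm_proj_le (star_ind (Set.Ioi 0) B) (ind_mul_self _ B)) (s • T)
  rw [norm_smul, Real.norm_eq_abs, abs_of_pos hs] at h5
  have e2 : ind (Set.Ioi 0) B * ind (Set.Ioi q) K
      = star (ind (Set.Ioi q) K * ind (Set.Ioi 0) B) := by
    rw [star_mul, star_ind, star_ind]
  rw [e2, norm_star]
  nlinarith

/-- A gapped operator comparable with `K - r` yields a projection cutting the spectrum of `K`
between `p` and `q`. -/
theorem exists_cut (hK : IsSelfAdjoint K) (hT : IsSelfAdjoint T) (hT3 : ‖T‖ ≤ 3) (hU : ‖U‖ ≤ 1)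
    {c κ : ℝ} (hs : 0 < s) (hc : 0 < c) (hpq : 96 * s ≤ q - p)
    (hB : B = s • T - (K - algebraMap ℝ A ((p + q) / 2)))
    (hgap : ∀ x : A, s * c * ‖x‖ ≤ ‖B * x‖) (hcomm : ‖B * U - U * B‖ ≤ s * κ) :
    ∃ F : A, star F = F ∧ F * F = F ∧ ind (Set.Iic p) K * F = ind (Set.Iic p) K ∧
      F * ind (Set.Iic q) K = F ∧ ‖F * U - U * F‖ ≤ 4 * (κ / c) + 32 * (6 * s / (q - p)) := by
  have hBs : IsSelfAdjoint B := by
    rw [hB]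
    exact ((IsSelfAdjoint.all s).smul hT).sub (hK.sub ((IsSelfAdjoint.all _).algebraMap A))
  have hl := norm_locality_low (p := p) hK hT hT3 hs hB
  have hh := norm_locality_high (q := q) hK hT hT3 hs hB
  have hPU := norm_comm_ind_le hBs (fun r hr => le_abs_of_gap hBs hgap hr) (by positivity) U
  have hqp : 0 < q - p := by linarith
  have hρ : 1 - ind (Set.Iic q) K = ind (Set.Ioi q) K := by
    rw [← ind_compl hK, Set.compl_Iic]
  have hχρ : ind (Set.Iic p) K * ind (Set.Ioi q) K = 0 := by
    rw [ind_mul_ind]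
    refine ind_eq_zero fun x _ hx => ?_
    have h1 : x ≤ p := hx.1
    have h2 : q < x := hx.2
    linarith
  have hρχ : ind (Set.Ioi q) K * ind (Set.Iic p) K = 0 := by
    rw [ind_mul_ind, Set.inter_comm, ← ind_mul_ind, hχρ]
  have hχs := star_ind (Set.Iic p) K
  have hρs := star_ind (Set.Ioi q) K
  have hχχ := ind_mul_self (Set.Iic p) K
  have hρρ := ind_mul_self (Set.Ioi q) K
  have hPs := star_ind (Set.Ioi 0) B
  have hPP := ind_mul_self (Set.Ioi 0) B
  set χ := ind (Set.Iic p) K with hχ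
  set ρ := ind (Set.Ioi q) K with hρdef
  set P := ind (Set.Ioi 0) B with hP
  set μ := 6 * s / (q - p) with hμ
  have hμ' : μ * (q - p) = 6 * s := div_mul_cancel₀ _ hqp.ne'
  have hμ1 : μ ≤ 1 / 16 := by rw [hμ, div_le_iff₀ hqp]; linarith
  have hx : ‖(1 - P) * χ‖ ≤ μ := by
    rw [hμ, le_div_iff₀ hqp]; linarith
  have hz : ‖P * ρ‖ ≤ μ := by
    rw [hμ, le_div_iff₀ hqp]; linarith
  set d := (1 - P) * χ - P * ρ with hd
  have hd2 : ‖d‖ ≤ 2 * μ := (norm_sub_le _ _).trans (by linarith)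
  set e := 1 - (χ + ρ) with he
  have hes : star e = e := by rw [he]; simp [hχs, hρs]
  have hff : (χ + ρ) * (χ + ρ) = χ + ρ := by
    rw [add_mul, mul_add, mul_add, hχχ, hρρ, hχρ, hρχ]; simp
  have hfg : (χ + ρ) * (χ - ρ) = χ - ρ := by
    rw [add_mul, mul_sub, mul_sub, hχχ, hρρ, hχρ, hρχ]; simp [sub_eq_add_neg]
  have he1 : ‖e‖ ≤ 1 := norm_one_sub_le (by simp [hχs, hρs]) hff
  have heχ : e * χ = 0 := by rw [he, sub_mul, add_mul, hχχ, hρχ]; simp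
  have heρ : e * ρ = 0 := by rw [he, sub_mul, add_mul, hρρ, hχρ]; simp
  set Y := χ - ρ + e * (P + P - 1) * e with hY
  have hYs : IsSelfAdjoint Y := by
    rw [IsSelfAdjoint, hY]
    simp only [star_add, star_sub, star_mul, hχs, hρs, hes, hPs, star_one, mul_assoc]
  have hrf : (P + P - 1) * (χ + ρ) = χ - ρ - (d + d) := by rw [hd]; noncomm_ring
  have hfr : (χ + ρ) * (P + P - 1) = χ - ρ - (star d + star d) := by
    have := congrArg star hrf
    simpa only [star_mul, star_add, star_sub, hχs, hρs, hPs, star_one] using this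
  have hYr : Y - (P + P - 1) = (star d + star d) + e * (d + d) := by
    have h1 : e * (P + P - 1) * e = (P + P - 1) - (χ + ρ) * (P + P - 1)
        - (P + P - 1) * (χ + ρ) + (χ + ρ) * ((P + P - 1) * (χ + ρ)) := by
      rw [he]; noncomm_ring
    have h2 : (χ + ρ) * (χ - ρ - (d + d)) = χ - ρ - (χ + ρ) * (d + d) := by
      rw [mul_sub, hfg]
    rw [hY, h1, hrf, hfr, h2, he]
    noncomm_ring
  have hYr1 : ‖Y - (P + P - 1)‖ ≤ 8 * μ := by
    rw [hYr]
    have h1 := norm_add_le (star d + star d) (e * (d + d))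
    have h2 := norm_add_le (star d) (star d)
    have h3 := norm_mul_le e (d + d)
    have h4 := norm_add_le d d
    rw [norm_star] at h2
    nlinarith [norm_nonneg (d + d)]
  have hrr : (P + P - 1) * (P + P - 1) = 1 := by
    have : (P + P - 1) * (P + P - 1) = (P * P + P * P) + (P * P + P * P) - (P + P) - (P + P) + 1 := by
      noncomm_ring
    rw [this, hPP]; abel
  have hr1 : ‖P + P - 1‖ ≤ 1 := norm_le_one_of_unitary
    (by rw [star_sub, star_add, hPs, star_one, hrr]) (by rw [star_sub, star_add, hPs, star_one, hrr])
  have hYgap : ∀ x : A, 1 / 2 * ‖x‖ ≤ ‖Y * x‖ := fun x => by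
    have h1 : ‖x‖ ≤ ‖(P + P - 1) * x‖ := by
      have : x = (P + P - 1) * ((P + P - 1) * x) := by rw [← mul_assoc, hrr, one_mul]
      calc ‖x‖ = ‖(P + P - 1) * ((P + P - 1) * x)‖ := by rw [← this]
        _ ≤ _ := (norm_mul_le _ _).trans (mul_le_of_le_one_left (norm_nonneg _) hr1)
    have h2 : (P + P - 1) * x = Y * x - (Y - (P + P - 1)) * x := by noncomm_ring
    have h3 := norm_sub_le (Y * x) ((Y - (P + P - 1)) * x)
    have h4 := norm_mul_le (Y - (P + P - 1)) x
    rw [← h2] at h3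
    nlinarith [norm_nonneg x]
  have hFU := norm_comm_ind_le hYs (fun r hr => le_abs_of_gap hYs hYgap hr) (by norm_num) U
  have hYχ : Y * χ = (1 : ℝ) • χ := by
    rw [hY, add_mul, sub_mul, hχχ, hρχ, mul_assoc _ e, heχ]; simp
  have hYρ : Y * ρ = (-1 : ℝ) • ρ := by
    rw [hY, add_mul, sub_mul, hρρ, hχρ, mul_assoc _ e, heρ]; simp
  have hFχ : ind (Set.Ioi 0) Y * χ = χ := by
    rw [ind, cfc_mul_eigen hYs hYχ, Set.indicator_of_mem (by simp), one_smul]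
  have hFρ : ind (Set.Ioi 0) Y * ρ = 0 := by
    rw [ind, cfc_mul_eigen hYs hYρ, Set.indicator_of_notMem (by simp), zero_smul]
  refine ⟨ind (Set.Ioi 0) Y, star_ind _ _, ind_mul_self _ _, ?_, ?_, ?_⟩
  · have := congrArg star hFχ
    rw [star_mul, hχs, star_ind] at this
    exact this
  · rw [← hρ, mul_sub, mul_one, sub_eq_zero] at hFρ
    exact hFρ.symm
  · have h1 : ‖P * U - U * P‖ ≤ κ / c := by
      rw [le_div_iff₀ hc]
      have h2 : s * (c * ‖P * U - U * P‖) ≤ s * κ := by linarith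
      have := le_of_mul_le_mul_left h2 hs
      linarith
    have e1 : Y * U - U * Y = ((Y - (P + P - 1)) * U - U * (Y - (P + P - 1)))
        + ((P * U - U * P) + (P * U - U * P)) := by noncomm_ring
    have h3 := norm_add_le ((Y - (P + P - 1)) * U - U * (Y - (P + P - 1)))
      ((P * U - U * P) + (P * U - U * P))
    have h4 := norm_add_le (P * U - U * P) (P * U - U * P)
    have h5 := norm_sub_le ((Y - (P + P - 1)) * U) (U * (Y - (P + P - 1)))
    have h6 := norm_mul_le (Y - (P + P - 1)) U
    have h7 := norm_mul_le U (Y - (P + P - 1))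
    rw [← e1] at h3
    have h8 : ‖Y - (P + P - 1)‖ * ‖U‖ ≤ 8 * μ :=
      (mul_le_of_le_one_right (norm_nonneg _) hU).trans hYr1
    linarith

end cut

section cuts

variable {A : Type*} [CStarAlgebra A] [PartialOrder A] [StarOrderedRing A] [FinSpec A]
  [Nontrivial A]

lemma proj_le_of_mul_eq {P Q : A} (hP : star P = P) (hPP : P * P = P) (hQ : star Q = Q)
    (hQQ : Q * Q = Q) (h : P * Q = P) : P ≤ Q := by
  have h' : Q * P = P := by
    have := congrArg star h
    rwa [star_mul, hP, hQ] at this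
  rw [← sub_nonneg]
  have : Q - P = star (Q - P) * (Q - P) := by
    rw [star_sub, hP, hQ, sub_mul, mul_sub, mul_sub, hPP, hQQ, h, h']; abel
  rw [this]
  exact star_mul_self_nonneg _

lemma norm_le_of_neg_le_le {a : A} (ha : IsSelfAdjoint a) {r : ℝ} (h1 : algebraMap ℝ A (-r) ≤ a)
    (h2 : a ≤ algebraMap ℝ A r) : ‖a‖ ≤ r := by
  rcases CStarAlgebra.norm_or_neg_norm_mem_spectrum ha with h | h
  · exact (le_algebraMap_iff_spectrum_le ha).1 h2 _ h
  · have := (algebraMap_le_iff_le_spectrum ha).1 h1 _ h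
    linarith

/-- An increasing family of projections cutting the spectrum of `K` between the points
`g 0, g 1, …`. -/
structure IsCutFamily (K : A) (g : ℕ → ℝ) (F : ℕ → A) : Prop where
  star_eq : ∀ j, star (F j) = F j
  mul_self : ∀ j, F j * F j = F j
  low : ∀ j, ind (Set.Iic (g j)) K * F j = ind (Set.Iic (g j)) K
  high : ∀ j, F j * ind (Set.Iic (g (j + 1))) K = F j

variable {K U : A} {g : ℕ → ℝ} {F : ℕ → A} {m : ℕ}

namespace IsCutFamily

lemma mul_of_le (h : IsCutFamily K g F) {i j : ℕ} (hij : i ≤ j) : F i * F j = F i := by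
  induction j, hij using Nat.le_induction with
  | base => exact h.mul_self i
  | succ j _ ih =>
    have : F j * F (j + 1) = F j := by
      nth_rw 1 [← h.high j]
      rw [mul_assoc, h.low, h.high]
    rw [← ih, mul_assoc, this]

lemma mul_of_ge (h : IsCutFamily K g F) {i j : ℕ} (hij : i ≤ j) : F j * F i = F i := by
  have := congrArg star (h.mul_of_le hij)
  rwa [star_mul, h.star_eq, h.star_eq] at this

/-- The consecutive differences of the cuts. -/
def _root_.cutDiff (F : ℕ → A) (j : ℕ) : A := F (j + 1) - F j

lemma isPVM (h : IsCutFamily K g F) (h0 : F 0 = 0) (h1 : F m = 1) :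
    IsPVM (Finset.range m) (cutDiff F) where
  star_eq c := by rw [cutDiff, star_sub, h.star_eq, h.star_eq]
  mul_self c := by
    rw [cutDiff, sub_mul, mul_sub, mul_sub, h.mul_self, h.mul_self, h.mul_of_le c.le_succ,
      h.mul_of_ge c.le_succ]
    abel
  orth c d hcd := by
    rw [cutDiff, cutDiff, sub_mul, mul_sub, mul_sub]
    rcases lt_or_gt_of_ne hcd with hlt | hlt
    · rw [h.mul_of_le (by omega), h.mul_of_le (by omega), h.mul_of_le (by omega),
        h.mul_of_le (by omega)]
      abel
    · rw [h.mul_of_ge (by omega), h.mul_of_ge (by omega), h.mul_of_ge (by omega),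
        h.mul_of_ge (by omega)]
      abel
  sum_eq := by
    simp only [cutDiff]
    rw [Finset.sum_range_sub, h0, h1, sub_zero]

lemma norm_shift_le (h : IsCutFamily K g F) (h0 : F 0 = 0) (h1 : ∀ l, m ≤ l → F l = 1) (y : A)
    (r : ℕ) {b : ℝ} (hb : 0 ≤ b) (hyb : ∀ j, ‖cutDiff F j * y * cutDiff F (j + r)‖ ≤ b) :
    ‖∑ j ∈ Finset.range m, cutDiff F j * y * cutDiff F (j + r)‖ ≤ b := by
  have hp := h.isPVM h0 (h1 m le_rfl)
  set Q := cutDiff F with hQ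
  set Z := ∑ j ∈ Finset.range m, Q j * y * Q (j + r) with hZ
  have e : star Z * Z
      = ∑ j ∈ Finset.range m, star (Q (j + r)) *
        (star (Q j * y * Q (j + r)) * (Q j * y * Q (j + r))) * Q (j + r) := by
    nth_rw 1 [hZ]
    rw [star_sum, Finset.sum_mul]
    refine Finset.sum_congr rfl fun j hj => ?_
    have e1 : star (Q j * y * Q (j + r)) * Z
        = star (Q j * y * Q (j + r)) * (Q j * y * Q (j + r)) := by
      rw [hZ, Finset.mul_sum, Finset.sum_eq_single_of_mem j hj]
      intro i _ hi
      have h2 : star (Q j * y * Q (j + r)) * (Q i * y * Q (i + r))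
          = star (y * Q (j + r)) * (Q j * Q i) * (y * Q (i + r)) := by
        simp only [star_mul, hp.star_eq, mul_assoc]
      rw [h2, hp.orth j i hi.symm, mul_zero, zero_mul]
    rw [e1]
    have e2 : Q j * y * Q (j + r) = Q j * y * Q (j + r) * Q (j + r) := by
      rw [mul_assoc _ (Q (j + r)), hp.mul_self]
    nth_rw 1 2 [e2]
    rw [star_mul]
    simp only [mul_assoc]
  have h2 : star Z * Z ≤ algebraMap ℝ A (b ^ 2) := by
    have hs : ∑ j ∈ Finset.range m, Q (j + r) = 1 - F r := by
      have : ∀ j, Q (j + r) = F (j + 1 + r) - F (j + r) := fun j => by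
        rw [hQ, cutDiff, add_right_comm]
      simp only [this]
      rw [Finset.sum_range_sub (fun j => F (j + r)), h1 (m + r) (by omega), zero_add]
    calc star Z * Z ≤ ∑ j ∈ Finset.range m, b ^ 2 • Q (j + r) := by
          rw [e]
          refine Finset.sum_le_sum fun j _ => ?_
          have h3 : star (Q j * y * Q (j + r)) * (Q j * y * Q (j + r)) ≤ algebraMap ℝ A (b ^ 2) :=
            CStarAlgebra.star_mul_le_algebraMap_norm_sq.trans (algebraMap_mono A
              (pow_le_pow_left₀ (norm_nonneg _) (hyb j) 2))
          have h4 := star_left_conjugate_le_conjugate h3 (Q (j + r))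
          refine h4.trans_eq ?_
          rw [Algebra.algebraMap_eq_smul_one, mul_smul_comm, mul_one, smul_mul_assoc, hp.star_eq,
            hp.mul_self]
      _ = b ^ 2 • (1 - F r) := by rw [← Finset.smul_sum, hs]
      _ ≤ algebraMap ℝ A (b ^ 2) := by
          rw [Algebra.algebraMap_eq_smul_one]
          refine smul_le_smul_of_nonneg_left ?_ (sq_nonneg b)
          rw [sub_le_self_iff]
          have : F r = star (F r) * F r := by rw [h.star_eq, h.mul_self]
          rw [this]; exact star_mul_self_nonneg _
  have h3 := (CStarAlgebra.norm_le_iff_le_algebraMap _ (sq_nonneg b) (star_mul_self_nonneg Z)).2 h2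
  rw [CStarRing.norm_star_mul_self] at h3
  nlinarith [norm_nonneg Z]

lemma norm_near_le (h : IsCutFamily K g F) (h0 : F 0 = 0) (h1 : ∀ l, m ≤ l → F l = 1) {y : A}
    {b : ℝ} (hb : ∀ j, ‖F j * y - y * F j‖ ≤ b) {r : ℕ} (hr : 1 ≤ r) (j : ℕ) :
    ‖cutDiff F j * y * cutDiff F (j + r)‖ ≤ b := by
  have hp := h.isPVM h0 (h1 m le_rfl)
  have e1 : cutDiff F j * F (j + 1) = cutDiff F j := by
    rw [cutDiff, sub_mul, h.mul_self, h.mul_of_le j.le_succ]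
  have e2 : F (j + 1) * cutDiff F (j + r) = 0 := by
    rw [cutDiff, mul_sub, h.mul_of_le (by omega), h.mul_of_le (by omega), sub_self]
  have e : cutDiff F j * y * cutDiff F (j + r)
      = cutDiff F j * (F (j + 1) * y - y * F (j + 1)) * cutDiff F (j + r) := by
    rw [mul_sub, sub_mul, ← mul_assoc, e1, ← mul_assoc, mul_assoc _ (F (j + 1)), e2, mul_zero,
      sub_zero]
  rw [e]
  exact (norm_proj_mul_mul_le (norm_proj_le (hp.star_eq _) (hp.mul_self _))
    (norm_proj_le (hp.star_eq _) (hp.mul_self _)) _).trans (hb _)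

lemma norm_far_le (h : IsCutFamily K g F) (hK : IsSelfAdjoint K) (h0 : F 0 = 0)
    (h1 : ∀ l, m ≤ l → F l = 1) (y : A) (j l : ℕ) :
    (g l - g (j + 2)) * ‖cutDiff F j * y * cutDiff F l‖ ≤ ‖K * y - y * K‖ := by
  have hp := h.isPVM h0 (h1 m le_rfl)
  rcases le_or_gt (g l) (g (j + 2)) with hle | hlt
  · exact (mul_nonpos_of_nonpos_of_nonneg (by linarith) (norm_nonneg _)).trans (norm_nonneg _)
  set χ := ind (Set.Iic (g (j + 2))) K with hχ
  set ρ := ind (Set.Ioi (g l)) K with hρ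
  have hρ' : ρ = 1 - ind (Set.Iic (g l)) K := by rw [← ind_compl hK, Set.compl_Iic]
  have e1 : cutDiff F j * χ = cutDiff F j := by
    rw [cutDiff, sub_mul, h.high, ← h.mul_of_le j.le_succ, mul_assoc, h.high]
  have e2 : ρ * cutDiff F l = cutDiff F l := by
    have h2 : ind (Set.Iic (g l)) K * F (l + 1) = ind (Set.Iic (g l)) K := by
      nth_rw 1 [← h.low l]
      rw [mul_assoc, h.mul_of_le l.le_succ, h.low]
    rw [hρ', sub_mul, one_mul, cutDiff, mul_sub, h2, h.low, sub_self, sub_zero]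
  have h3 := sylvester (a := K) (b := K) (X := χ * y * ρ) (α := g (j + 2)) (β := g l) hK hK
    (by rw [← mul_assoc, ← mul_assoc, ← hχ, ind_mul_self])
    (by rw [mul_assoc, hρ, ind_mul_ind, Set.inter_eq_left.2 Set.Ioi_subset_Ici_self])
  have e3 : K * (χ * y * ρ) - χ * y * ρ * K = χ * (K * y - y * K) * ρ := by
    have c1 := (commute_ind hK (Set.Iic (g (j + 2)))).eq
    have c2 := (commute_ind hK (Set.Ioi (g l))).eq
    rw [mul_assoc (χ * y), ← c2, mul_assoc χ, ← mul_assoc, c1]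
    noncomm_ring
  rw [e3] at h3
  have h4 := norm_proj_mul_mul_le (norm_proj_le (star_ind (Set.Iic (g (j + 2))) K)
    (ind_mul_self _ K)) (norm_proj_le (star_ind (Set.Ioi (g l)) K) (ind_mul_self _ K))
    (K * y - y * K)
  have e4 : cutDiff F j * y * cutDiff F l = cutDiff F j * (χ * y * ρ) * cutDiff F l := by
    nth_rw 1 [← e1, ← e2]
    simp only [mul_assoc]
  have h5 := norm_proj_mul_mul_le (norm_proj_le (hp.star_eq j) (hp.mul_self j))
    (norm_proj_le (hp.star_eq l) (hp.mul_self l)) (χ * y * ρ)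
  rw [← e4] at h5
  calc _ ≤ (g l - g (j + 2)) * ‖χ * y * ρ‖ := by gcongr
    _ ≤ _ := h3.trans h4

lemma sub_pinch_eq (h : IsCutFamily K g F) (h0 : F 0 = 0) (h1 : ∀ l, m ≤ l → F l = 1) (y : A) :
    y - pinch (Finset.range m) (cutDiff F) y
      = (∑ j ∈ Finset.range m, cutDiff F j * y * cutDiff F (j + 1)
        + ∑ j ∈ Finset.range m, cutDiff F j * y * cutDiff F (j + 2))
      + (∑ j ∈ Finset.range m, cutDiff F (j + 1) * y * cutDiff F j
        + ∑ j ∈ Finset.range m, cutDiff F (j + 2) * y * cutDiff F j)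
      + ∑ j ∈ Finset.range m, ∑ l ∈ Finset.range m,
        if j + 3 ≤ l ∨ l + 3 ≤ j then cutDiff F j * y * cutDiff F l else 0 := by
  have hp := h.isPVM h0 (h1 m le_rfl)
  have hz : ∀ l, m ≤ l → cutDiff F l = 0 := fun l hl => by
    rw [cutDiff, h1 l hl, h1 (l + 1) (by omega), sub_self]
  set Q := cutDiff F with hQ
  have hy : y = ∑ j ∈ Finset.range m, ∑ l ∈ Finset.range m, Q j * y * Q l := by
    simp only [← Finset.mul_sum, ← Finset.sum_mul, hp.sum_eq, one_mul, mul_one]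
  have hd : ∀ r, ∑ j ∈ Finset.range m, Q j * y * Q (j + r)
      = ∑ j ∈ Finset.range m, ∑ l ∈ Finset.range m, if l = j + r then Q j * y * Q l else 0 :=
    fun r => Finset.sum_congr rfl fun j _ => by
      rw [Finset.sum_ite_eq']
      split_ifs with hm
      · rfl
      · rw [hz (j + r) (by simpa using hm), mul_zero]
  have hd' : ∀ r, ∑ j ∈ Finset.range m, Q (j + r) * y * Q j
      = ∑ j ∈ Finset.range m, ∑ l ∈ Finset.range m, if j = l + r then Q j * y * Q l else 0 :=
    fun r => by
      rw [Finset.sum_comm]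
      refine Finset.sum_congr rfl fun j _ => ?_
      rw [Finset.sum_ite_eq']
      split_ifs with hm
      · rfl
      · rw [hz (j + r) (by simpa using hm), zero_mul, zero_mul]
  have hpin : pinch (Finset.range m) Q y = ∑ j ∈ Finset.range m, Q j * y * Q (j + 0) := rfl
  rw [hpin, hd 0, hd 1, hd 2, hd' 1, hd' 2, sub_eq_iff_eq_add]
  nth_rw 1 [hy]
  simp only [← Finset.sum_add_distrib]
  refine Finset.sum_congr rfl fun j _ => Finset.sum_congr rfl fun l _ => ?_
  rcases lt_trichotomy j l with hjl | hjl | hjl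
  · rcases (by omega : l = j + 1 ∨ l = j + 2 ∨ j + 3 ≤ l) with hh | hh | hh
    · simp [hh, show ¬ j = j + 1 + 1 by omega, show ¬ j = j + 1 + 2 by omega,
        show ¬ j + 1 + 3 ≤ j by omega]
    · simp [hh, show ¬ j = j + 2 + 1 by omega, show ¬ j = j + 2 + 2 by omega,
        show ¬ j + 2 + 3 ≤ j by omega]
    · rw [if_neg (by omega), if_neg (by omega), if_neg (by omega), if_neg (by omega),
        if_pos (by omega), if_neg (by omega)]
      simp
  · subst hjl; simp
  · rcases (by omega : j = l + 1 ∨ j = l + 2 ∨ l + 3 ≤ j) with hh | hh | hh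
    · simp [hh, show ¬ l = l + 1 + 1 by omega, show ¬ l = l + 1 + 2 by omega,
        show ¬ l + 1 + 3 ≤ l by omega]
    · simp [hh, show ¬ l = l + 2 + 1 by omega, show ¬ l = l + 2 + 2 by omega,
        show ¬ l + 2 + 3 ≤ l by omega]
    · rw [if_neg (by omega), if_neg (by omega), if_neg (by omega), if_neg (by omega),
        if_pos (by omega), if_neg (by omega)]
      simp

lemma norm_sub_pinch_le (h : IsCutFamily K g F) (hK : IsSelfAdjoint K)
    (h0 : F 0 = 0) (h1 : ∀ l, m ≤ l → F l = 1) {b Δ : ℝ} (hΔ : 0 < Δ)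
    (hg : ∀ j l, j < l → g j + Δ ≤ g l) (hb : ∀ j, ‖F j * U - U * F j‖ ≤ b) :
    ‖U - pinch (Finset.range m) (cutDiff F) U‖ ≤ 4 * b + m ^ 2 * (‖U * K - K * U‖ / Δ) := by
  have hp := h.isPVM h0 (h1 m le_rfl)
  have hb0 : 0 ≤ b := (norm_nonneg _).trans (hb 0)
  have hstar : ∀ P : A, star P = P → ‖P * star U - star U * P‖ = ‖P * U - U * P‖ := fun P hP => by
    have : P * star U - star U * P = -star (P * U - U * P) := by
      rw [star_sub, star_mul, star_mul, hP]; abel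
    rw [this, norm_neg, norm_star]
  have hb' : ∀ j, ‖F j * star U - star U * F j‖ ≤ b := fun j => by
    rw [hstar _ (h.star_eq j)]; exact hb j
  have hup : ∀ r, 1 ≤ r → ‖∑ j ∈ Finset.range m, cutDiff F j * U * cutDiff F (j + r)‖ ≤ b :=
    fun r hr => h.norm_shift_le h0 h1 U r hb0 (h.norm_near_le h0 h1 hb hr)
  have hdn : ∀ r, 1 ≤ r → ‖∑ j ∈ Finset.range m, cutDiff F (j + r) * U * cutDiff F j‖ ≤ b :=
    fun r hr => by
      have := h.norm_shift_le h0 h1 (star U) r hb0 (h.norm_near_le h0 h1 hb' hr)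
      rw [← norm_star, star_sum]
      simpa only [star_mul, hp.star_eq, mul_assoc] using this
  have hfar : ∀ y : A, ∀ j l, j + 3 ≤ l →
      ‖cutDiff F j * y * cutDiff F l‖ ≤ ‖K * y - y * K‖ / Δ := fun y j l hjl => by
    rw [le_div_iff₀ hΔ]
    have := h.norm_far_le hK h0 h1 y j l
    have := hg (j + 2) l (by omega)
    nlinarith [norm_nonneg (cutDiff F j * y * cutDiff F l)]
  have hterm : ∀ j l, ‖if j + 3 ≤ l ∨ l + 3 ≤ j then cutDiff F j * U * cutDiff F l else 0‖
      ≤ ‖U * K - K * U‖ / Δ := fun j l => by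
    split_ifs with hjl
    · rcases hjl with hjl | hjl
      · rw [norm_sub_rev]; exact hfar U j l hjl
      · have := hfar (star U) l j hjl
        rw [hstar K hK.star_eq, norm_sub_rev, ← norm_star] at this
        simpa only [star_mul, hp.star_eq, star_star, mul_assoc] using this
    · rw [norm_zero]; positivity
  rw [h.sub_pinch_eq h0 h1]
  refine (norm_add_le _ _).trans (add_le_add ((norm_add_le _ _).trans ?_) ?_)
  · have a1 := norm_add_le_of_le (hup 1 le_rfl) (hup 2 (by norm_num))
    have a2 := norm_add_le_of_le (hdn 1 le_rfl) (hdn 2 (by norm_num))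
    linarith
  · refine (norm_sum_le_of_le _ fun j _ => norm_sum_le_of_le _ fun l _ => hterm j l).trans ?_
    simp [sq, mul_assoc]

end IsCutFamily

end cuts

section assemble

variable {A : Type*} [CStarAlgebra A] [PartialOrder A] [StarOrderedRing A] [FinSpec A]
  [Nontrivial A] {K U : A} {g : ℕ → ℝ} {F : ℕ → A} {m : ℕ}

lemma IsCutFamily.le_ind (h : IsCutFamily K g F) (j : ℕ) :
    F j ≤ ind (Set.Iic (g (j + 1))) K :=
  proj_le_of_mul_eq (h.star_eq j) (h.mul_self j) (star_ind _ _) (ind_mul_self _ _) (h.high j)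

lemma IsCutFamily.ind_le (h : IsCutFamily K g F) (j : ℕ) : ind (Set.Iic (g j)) K ≤ F j :=
  proj_le_of_mul_eq (star_ind _ _) (ind_mul_self _ _) (h.star_eq j) (h.mul_self j) (h.low j)

lemma IsCutFamily.norm_sub_le (h : IsCutFamily K g F) (hK : IsSelfAdjoint K) {Δ : ℝ} (hΔ : 0 < Δ)
    (hg : ∀ j, g (j + 1) = g j + Δ) (hlo : ∀ r ∈ spectrum ℝ K, g 0 ≤ r)
    (hhi : ∀ r ∈ spectrum ℝ K, r ≤ g m) :
    ‖K - (algebraMap ℝ A (g m) - Δ • ∑ j ∈ Finset.range m, F j)‖ ≤ Δ := by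
  set φ : ℕ → ℝ → ℝ := fun j t => max (g (j + 1) - t) 0 - max (g j - t) 0 with hφ
  have hsum : ∑ j ∈ Finset.range m, cfc (φ j) K = algebraMap ℝ A (g m) - K := by
    rw [← cfc_sum _ _ _ fun _ _ => contR _ _]
    have : algebraMap ℝ A (g m) - K = cfc (fun x => g m - x) K := by
      rw [cfcR_sub, cfc_const _ K, cfc_id' ℝ K]
    rw [this]
    refine cfc_congr fun t ht => ?_
    rw [Finset.sum_apply]
    simp only [hφ]
    rw [Finset.sum_range_sub (fun j => max (g j - t) 0), max_eq_left (sub_nonneg.2 (hhi t ht)),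
      max_eq_right (sub_nonpos.2 (hlo t ht)), sub_zero]
  have hup : ∀ j, cfc (φ j) K ≤ Δ • ind (Set.Iic (g (j + 1))) K := fun j => by
    rw [ind, ← cfc_smul _ _ _ (contR _ _)]
    refine cfc_mono (fun t _ => ?_) (contR _ _) (contR _ _)
    simp only [hφ, hg]
    by_cases ht : t ≤ g j + Δ
    · rw [Set.indicator_of_mem (by simpa using ht), max_eq_left (by linarith), smul_eq_mul]
      linarith [le_max_left (g j - t) 0]
    · rw [Set.indicator_of_notMem (by simpa using ht), max_eq_right (by linarith),
        max_eq_right (by linarith), smul_zero, sub_zero]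
  have hdn : ∀ j, Δ • ind (Set.Iic (g j)) K ≤ cfc (φ j) K := fun j => by
    rw [ind, ← cfc_smul _ _ _ (contR _ _)]
    refine cfc_mono (fun t _ => ?_) (contR _ _) (contR _ _)
    simp only [hφ, hg]
    by_cases ht : t ≤ g j
    · rw [Set.indicator_of_mem (by simpa using ht), max_eq_left (by linarith),
        max_eq_left (by linarith), smul_eq_mul]
      linarith
    · rw [Set.indicator_of_notMem (by simpa using ht), max_eq_right (a := g j - t) (by linarith),
        smul_zero, sub_zero]
      exact le_max_right _ _
  have htel : ∑ j ∈ Finset.range m, (Δ • ind (Set.Iic (g (j + 1))) K - Δ • ind (Set.Iic (g j)) K)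
      ≤ algebraMap ℝ A Δ := by
    rw [Finset.sum_range_sub (fun j => Δ • ind (Set.Iic (g j)) K), ← smul_sub,
      ind_eq_one (s := Set.Iic (g m)) hK hhi, ← ind_compl hK, Algebra.algebraMap_eq_smul_one]
    refine smul_le_smul_of_nonneg_left ?_ hΔ.le
    exact proj_le_of_mul_eq (star_ind _ _) (ind_mul_self _ _) (star_one _) (mul_one _) (mul_one _)
  set x := ∑ j ∈ Finset.range m, (Δ • F j - cfc (φ j) K) with hx
  have e : K - (algebraMap ℝ A (g m) - Δ • ∑ j ∈ Finset.range m, F j) = x := by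
    rw [hx, Finset.sum_sub_distrib, hsum, Finset.smul_sum]; abel
  have hxs : IsSelfAdjoint x := by
    rw [hx, isSelfAdjoint_iff, star_sum]
    refine Finset.sum_congr rfl fun j _ => ?_
    rw [star_sub, star_smul, star_trivial, h.star_eq,
      (IsSelfAdjoint.cfc (f := φ j) (a := K)).star_eq]
  rw [e]
  refine norm_le_of_neg_le_le hxs ?_ ?_
  · rw [map_neg, neg_le, hx, ← Finset.sum_neg_distrib]
    refine (Finset.sum_le_sum fun j _ => ?_).trans htel
    rw [neg_sub]
    exact sub_le_sub (hup j) (smul_le_smul_of_nonneg_left (h.ind_le j) hΔ.le)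
  · refine (Finset.sum_le_sum fun j _ => ?_).trans htel
    exact sub_le_sub (smul_le_smul_of_nonneg_left (h.le_ind j) hΔ.le) (hdn j)

/-- An element close to a unitary is close to the unitary part of its polar decomposition. -/
lemma exists_unitary_near (hU : U ∈ unitary A) {N : A} {θ : ℝ} (hθ : θ < 1) (hN : ‖U - N‖ ≤ θ) :
    ∃ V : A, star V * V = 1 ∧ V * star V = 1 ∧ ‖U - V‖ ≤ 4 * θ ∧
      ∀ P, star P = P → Commute P N → Commute P V := by
  obtain ⟨hU1, hU2⟩ := Unitary.mem_iff.1 hU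
  have hUn := norm_le_one_of_unitary hU1 hU2
  have hu : IsUnit N := by
    have e : N = U * (1 - star U * (U - N)) := by
      rw [mul_sub, ← mul_assoc, hU2, mul_one, one_mul, sub_sub_cancel]
    rw [e]
    refine (Units.isUnit ⟨U, star U, hU2, hU1⟩).mul (isUnit_one_sub_of_norm_lt_one ?_)
    refine (norm_mul_le _ _).trans_lt ?_
    rw [norm_star]
    have := mul_le_of_le_one_left (norm_nonneg (U - N)) hUn
    linarith
  obtain ⟨V, H, hV, hV', -, hVH, hc, hH⟩ := exists_polar hu
  refine ⟨V, hV, hV', ?_, hc⟩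
  have hθ0 := (norm_nonneg _).trans hN
  have hVn := norm_le_one_of_unitary hV hV'
  have e1 : star N * N - 1 = star (U - N) * (U - N) - star (U - N) * U - star U * (U - N) := by
    rw [← hU1, star_sub]; noncomm_ring
  have h1 : ‖star N * N - 1‖ ≤ 3 * θ := by
    rw [e1]
    have a1 := norm_sub_le (star (U - N) * (U - N) - star (U - N) * U) (star U * (U - N))
    have a2 := norm_sub_le (star (U - N) * (U - N)) (star (U - N) * U)
    have a3 := norm_mul_le (star (U - N)) (U - N)
    have a4 := norm_mul_le (star (U - N)) U
    have a5 := norm_mul_le (star U) (U - N)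
    rw [norm_star] at a3 a4 a5
    nlinarith [norm_nonneg (U - N)]
  have e2 : U - V = (U - N) + V * (H - 1) := by rw [mul_sub, hVH]; simp
  rw [e2]
  refine (norm_add_le _ _).trans ?_
  have := (norm_mul_le V (H - 1)).trans (mul_le_of_le_one_left (norm_nonneg _) hVn)
  linarith

/-- A cut family with small commutators produces a nearby commuting pair. -/
theorem IsCutFamily.exists_commuting (h : IsCutFamily K g F) (hK : IsSelfAdjoint K)
    (hK1 : ‖K‖ ≤ 1) (hU : U ∈ unitary A) (h0 : F 0 = 0) (h1 : ∀ l, m ≤ l → F l = 1) {b Δ θ : ℝ}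
    (hΔ : 0 < Δ) (hg : ∀ j, g (j + 1) = g j + Δ) (hlo : g 0 ≤ -1) (hhi : 1 ≤ g m)
    (hb : ∀ j, ‖F j * U - U * F j‖ ≤ b)
    (hθ : 4 * b + m ^ 2 * (‖U * K - K * U‖ / Δ) ≤ θ) (hθ1 : θ < 1) :
    ∃ U' K' : A, star U' * U' = 1 ∧ U' * star U' = 1 ∧ star K' = K' ∧ ‖K'‖ ≤ 1 ∧
      U' * K' = K' * U' ∧ ‖U - U'‖ ≤ 4 * θ ∧ ‖K - K'‖ ≤ 2 * Δ := by
  have hp := h.isPVM h0 (h1 m le_rfl)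
  have hgl : ∀ j r, g j + Δ ≤ g (j + 1 + r) := fun j r => by
    induction r with
    | zero => exact (hg j).ge
    | succ r ih => rw [← add_assoc, hg]; linarith
  have hglt : ∀ j l, j < l → g j + Δ ≤ g l := fun j l hjl => by
    obtain ⟨r, rfl⟩ := Nat.exists_eq_add_of_lt hjl
    rw [add_right_comm]; exact hgl j r
  have hθ' := (h.norm_sub_pinch_le hK h0 h1 hΔ hglt hb).trans hθ
  obtain ⟨V, hV, hV', hUV, hc⟩ := exists_unitary_near hU hθ1 hθ'
  have hcQ : ∀ j ∈ Finset.range m, Commute (cutDiff F j) V := fun j hj =>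
    hc _ (hp.star_eq j) (commute_pinch hp U hj)
  have hcF : ∀ j ∈ Finset.range m, Commute (F j) V := fun j hj => by
    have : F j = ∑ i ∈ Finset.range j, cutDiff F i := by
      simp only [cutDiff]; rw [Finset.sum_range_sub, h0, sub_zero]
    rw [this]
    refine Commute.sum_left _ _ _ fun i hi => hcQ i ?_
    rw [Finset.mem_range] at *
    omega
  set L := algebraMap ℝ A (g m) - Δ • ∑ j ∈ Finset.range m, F j with hL
  have hKL : ‖K - L‖ ≤ Δ := h.norm_sub_le hK hΔ hg
    (fun r hr => hlo.trans (by linarith [(abs_le.1 ((abs_le_norm_of_mem hK hr).trans hK1)).1]))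
    (fun r hr => (abs_le.1 ((abs_le_norm_of_mem hK hr).trans hK1)).2.trans hhi)
  have hLn : ‖L‖ ≤ 1 + Δ := by
    have := _root_.norm_sub_le K (K - L)
    rw [sub_sub_cancel] at this
    linarith
  have hLs : star L = L := by
    rw [hL, star_sub, star_smul, star_sum, star_trivial Δ, ← algebraMap_star_comm,
      star_trivial (g m)]
    simp only [h.star_eq]
  have hLV : Commute L V := by
    refine Commute.sub_left (Algebra.commutes _ _) ?_
    exact (Commute.sum_left _ _ _ hcF).smul_left _
  have hd : 0 < 1 + Δ := by linarith
  refine ⟨V, (1 + Δ)⁻¹ • L, hV, hV', ?_, ?_, ?_, hUV, ?_⟩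
  · rw [star_smul, star_trivial, hLs]
  · rw [norm_smul, Real.norm_eq_abs, abs_of_pos (inv_pos.2 hd), inv_mul_le_iff₀ hd, mul_one]
    exact hLn
  · exact (hLV.smul_left _).symm.eq
  · have e : K - (1 + Δ)⁻¹ • L = (K - L) + (Δ * (1 + Δ)⁻¹) • L := by
      have : Δ * (1 + Δ)⁻¹ = 1 - (1 + Δ)⁻¹ := by field_simp; ring
      rw [this, sub_smul, one_smul]; abel
    rw [e]
    refine (norm_add_le _ _).trans ?_
    rw [norm_smul, Real.norm_eq_abs, abs_of_pos (by positivity), mul_assoc]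
    have : (1 + Δ)⁻¹ * ‖L‖ ≤ 1 := by rw [inv_mul_le_iff₀ hd, mul_one]; exact hLn
    nlinarith

end assemble

section smallCommutator

variable {A : Type*} [CStarAlgebra A] [PartialOrder A] [StarOrderedRing A] [FinSpec A]
  [Nontrivial A] {K U : A} {η c ε : ℝ}

/-- A cut of width `ε` around `r`, from the gap of the Cayley model at scale `ε ^ 2`. -/
lemma exists_cut_of_gap (hη : 0 < η) (hc : 0 < c)
    (hgap : ∀ D : GapData A, D.Approx η → ∀ p, c * ‖p‖ ≤ ‖(D.T - D.k) * p‖)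
    (hε : 0 < ε) (hε1 : 96 * ε ≤ 1) (hεη : 48 * ε ≤ η) (hU : U ∈ unitary A)
    (hK : IsSelfAdjoint K) (hδ : ‖U * K - K * U‖ ≤ ε ^ 6) (p : ℝ) :
    ∃ F : A, star F = F ∧ F * F = F ∧ ind (Set.Iic p) K * F = ind (Set.Iic p) K ∧
      F * ind (Set.Iic (p + ε)) K = F ∧ ‖F * U - U * F‖ ≤ (132 / c + 192) * ε := by
  have hs : 0 < ε ^ 2 := by positivity
  set r := (p + (p + ε)) / 2 with hr
  set k : A := (ε ^ 2)⁻¹ • (K - algebraMap ℝ A r) with hk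
  have hks : IsSelfAdjoint k :=
    (IsSelfAdjoint.all _).smul (hK.sub ((IsSelfAdjoint.all _).algebraMap A))
  have hUr : U * algebraMap ℝ A r = algebraMap ℝ A r * U := (Algebra.commutes r U).symm
  have hcomm : U * k - k * U = (ε ^ 2)⁻¹ • (U * K - K * U) := by
    rw [hk, mul_smul_comm, smul_mul_assoc, ← smul_sub, mul_sub, sub_mul, hUr]
    congr 1; abel
  have hcn : ‖U * k - k * U‖ ≤ ε ^ 4 := by
    rw [hcomm, norm_smul, Real.norm_eq_abs, abs_of_pos (inv_pos.2 hs), inv_mul_le_iff₀ hs]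
    calc _ ≤ ε ^ 6 := hδ
      _ = ε ^ 2 * ε ^ 4 := by ring
  set M := ⌈1 / ε⌉₊ with hM
  have hM1 : 1 / ε ≤ M := Nat.le_ceil _
  have hM2 : (M : ℝ) ≤ 2 / ε := by
    have h1 := (Nat.ceil_lt_add_one (one_div_pos.2 hε).le).le
    have h2 : (1 : ℝ) ≤ 1 / ε := by rw [le_div_iff₀ hε]; linarith
    calc (M : ℝ) ≤ 1 / ε + 1 := h1
      _ ≤ 1 / ε + 1 / ε := by linarith
      _ = 2 / ε := by ring
  have hMp : (0 : ℝ) < M := (one_div_pos.2 hε).trans_le hM1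
  have hM0 : M ≠ 0 := fun h => by rw [h] at hMp; simp at hMp
  have hMη : 6 * (M : ℝ) ^ 3 * ‖U * k - k * U‖ ≤ η := by
    calc 6 * (M : ℝ) ^ 3 * ‖U * k - k * U‖ ≤ 6 * (2 / ε) ^ 3 * ε ^ 4 := by gcongr
      _ = 48 * ε := by field_simp; ring
      _ ≤ η := hεη
  obtain ⟨D, hDk, hD, hTs, hT3, hTU⟩ := exists_gapData hM0 hU hks hη hMη
  have hB : ε ^ 2 • D.T - (K - algebraMap ℝ A r) = ε ^ 2 • (D.T - k) := by
    rw [smul_sub, hk, smul_smul, mul_inv_cancel₀ hs.ne', one_smul]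
  have hq : (p + ε) - p = ε := by ring
  have h32 : 32 / (M : ℝ) ≤ 32 * ε := by
    rw [div_le_iff₀ hMp]
    rw [div_le_iff₀ hε] at hM1
    linarith
  have h4 : ε ^ 4 ≤ ε := by
    calc ε ^ 4 ≤ ε ^ 1 := pow_le_pow_of_le_one hε.le (by linarith) (by norm_num)
      _ = ε := pow_one ε
  obtain ⟨F, h1, h2, h3, h5, h6⟩ := exists_cut (K := K) (T := D.T) (U := U) (p := p) (q := p + ε)
    (s := ε ^ 2) (κ := 33 * ε) hK hTs hT3
    (norm_le_one_of_unitary (Unitary.mem_iff.1 hU).1 (Unitary.mem_iff.1 hU).2) hs hc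
    (by rw [hq]; nlinarith) rfl
    (fun x => by
      rw [← hr, hB, smul_mul_assoc, norm_smul, Real.norm_eq_abs, abs_of_pos hs, mul_assoc, ← hDk]
      exact mul_le_mul_of_nonneg_left (hgap D hD x) hs.le)
    (by
      rw [← hr, hB, smul_mul_assoc, mul_smul_comm, ← smul_sub, norm_smul, Real.norm_eq_abs,
        abs_of_pos hs]
      refine mul_le_mul_of_nonneg_left ?_ hs.le
      have e : (D.T - k) * U - U * (D.T - k) = (D.T * U - U * D.T) + (U * k - k * U) := by
        noncomm_ring
      rw [e]
      exact (norm_add_le _ _).trans (by linarith))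
  refine ⟨F, h1, h2, h3, h5, h6.trans_eq ?_⟩
  rw [hq]
  field_simp
  ring

theorem exists_commuting_of_gap (hη : 0 < η) (hc : 0 < c)
    (hgap : ∀ D : GapData A, D.Approx η → ∀ p, c * ‖p‖ ≤ ‖(D.T - D.k) * p‖)
    (hε : 0 < ε) (hε1 : 96 * ε ≤ 1) (hεη : 48 * ε ≤ η)
    (hsmall : (4 * (132 / c + 192) + 9) * ε < 1) (hU : U ∈ unitary A)
    (hK : IsSelfAdjoint K) (hK1 : ‖K‖ ≤ 1) (hδ : ‖U * K - K * U‖ ≤ ε ^ 6) :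
    ∃ U' K' : A, star U' * U' = 1 ∧ U' * star U' = 1 ∧ star K' = K' ∧ ‖K'‖ ≤ 1 ∧
      U' * K' = K' * U' ∧ ‖U - U'‖ ≤ 4 * ((4 * (132 / c + 192) + 9) * ε) ∧ ‖K - K'‖ ≤ 2 * ε := by
  set g : ℕ → ℝ := fun j => -1 + ((j : ℝ) - 2) * ε with hg
  have hgs : ∀ j, g (j + 1) = g j + ε := fun j => by simp only [hg]; push_cast; ring
  choose F hF1 hF2 hF3 hF4 hF5 using fun j =>
    exists_cut_of_gap hη hc hgap hε hε1 hεη hU hK hδ (g j)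
  have hF : IsCutFamily K g F := ⟨hF1, hF2, hF3, fun j => by rw [hgs]; exact hF4 j⟩
  set m := ⌈2 / ε⌉₊ + 2 with hm
  have hm1 : 2 / ε + 2 ≤ m := by rw [hm]; push_cast; linarith [Nat.le_ceil (2 / ε)]
  have hm2 : (m : ℝ) ≤ 2 / ε + 3 := by
    rw [hm]; push_cast; linarith [Nat.ceil_lt_add_one (div_pos two_pos hε).le]
  have hmε : (m : ℝ) * ε ≤ 3 := by
    calc (m : ℝ) * ε ≤ (2 / ε + 3) * ε := by gcongr
      _ = 2 + 3 * ε := by field_simp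
      _ ≤ 3 := by linarith
  have hgm : ∀ l, m ≤ l → 1 ≤ g l := fun l hl => by
    have h1 : (m : ℝ) ≤ l := by exact_mod_cast hl
    have h2 : 2 / ε * ε ≤ ((l : ℝ) - 2) * ε := by gcongr; linarith
    rw [div_mul_cancel₀ _ hε.ne'] at h2
    simp only [hg]; linarith
  have h0 : F 0 = 0 := by
    rw [← hF.high 0]
    have : ind (Set.Iic (g (0 + 1))) K = 0 := ind_eq_zero fun r hr hr' => by
      have h1 := (abs_le.1 ((abs_le_norm_of_mem hK hr).trans hK1)).1
      have h2 : r ≤ g (0 + 1) := hr'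
      simp only [hg] at h2
      norm_num at h2
      linarith
    rw [this, mul_zero]
  have h1 : ∀ l, m ≤ l → F l = 1 := fun l hl => by
    have : ind (Set.Iic (g l)) K = 1 := ind_eq_one hK fun r hr =>
      (abs_le.1 ((abs_le_norm_of_mem hK hr).trans hK1)).2.trans (hgm l hl)
    have h2 := hF.low l
    rwa [this, one_mul] at h2
  refine hF.exists_commuting (m := m) hK hK1 hU h0 h1 hε hgs (by simp only [hg]; norm_num; linarith)
    (hgm m le_rfl) hF5 ?_ hsmall
  have h3 : ‖U * K - K * U‖ / ε ≤ ε ^ 5 := by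
    rw [div_le_iff₀ hε]
    calc _ ≤ ε ^ 6 := hδ
      _ = ε ^ 5 * ε := by ring
  have h4 : (m : ℝ) ^ 2 * (‖U * K - K * U‖ / ε) ≤ 9 * ε := by
    calc (m : ℝ) ^ 2 * (‖U * K - K * U‖ / ε) ≤ (m : ℝ) ^ 2 * ε ^ 5 := by gcongr
      _ = (m * ε) ^ 2 * (ε ^ 2 * ε) := by ring
      _ ≤ 3 ^ 2 * (1 * ε) := by
        gcongr
        nlinarith
      _ = 9 * ε := by ring
  linarith

end smallCommutator

section matrices
open scoped Matrix.Norms.L2Operator MatrixOrder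

instance finSpec_matrix (n : ℕ) : FinSpec (Matrix (Fin n) (Fin n) ℂ) :=
  ⟨fun a => Matrix.finite_spectrum a⟩

/-- A linear bound in terms of the sixth root of the commutator norm. -/
theorem exists_linear_bound : ∃ C : ℝ, 0 < C ∧ ∀ (n : ℕ), 1 ≤ n → ∀ ε : ℝ, 0 < ε →
    ∀ U K : Matrix (Fin n) (Fin n) ℂ, U ∈ unitary (Matrix (Fin n) (Fin n) ℂ) →
    IsSelfAdjoint K → ‖K‖ ≤ 1 → ‖U * K - K * U‖ ≤ ε ^ 6 →
    ∃ U' K' : Matrix (Fin n) (Fin n) ℂ, star U' * U' = 1 ∧ U' * star U' = 1 ∧ star K' = K' ∧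
      ‖K'‖ ≤ 1 ∧ U' * K' = K' * U' ∧ ‖U - U'‖ ≤ C * ε ∧ ‖K - K'‖ ≤ C * ε := by
  obtain ⟨η, hη, c, hc, hgap⟩ := GapData.exists_gap
  set C₁ := 4 * (4 * (132 / c + 192) + 9) with hC₁
  have hC₁p : 2 ≤ C₁ := by
    have : 0 < 132 / c := by positivity
    rw [hC₁]; linarith
  set ε₀ := min (1 / 96) (min (η / 48) (1 / C₁)) with hε₀
  have hε₀p : 0 < ε₀ := lt_min (by norm_num) (lt_min (by positivity) (by positivity))
  refine ⟨max C₁ (2 / ε₀), by positivity, fun n hn ε hε U K hU hK hK1 hδ => ?_⟩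
  have : Nonempty (Fin n) := ⟨⟨0, hn⟩⟩
  rcases le_or_gt ε ε₀ with hle | hlt
  · have h1 : ε ≤ 1 / 96 := hle.trans (min_le_left _ _)
    have h2 : ε ≤ η / 48 := hle.trans ((min_le_right _ _).trans (min_le_left _ _))
    have h3 : ε ≤ 1 / C₁ := hle.trans ((min_le_right _ _).trans (min_le_right _ _))
    rw [le_div_iff₀ (by positivity)] at h1 h2 h3
    obtain ⟨U', K', a1, a2, a3, a4, a5, a6, a7⟩ := exists_commuting_of_gap hη hc (hgap n) hε
      (by linarith) (by linarith) (by linarith) hU hK hK1 hδ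
    refine ⟨U', K', a1, a2, a3, a4, a5, ?_, ?_⟩
    · refine a6.trans ?_
      rw [← mul_assoc, ← hC₁]
      exact mul_le_mul_of_nonneg_right (le_max_left _ _) hε.le
    · exact a7.trans (mul_le_mul_of_nonneg_right (hC₁p.trans (le_max_left _ _)) hε.le)
  · have h2 : 2 ≤ max C₁ (2 / ε₀) * ε := by
      calc 2 = 2 / ε₀ * ε₀ := (div_mul_cancel₀ _ hε₀p.ne').symm
        _ ≤ max C₁ (2 / ε₀) * ε := by gcongr; exact le_max_right _ _
    refine ⟨1, K, by simp, by simp, hK.star_eq, hK1, by simp, ?_, ?_⟩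
    · have h3 := norm_sub_le U 1
      have h4 := norm_le_one_of_unitary (Unitary.mem_iff.1 hU).1 (Unitary.mem_iff.1 hU).2
      rw [CStarRing.norm_one] at h3
      linarith
    · rw [sub_self, norm_zero]; linarith

end matrices

/-- Theorem (`thm:cylinderQuantitative`): there is a dimension-independent function `ε`
with `ε(δ) = E(1/δ)·δ^{1/6}` (so `ε(δ)/δ^{1/6−α} → 0` as `δ → 0⁺` for every
`α ∈ (0, 1/6)`) such that any δ-representation of the cylinder (a unitary `U` and a
Hermitian contraction `K` with `‖[U,K]‖ ≤ δ`) is within `ε(δ)` of an exact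
representation of the cylinder. -/
theorem cylinder_quantitative :
    ∃ ε : ℝ → ℝ,
      (∀ δ > (0 : ℝ), 0 < ε δ) ∧
      (∀ α ∈ Set.Ioo (0 : ℝ) (1/6),
        Filter.Tendsto (fun δ : ℝ => ε δ / δ ^ ((1:ℝ)/6 - α))
          (nhdsWithin 0 (Set.Ioi 0)) (nhds 0)) ∧
      (∀ (n : ℕ), 1 ≤ n → ∀ δ : ℝ, 0 < δ →
        ∀ U K : Matrix (Fin n) (Fin n) ℂ,
          Uᴴ * U = 1 → U * Uᴴ = 1 →
          K.IsHermitian → AC.opNorm K ≤ 1 →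
          AC.opNorm (U * K - K * U) ≤ δ →
          ∃ U' K' : Matrix (Fin n) (Fin n) ℂ,
            U'ᴴ * U' = 1 ∧ U' * U'ᴴ = 1 ∧
            K'.IsHermitian ∧ AC.opNorm K' ≤ 1 ∧
            U' * K' = K' * U' ∧
            AC.opNorm (U - U') ≤ ε δ ∧ AC.opNorm (K - K') ≤ ε δ) := by
  obtain ⟨C, hC, h⟩ := exists_linear_bound
  refine ⟨fun δ => C * δ ^ ((1 : ℝ) / 6), fun δ hδ => mul_pos hC (Real.rpow_pos_of_pos hδ _),
    fun α hα => ?_, fun n hn δ hδ U K hU hU' hK hK1 hUK => ?_⟩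
  · have h1 : Filter.Tendsto (fun δ : ℝ => C * δ ^ α) (nhdsWithin 0 (Set.Ioi 0)) (nhds 0) := by
      have h2 := ((Real.continuousAt_rpow_const 0 α (Or.inr hα.1.le)).tendsto.const_mul C).mono_left
        (nhdsWithin_le_nhds (s := Set.Ioi 0))
      rwa [Real.zero_rpow hα.1.ne', mul_zero] at h2
    refine h1.congr' ?_
    filter_upwards [self_mem_nhdsWithin] with δ hδ
    rw [mul_div_assoc, ← Real.rpow_sub hδ]
    congr 2
    ring
  · have hε : (δ ^ ((1 : ℝ) / 6)) ^ 6 = δ := by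
      rw [← Real.rpow_natCast, ← Real.rpow_mul hδ.le]
      norm_num
    exact h n hn _ (Real.rpow_pos_of_pos hδ _) U K (Unitary.mem_iff.2 ⟨hU, hU'⟩) hK hK1
      (hUK.trans_eq hε.symm)
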